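/- arXiv:1709.06441 — 2 statements merged into one kernel-verified Lean document; each statement's English description precedes it below -/
import Mathlib

section
/- Let i, j, k ≥ 6 and let (t₁, t₂, t₃) be a permutation of (i, j, k). Write G = ⟨a, b; a^i, b^j, (ab)^k⟩ and H = ⟨x₁, x₂, x₃; x₁^{t₁}, x₂^{t₂}, x₃^{t₃}, x₁x₂x₃⟩. If f: G → H is an isomorphism, then there exist an inner automorphism γ of H, distinct indices p, q ∈ {1, 2, 3}, and ε = ±1 such that fγ(a) = x_p^ε and fγ(b) = x_q^ε. [Here fγ(a) means applying γ after f is composed in the sense f∘γ evaluated on the generator a of G; equivalently, after composing f with an inner automorphism of H, the generators a and b are sent to x_p^ε and x_q^ε respectively.] -/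
/-- The subgroup of inner automorphisms of `G`. -/
def Inn (G : Type*) [Group G] : Subgroup (MulAut G) := (MulAut.conj (G := G)).range

/-- The relators of the triangle group `T_{i,j,k}` on two generators. -/
def triangleRels (i j k : ℕ) : Set (FreeGroup (Fin 2)) :=
  {FreeGroup.of 0 ^ i, FreeGroup.of 1 ^ j, (FreeGroup.of 0 * FreeGroup.of 1) ^ k}

/-- The triangle group `T_{i,j,k} = ⟨a, b; a^i, b^j, (ab)^k⟩`. -/
abbrev TriangleGroup (i j k : ℕ) := PresentedGroup (triangleRels i j k)

/-- The relators of `⟨x₁, x₂, x₃; x₁^{t₁}, x₂^{t₂}, x₃^{t₃}, x₁x₂x₃⟩`. -/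
def triangleRels₃ (t : Fin 3 → ℕ) : Set (FreeGroup (Fin 3)) :=
  {FreeGroup.of 0 ^ t 0, FreeGroup.of 1 ^ t 1, FreeGroup.of 2 ^ t 2,
   FreeGroup.of 0 * FreeGroup.of 1 * FreeGroup.of 2}

/-- The triangle group `⟨x₁, x₂, x₃; x₁^{t₁}, x₂^{t₂}, x₃^{t₃}, x₁x₂x₃⟩`. -/
abbrev TriangleGroup₃ (t : Fin 3 → ℕ) := PresentedGroup (triangleRels₃ t)

namespace TriZ
open Matrix

/-- Gram matrix of the triangle with cosines `c`. -/
def Gm (c : Fin 3 → ℝ) : Matrix (Fin 3) (Fin 3) ℝ :=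
  !![1, -c 2, -c 1; -c 2, 1, -c 0; -c 1, -c 0, 1]

/-- Adjugate of the Gram matrix. -/
def Qm (c : Fin 3 → ℝ) : Matrix (Fin 3) (Fin 3) ℝ :=
  !![1 - c 0 ^ 2, c 2 + c 0 * c 1, c 1 + c 0 * c 2;
     c 2 + c 0 * c 1, 1 - c 1 ^ 2, c 0 + c 1 * c 2;
     c 1 + c 0 * c 2, c 0 + c 1 * c 2, 1 - c 2 ^ 2]

/-- Cross product matrix. -/
def Xm (x : Fin 3 → ℝ) : Matrix (Fin 3) (Fin 3) ℝ :=
  !![0, -x 2, x 1; x 2, 0, -x 0; -x 1, x 0, 0]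

/-- The simple reflections. -/
def Sm (c : Fin 3 → ℝ) (p : Fin 3) : Matrix (Fin 3) (Fin 3) ℝ :=
  fun a b => (if a = b then 1 else 0) - if a = p then 2 * Gm c p b else 0

/-- The adjugate quadratic form on functionals. -/
def Qf (c : Fin 3 → ℝ) (x y : Fin 3 → ℝ) : ℝ := x ⬝ᵥ (Qm c *ᵥ y)

/-- Rotation around the functional `x` with parameters `l`, `m`. -/
def Nm (c : Fin 3 → ℝ) (x : Fin 3 → ℝ) (l m : ℝ) : Matrix (Fin 3) (Fin 3) ℝ :=
  (1 - 2 * l ^ 2 * Qf c x x) • 1 + (2 * l ^ 2) • vecMulVec (Qm c *ᵥ x) x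
    + (2 * l * m) • (Xm x * Gm c)

/-- Simple roots and fundamental functionals: standard basis vectors. -/
def E (p : Fin 3) : Fin 3 → ℝ := Pi.single p 1

lemma Sm_sq (c : Fin 3 → ℝ) (p : Fin 3) : Sm c p * Sm c p = 1 := by
  ext a b
  fin_cases p <;> fin_cases a <;> fin_cases b <;>
    simp [Sm, Gm, Matrix.mul_apply, Fin.sum_univ_three] <;> ring

lemma Sm_mul_Sm (c : Fin 3 → ℝ) (p : Fin 3) :
    Sm c (p + 1) * Sm c (p + 2) = Nm c (E p) 1 (c p) := by
  ext a b
  fin_cases p <;> fin_cases a <;> fin_cases b <;>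
    simp [E, Nm, Xm, Qm, Qf, Sm, Gm, Matrix.mul_apply, Fin.sum_univ_three, vecMulVec_apply,
      mulVec, dotProduct] <;> ring

lemma Nm_mul (c : Fin 3 → ℝ) (p : Fin 3) (l m : ℝ) (h : l ^ 2 * (1 - c p ^ 2) + m ^ 2 = 1) :
    Nm c (E p) l m * Nm c (E p) 1 (c p) =
      Nm c (E p) (l * c p + m) (m * c p - l * (1 - c p ^ 2)) := by
  have h' : m ^ 2 = 1 - l ^ 2 * (1 - c p ^ 2) := by linarith
  ext a b
  fin_cases p <;> fin_cases a <;> fin_cases b <;>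
    simp [E, Nm, Xm, Qm, Qf, Gm, Matrix.mul_apply, Fin.sum_univ_three, vecMulVec_apply,
      mulVec, dotProduct, Matrix.one_apply] at h' ⊢ <;> ring_nf <;> simp only [h'] <;> ring

lemma Sm_Qm (c x : Fin 3 → ℝ) (p : Fin 3) : Qm c *ᵥ (x ᵥ* Sm c p) = Sm c p *ᵥ (Qm c *ᵥ x) := by
  ext a
  fin_cases p <;> fin_cases a <;>
    simp [Qm, Gm, Sm, Fin.sum_univ_three, mulVec, vecMul, dotProduct] <;> ring

lemma Sm_Xm (c x : Fin 3 → ℝ) (p : Fin 3) :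
    Sm c p * (Xm x * Gm c) * Sm c p = - (Xm (x ᵥ* Sm c p) * Gm c) := by
  ext a b
  fin_cases p <;> fin_cases a <;> fin_cases b <;>
    simp [Xm, Gm, Sm, Matrix.mul_apply, Fin.sum_univ_three, vecMul, dotProduct] <;> ring

lemma Qf_act (c x y : Fin 3 → ℝ) (p : Fin 3) :
    Qf c (x ᵥ* Sm c p) (y ᵥ* Sm c p) = Qf c x y := by
  fin_cases p <;> 
    simp [Qm, Qf, Gm, Sm, Fin.sum_univ_three, mulVec, vecMul, dotProduct] <;> ring

lemma Sm_conj (c x : Fin 3 → ℝ) (p : Fin 3) (l m : ℝ) :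
    Sm c p * Nm c x l m * Sm c p = Nm c (x ᵥ* Sm c p) l (-m) := by
  unfold Nm
  rw [Qf_act, mul_add, mul_add, add_mul, add_mul, mul_smul_comm, mul_smul_comm,
    mul_smul_comm, smul_mul_assoc, smul_mul_assoc, smul_mul_assoc, mul_one, Sm_sq, Sm_Xm, mul_vecMulVec, vecMulVec_mul, Sm_Qm]
  simp

lemma trace_XG (c x : Fin 3 → ℝ) : (Xm x * Gm c).trace = 0 := by
  simp [Xm, Gm, Matrix.mul_apply, Fin.sum_univ_three, trace]; ring

lemma trace_XGXG (c x y : Fin 3 → ℝ) : (Xm x * Gm c * (Xm y * Gm c)).trace = - 2 * Qf c x y := by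
  simp [Xm, Gm, Matrix.mul_apply, Fin.sum_univ_three, trace, Qf, Qm, mulVec, dotProduct]; ring

lemma Qf_symm (c x y : Fin 3 → ℝ) : Qf c x y = Qf c y x := by
  simp [Fin.sum_univ_three, Qf, Qm, mulVec, dotProduct]; ring

lemma XG_Q (c x y : Fin 3 → ℝ) : y ⬝ᵥ ((Xm x * Gm c) *ᵥ (Qm c *ᵥ y)) = 0 := by
  simp [Xm, Gm, Matrix.mul_apply, Fin.sum_univ_three, Qm, mulVec, dotProduct]; ring

lemma trace_Nm (c x : Fin 3 → ℝ) (l m : ℝ) : (Nm c x l m).trace = 3 - 4 * l ^ 2 * Qf c x x := by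
  unfold Nm
  rw [trace_add, trace_add, trace_smul, trace_smul, trace_smul, trace_XG, trace_vecMulVec,
    dotProduct_comm]
  simp [Qf]; ring

lemma trace_Nm_mul (c x y : Fin 3 → ℝ) (l m l' m' : ℝ) (h : m ^ 2 = 1 - l ^ 2 * Qf c x x)
    (h' : m' ^ 2 = 1 - l' ^ 2 * Qf c y y) :
    (Nm c x l m * Nm c y l' m').trace = 4 * (l * l' * Qf c x y - m * m') ^ 2 - 1 := by
  have e : 4 * (l * l' * Qf c x y - m * m') ^ 2 - 1 = 4 * (l * l' * Qf c x y) ^ 2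
    - 8 * l * l' * m * m' * Qf c x y + 4 * (1 - l ^ 2 * Qf c x x) * (1 - l' ^ 2 * Qf c y y) - 1 := by
    rw [← h, ← h']; ring
  rw [e]
  have t1 : (vecMulVec (Qm c *ᵥ x) x).trace = Qf c x x := by
    rw [trace_vecMulVec, dotProduct_comm]; rfl
  have t2 : (vecMulVec (Qm c *ᵥ y) y).trace = Qf c y y := by
    rw [trace_vecMulVec, dotProduct_comm]; rfl
  have t3 : (vecMulVec (Qm c *ᵥ x) x * vecMulVec (Qm c *ᵥ y) y).trace = Qf c x y ^ 2 := by
    rw [vecMulVec_mul_vecMulVec, trace_vecMulVec, dotProduct_smul, dotProduct_comm _ y]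
    rw [show x ⬝ᵥ (Qm c *ᵥ y) = Qf c x y from rfl, show y ⬝ᵥ (Qm c *ᵥ x) = Qf c y x from rfl,
      Qf_symm c y x]
    simp; ring
  have t4 : (vecMulVec (Qm c *ᵥ x) x * (Xm y * Gm c)).trace = 0 := by
    rw [trace_mul_comm, mul_vecMulVec, trace_vecMulVec, dotProduct_comm]
    exact XG_Q c y x
  have t5 : (Xm x * Gm c * vecMulVec (Qm c *ᵥ y) y).trace = 0 := by
    rw [mul_vecMulVec, trace_vecMulVec, dotProduct_comm]
    exact XG_Q c x y
  unfold Nm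
  simp only [add_mul, mul_add, smul_mul_assoc, mul_smul_comm, mul_one, one_mul, trace_add, trace_smul, t1, t2,
    t3, t4, t5, trace_XG, trace_XGXG, trace_one, smul_eq_mul, Fintype.card_fin]
  push_cast
  ring

lemma Nm_zero (c x : Fin 3 → ℝ) (m : ℝ) : Nm c x 0 m = 1 := by
  simp [Nm]

end TriZ

namespace TriZ
open Matrix

/-- Angle at vertex `p`. -/
noncomputable def th (t : Fin 3 → ℕ) (p : Fin 3) : ℝ := Real.pi / t p

/-- Cosines of the angles. -/
noncomputable def cc (t : Fin 3 → ℕ) (p : Fin 3) : ℝ := Real.cos (th t p)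

lemma th_pos {t : Fin 3 → ℕ} (ht : ∀ p, 6 ≤ t p) (p : Fin 3) : 0 < th t p := by
  have : (6 : ℝ) ≤ t p := by exact_mod_cast ht p
  unfold th
  have := Real.pi_pos
  positivity

lemma th_mul {t : Fin 3 → ℕ} (ht : ∀ p, 6 ≤ t p) (p : Fin 3) : (t p : ℝ) * th t p = Real.pi := by
  have : (6 : ℝ) ≤ t p := by exact_mod_cast ht p
  unfold th
  field_simp

lemma th_le {t : Fin 3 → ℕ} (ht : ∀ p, 6 ≤ t p) (p : Fin 3) : th t p ≤ Real.pi / 6 := by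
  have : (6 : ℝ) ≤ t p := by exact_mod_cast ht p
  unfold th
  have := Real.pi_pos
  gcongr

lemma sin_th_pos {t : Fin 3 → ℕ} (ht : ∀ p, 6 ≤ t p) (p : Fin 3) : 0 < Real.sin (th t p) := by
  apply Real.sin_pos_of_pos_of_lt_pi (th_pos ht p)
  have := th_le ht p
  have := Real.pi_pos
  linarith

lemma cc_ge {t : Fin 3 → ℕ} (ht : ∀ p, 6 ≤ t p) (p : Fin 3) : 43 / 50 ≤ cc t p := by
  have h1 : Real.cos (Real.pi / 6) ≤ cc t p := by
    apply Real.cos_le_cos_of_nonneg_of_le_pi (th_pos ht p).le _ (th_le ht p)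
    have := Real.pi_pos
    linarith
  rw [Real.cos_pi_div_six] at h1
  have : (86 / 50 : ℝ) ≤ Real.sqrt 3 := by
    apply Real.le_sqrt_of_sq_le; norm_num
  linarith

lemma cc_lt {t : Fin 3 → ℕ} (ht : ∀ p, 6 ≤ t p) (p : Fin 3) : cc t p < 1 := by
  have h := sin_th_pos ht p
  have := Real.sin_sq_add_cos_sq (th t p)
  unfold cc
  nlinarith

/-- `sin (n θ) / sin θ`. -/
noncomputable def U (t : Fin 3 → ℕ) (p : Fin 3) (n : ℕ) : ℝ :=
  Real.sin (n * th t p) / Real.sin (th t p)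

lemma U_zero (t : Fin 3 → ℕ) (p : Fin 3) : U t p 0 = 0 := by simp [U]

lemma U_one {t : Fin 3 → ℕ} (ht : ∀ p, 6 ≤ t p) (p : Fin 3) : U t p 1 = 1 := by
  have := sin_th_pos ht p
  simp [U, this.ne']

lemma U_top {t : Fin 3 → ℕ} (ht : ∀ p, 6 ≤ t p) (p : Fin 3) : U t p (t p) = 0 := by
  simp [U, th_mul ht p]

lemma U_succ {t : Fin 3 → ℕ} (ht : ∀ p, 6 ≤ t p) (p : Fin 3) (n : ℕ) :
    U t p (n + 1) = U t p n * cc t p + Real.cos (n * th t p) := by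
  have := sin_th_pos ht p
  unfold U cc
  push_cast
  rw [add_mul, one_mul, Real.sin_add]
  field_simp

lemma U_add_two {t : Fin 3 → ℕ} (ht : ∀ p, 6 ≤ t p) (p : Fin 3) (n : ℕ) :
    U t p (n + 2) = 2 * cc t p * U t p (n + 1) - U t p n := by
  have := sin_th_pos ht p
  unfold U cc
  push_cast
  rw [show ((n : ℝ) + 2) * th t p = (n + 1) * th t p + th t p by ring,
    show (n : ℝ) * th t p = (n + 1) * th t p - th t p by ring, Real.sin_add, Real.sin_sub]
  field_simp
  ring

lemma sin_mono_aux {a x : ℝ} (ha : 0 ≤ a) (h1 : a ≤ x) (h2 : x ≤ Real.pi - a) :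
    Real.sin a ≤ Real.sin x := by
  rcases le_total x (Real.pi / 2) with h | h
  · exact Real.sin_le_sin_of_le_of_le_pi_div_two (by linarith [Real.pi_pos]) h h1
  · rw [← Real.sin_pi_sub x]
    exact Real.sin_le_sin_of_le_of_le_pi_div_two (by linarith [Real.pi_pos]) (by linarith)
      (by linarith)

lemma U_ge {t : Fin 3 → ℕ} (ht : ∀ p, 6 ≤ t p) (p : Fin 3) (n : ℕ) (h1 : 1 ≤ n) (h2 : n < t p) :
    1 ≤ U t p n := by
  have hs := sin_th_pos ht p
  unfold U
  rw [le_div_iff₀ hs, one_mul]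
  have hn : (1 : ℝ) ≤ n := by exact_mod_cast h1
  have hn' : (n : ℝ) + 1 ≤ t p := by exact_mod_cast h2
  have hp := th_pos ht p
  have hm := th_mul ht p
  apply sin_mono_aux hp.le
  · nlinarith
  · nlinarith

/-- `0` or at least `1`. -/
def P01 (x : ℝ) : Prop := x = 0 ∨ 1 ≤ x

lemma P01.nonneg {x : ℝ} (h : P01 x) : 0 ≤ x := by
  rcases h with h | h <;> linarith

lemma P01.add {x y : ℝ} (h : P01 x) (h' : P01 y) : P01 (x + y) := by
  have := h.nonneg
  have := h'.nonneg
  rcases h with h | h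
  · rcases h' with h' | h'
    · left; linarith
    · right; linarith
  · right; linarith

lemma P01.mul {x y : ℝ} (h : P01 x) (h' : P01 y) : P01 (x * y) := by
  rcases h with h | h
  · left; simp [h]
  · rcases h' with h' | h'
    · left; simp [h']
    · right; nlinarith

lemma U_P01 {t : Fin 3 → ℕ} (ht : ∀ p, 6 ≤ t p) (p : Fin 3) (n : ℕ) (h2 : n ≤ t p) :
    P01 (U t p n) := by
  rcases Nat.eq_zero_or_pos n with rfl | h
  · left; exact U_zero t p
  · rcases h2.lt_or_eq with h' | rfl
    · right; exact U_ge ht p n h h'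
    · left; exact U_top ht p

lemma Nm_pow {t : Fin 3 → ℕ} (ht : ∀ p, 6 ≤ t p) (p : Fin 3) (n : ℕ) :
    Nm (cc t) (E p) 1 (cc t p) ^ n = Nm (cc t) (E p) (U t p n) (Real.cos (n * th t p)) := by
  induction n with
  | zero => simp [U_zero, Nm_zero]
  | succ n ih =>
    have hs := sin_th_pos ht p
    have e1 : 1 - cc t p ^ 2 = Real.sin (th t p) ^ 2 := by
      have := Real.sin_sq_add_cos_sq (th t p)
      unfold cc; linarith
    rw [pow_succ, ih, Nm_mul, U_succ ht]
    · congr 1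
      push_cast
      rw [e1, add_mul, one_mul, Real.cos_add]
      unfold U cc
      field_simp
    · rw [e1]
      unfold U
      rw [div_pow, div_mul_cancel₀ _ (by positivity)]
      exact Real.sin_sq_add_cos_sq _

lemma fin3_cases {p q : Fin 3} (h : p ≠ q) :
    ∃ r : Fin 3, -(p + q) = r ∧ ((p = r + 1 ∧ q = r + 2) ∨ (p = r + 2 ∧ q = r + 1)) := by
  revert p q; decide

/-- The Coxeter matrix of the triangle. -/
def CM (t : Fin 3 → ℕ) (ht : ∀ p, 6 ≤ t p) : CoxeterMatrix (Fin 3) where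
  M := Matrix.of fun p q => if p = q then 1 else t (-(p + q))
  isSymm := by
    ext p q
    simp [eq_comm, add_comm]
  diagonal := by intro p; simp
  off_diagonal := by
    intro p q h
    have := ht (-(p + q))
    simp only [Matrix.of_apply, if_neg h]
    omega

lemma CM_apply (t : Fin 3 → ℕ) (ht : ∀ p, 6 ≤ t p) (p q : Fin 3) :
    (CM t ht) p q = if p = q then 1 else t (-(p + q)) := rfl

lemma liftable {t : Fin 3 → ℕ} (ht : ∀ p, 6 ≤ t p) : (CM t ht).IsLiftable (Sm (cc t)) := by
  intro p q
  by_cases h : p = q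
  · subst h
    simp [CM_apply, Sm_sq]
  · rw [CM_apply, if_neg h]
    obtain ⟨r, hr, h'⟩ := fin3_cases h
    rw [hr]
    have key : (Sm (cc t) (r + 1) * Sm (cc t) (r + 2)) ^ (t r) = 1 := by
      rw [Sm_mul_Sm, Nm_pow ht, U_top ht, Nm_zero]
    rcases h' with ⟨rfl, rfl⟩ | ⟨rfl, rfl⟩
    · exact key
    · have e : (Sm (cc t) (r + 1) * Sm (cc t) (r + 2)) ^ (t r)
          * (Sm (cc t) (r + 2) * Sm (cc t) (r + 1)) ^ (t r) = 1 := by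
        have hab : (Sm (cc t) (r + 1) * Sm (cc t) (r + 2))
          * (Sm (cc t) (r + 2) * Sm (cc t) (r + 1)) = 1 := by
          rw [mul_assoc, ← mul_assoc (Sm (cc t) (r + 2)), Sm_sq, one_mul, Sm_sq]
        have hba : (Sm (cc t) (r + 2) * Sm (cc t) (r + 1))
          * (Sm (cc t) (r + 1) * Sm (cc t) (r + 2)) = 1 := by
          rw [mul_assoc, ← mul_assoc (Sm (cc t) (r + 1)), Sm_sq, one_mul, Sm_sq]
        have hc : Commute (Sm (cc t) (r + 1) * Sm (cc t) (r + 2))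
          (Sm (cc t) (r + 2) * Sm (cc t) (r + 1)) := hab.trans hba.symm
        rw [← hc.mul_pow, hab, one_pow]
      rwa [key, one_mul] at e

/-- The Coxeter system of the triangle. -/
abbrev cs (t : Fin 3 → ℕ) (ht : ∀ p, 6 ≤ t p) : CoxeterSystem (CM t ht) (CM t ht).Group :=
  (CM t ht).toCoxeterSystem

/-- The geometric representation. -/
noncomputable def rho (t : Fin 3 → ℕ) (ht : ∀ p, 6 ≤ t p) :
    (CM t ht).Group →* Matrix (Fin 3) (Fin 3) ℝ := (cs t ht).lift ⟨Sm (cc t), liftable ht⟩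

lemma rho_simple (t : Fin 3 → ℕ) (ht : ∀ p, 6 ≤ t p) (p : Fin 3) :
    rho t ht ((cs t ht).simple p) = Sm (cc t) p := (cs t ht).lift_apply_simple (liftable ht) p

lemma Sm_E (c : Fin 3 → ℝ) {p q : Fin 3} (h : p ≠ q) :
    Sm c q *ᵥ E p = E p + (2 * c (-(p + q))) • E q := by
  ext a
  fin_cases p <;> fin_cases q <;> first | exact absurd rfl h | skip
  all_goals fin_cases a
  all_goals simp [Sm, E, Gm, mulVec, dotProduct, Fin.sum_univ_three]
  all_goals rfl

lemma Sm_E_self (c : Fin 3 → ℝ) (p : Fin 3) : Sm c p *ᵥ E p = - E p := by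
  ext a
  fin_cases p <;> fin_cases a <;>
    simp [Sm, E, Gm, mulVec, dotProduct, Fin.sum_univ_three] <;> norm_num

lemma rho_alt {t : Fin 3 → ℕ} (ht : ∀ p, 6 ≤ t p) {p q : Fin 3} (h : p ≠ q) (n : ℕ) :
    rho t ht ((cs t ht).wordProd (CoxeterSystem.alternatingWord p q n)) *ᵥ E p =
      if Even n then U t (-(p + q)) (n + 1) • E p + U t (-(p + q)) n • E q
      else U t (-(p + q)) n • E p + U t (-(p + q)) (n + 1) • E q := by
  induction n with
  | zero => simp [CoxeterSystem.alternatingWord, U_zero, U_one ht]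
  | succ n ih =>
    rw [CoxeterSystem.alternatingWord_succ', CoxeterSystem.wordProd_cons, map_mul,
      ← mulVec_mulVec, ih, rho_simple]
    by_cases hn : Even n
    · have hn' : ¬ Even (n + 1) := by simpa [Nat.even_add_one] using hn
      rw [if_pos hn, if_pos hn, if_neg hn', mulVec_add, mulVec_smul, mulVec_smul, Sm_E _ h,
        Sm_E_self, U_add_two ht]
      module
    · have hn' : Even (n + 1) := by simpa [Nat.even_add_one] using hn
      rw [if_neg hn, if_neg hn, if_pos hn', mulVec_add, mulVec_smul, mulVec_smul, Sm_E _ h.symm,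
        Sm_E_self, U_add_two ht, add_comm q p]
      module

end TriZ

namespace TriZ
open Matrix

/-- The Coxeter group of the triangle. -/
abbrev WW (t : Fin 3 → ℕ) (ht : ∀ p, 6 ≤ t p) := (CM t ht).Group

/-- Positive vectors, all of whose coordinates are `0` or at least `1`. -/
def isPos (b : Fin 3 → ℝ) : Prop := ∀ a, P01 (b a)

lemma isPos_E (p : Fin 3) : isPos (E p) := by
  intro a
  by_cases h : a = p
  · subst h; right; simp [E]
  · left; simp [E, h]

lemma isPos_comb {x y : ℝ} {b b' : Fin 3 → ℝ} (hx : P01 x) (hy : P01 y) (hb : isPos b)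
    (hb' : isPos b') : isPos (x • b + y • b') := by
  intro a
  simpa using (hx.mul (hb a)).add (hy.mul (hb' a))

variable {t : Fin 3 → ℕ} (ht : ∀ p, 6 ≤ t p)

theorem tits (w : WW t ht) (p : Fin 3) (h : ¬ (cs t ht).IsRightDescent w p) :
    isPos (rho t ht w *ᵥ E p) := by
  induction hl : (cs t ht).length w using Nat.strong_induction_on generalizing w p with
  | _ L ih =>
  subst hl
  by_cases hw : w = 1
  · subst hw
    simpa using isPos_E p
  obtain ⟨q, hq⟩ := (cs t ht).exists_rightDescent_of_ne_one hw
  have hpq : p ≠ q := by rintro rfl; exact h hq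
  let A : ℕ → Prop := fun n => ∃ v : WW t ht,
    w = v * (cs t ht).wordProd (CoxeterSystem.alternatingWord p q n) ∧
      (cs t ht).length v + n = (cs t ht).length w
  have hA1 : A 1 := by
    refine ⟨w * (cs t ht).simple q, ?_, ?_⟩
    · rw [CoxeterSystem.alternatingWord_succ, CoxeterSystem.wordProd_concat]
      simp only [CoxeterSystem.alternatingWord, CoxeterSystem.wordProd_nil, one_mul]
      exact ((cs t ht).simple_mul_simple_cancel_right q).symm
    · exact ((cs t ht).isRightDescent_iff).1 hq
  obtain ⟨n, hn1, ⟨v, hv, hvl⟩, hn⟩ : ∃ n, 1 ≤ n ∧ A n ∧ ¬ A (n + 1) := by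
    by_contra hcon
    push Not at hcon
    have hall : ∀ n, 1 ≤ n → A n := by
      intro n hn
      induction n, hn using Nat.le_induction with
      | base => exact hA1
      | succ n hn ihn => exact hcon n hn ihn
    obtain ⟨v, -, hv⟩ := hall ((cs t ht).length w + 1) (by omega)
    omega
  -- neither is a descent of `v`
  have hr : ¬ (cs t ht).IsRightDescent v (if Even n then q else p) := by
    intro hd
    apply hn
    refine ⟨v * (cs t ht).simple (if Even n then q else p), ?_, ?_⟩
    · rw [CoxeterSystem.alternatingWord_succ', CoxeterSystem.wordProd_cons, mul_assoc,
        CoxeterSystem.simple_mul_simple_cancel_left]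
      exact hv
    · have := ((cs t ht).isRightDescent_iff).1 hd
      omega
  have hr' : ¬ (cs t ht).IsRightDescent v (if Even n then p else q) := by
    intro hd
    obtain ⟨k, rfl⟩ : ∃ k, n = k + 1 := ⟨n - 1, by omega⟩
    have e : (if Even (k + 1) then p else q) = (if Even k then q else p) := by
      by_cases hk : Even k
      · have hk' : ¬ Even (k + 1) := by simpa [Nat.even_add_one] using hk
        simp [hk, hk']
      · have hk' : Even (k + 1) := by simpa [Nat.even_add_one] using hk
        simp [hk, hk']
    rw [e] at hd
    rw [CoxeterSystem.alternatingWord_succ', CoxeterSystem.wordProd_cons, ← mul_assoc] at hv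
    have h1 := (cs t ht).length_mul_le (v * (cs t ht).simple (if Even k then q else p))
      ((cs t ht).wordProd (CoxeterSystem.alternatingWord p q k))
    rw [← hv] at h1
    have h2 := (cs t ht).length_wordProd_le (CoxeterSystem.alternatingWord p q k)
    rw [CoxeterSystem.length_alternatingWord] at h2
    have := ((cs t ht).isRightDescent_iff).1 hd
    omega
  have hvp : ¬ (cs t ht).IsRightDescent v p := by
    by_cases hk : Even n
    · simpa [hk] using hr'
    · simpa [hk] using hr
  have hvq : ¬ (cs t ht).IsRightDescent v q := by
    by_cases hk : Even n
    · simpa [hk] using hr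
    · simpa [hk] using hr'
  have ihp := ih _ (by omega) v p hvp rfl
  have ihq := ih _ (by omega) v q hvq rfl
  have hnm : n < t (-(p + q)) := by
    by_contra hcon
    have hM : (CM t ht) q p = t (-(p + q)) := by
      rw [CM_apply, if_neg hpq.symm, add_comm]
    have h1 := (cs t ht).not_isReduced_alternatingWord q p (m := n + 1)
      (by rw [hM]; have := ht (-(p + q)); omega) (by rw [hM]; omega)
    unfold CoxeterSystem.IsReduced at h1
    rw [CoxeterSystem.length_alternatingWord] at h1
    have h2 := (cs t ht).length_wordProd_le (CoxeterSystem.alternatingWord q p (n + 1))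
    rw [CoxeterSystem.length_alternatingWord] at h2
    have h3 : w * (cs t ht).simple p =
        v * (cs t ht).wordProd (CoxeterSystem.alternatingWord q p (n + 1)) := by
      rw [CoxeterSystem.alternatingWord_succ, CoxeterSystem.wordProd_concat, ← mul_assoc, ← hv]
    have h4 := (cs t ht).length_mul_le v
      ((cs t ht).wordProd (CoxeterSystem.alternatingWord q p (n + 1)))
    rw [← h3] at h4
    have h5 := ((cs t ht).not_isRightDescent_iff).1 h
    omega
  have U1 := U_P01 ht (-(p + q)) n (by omega)
  have U2 := U_P01 ht (-(p + q)) (n + 1) (by omega)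
  rw [hv, map_mul, ← mulVec_mulVec, rho_alt ht hpq]
  split_ifs
  · rw [mulVec_add, mulVec_smul, mulVec_smul]
    exact isPos_comb U2 U1 ihp ihq
  · rw [mulVec_add, mulVec_smul, mulVec_smul]
    exact isPos_comb U1 U2 ihp ihq

lemma rho_mul_inv (g : WW t ht) : rho t ht g * rho t ht g⁻¹ = 1 := by
  rw [← map_mul, mul_inv_cancel, map_one]

lemma rho_inv_mul (g : WW t ht) : rho t ht g⁻¹ * rho t ht g = 1 := by
  rw [← map_mul, inv_mul_cancel, map_one]

/-- Roots. -/
def isRoot (b : Fin 3 → ℝ) : Prop := ∃ (w : WW t ht) (p : Fin 3), b = rho t ht w *ᵥ E p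

lemma isRoot_E (p : Fin 3) : isRoot ht (E p) := ⟨1, p, by simp⟩

lemma isRoot_Sm {b : Fin 3 → ℝ} (hb : isRoot ht b) (p : Fin 3) : isRoot ht (Sm (cc t) p *ᵥ b) := by
  obtain ⟨w, q, rfl⟩ := hb
  refine ⟨(cs t ht).simple p * w, q, ?_⟩
  rw [map_mul, rho_simple, mulVec_mulVec]

lemma neg_of_descent (w : WW t ht) (p : Fin 3) (h : (cs t ht).IsRightDescent w p) :
    isPos (-(rho t ht w *ᵥ E p)) := by
  have h' := ((cs t ht).isRightDescent_iff_not_isRightDescent_mul).1 h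
  have := tits ht _ p h'
  rwa [map_mul, rho_simple, ← mulVec_mulVec, Sm_E_self, mulVec_neg] at this

lemma root_dich {b : Fin 3 → ℝ} (hb : isRoot ht b) : isPos b ∨ isPos (-b) := by
  obtain ⟨w, p, rfl⟩ := hb
  by_cases h : (cs t ht).IsRightDescent w p
  · right; exact neg_of_descent ht w p h
  · left; exact tits ht w p h

lemma Gm_Sm (c y : Fin 3 → ℝ) (p : Fin 3) : Gm c *ᵥ (Sm c p *ᵥ y) = (Gm c *ᵥ y) ᵥ* Sm c p := by
  ext a
  fin_cases p <;> fin_cases a <;>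
    simp [Gm, Sm, Fin.sum_univ_three, mulVec, vecMul, dotProduct] <;> ring

lemma Gm_rho (g : WW t ht) (y : Fin 3 → ℝ) :
    Gm (cc t) *ᵥ (rho t ht g *ᵥ y) = (Gm (cc t) *ᵥ y) ᵥ* rho t ht g⁻¹ := by
  induction g using (cs t ht).simple_induction_left with
  | one => simp
  | mul_simple_left w p ih =>
    rw [map_mul, ← mulVec_mulVec, rho_simple, Gm_Sm, ih, _root_.mul_inv_rev, map_mul, vecMul_vecMul,
      CoxeterSystem.inv_simple, rho_simple]

lemma root_norm {b : Fin 3 → ℝ} (hb : isRoot ht b) : b ⬝ᵥ (Gm (cc t) *ᵥ b) = 1 := by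
  obtain ⟨w, p, rfl⟩ := hb
  rw [Gm_rho, dotProduct_comm, ← dotProduct_mulVec, mulVec_mulVec, rho_inv_mul, one_mulVec]
  fin_cases p <;> simp [Gm, E]

lemma Sm_mulVec_ne (c y : Fin 3 → ℝ) {p a : Fin 3} (h : a ≠ p) : (Sm c p *ᵥ y) a = y a := by
  simp [Sm, mulVec, dotProduct, h]

lemma Sm_Sm (c y : Fin 3 → ℝ) (p : Fin 3) : Sm c p *ᵥ (Sm c p *ᵥ y) = y := by
  rw [mulVec_mulVec, Sm_sq, one_mulVec]

lemma Sm_pos {b : Fin 3 → ℝ} (hb : isRoot ht b) (hp : isPos b) {p : Fin 3} (hne : b ≠ E p) :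
    isPos (Sm (cc t) p *ᵥ b) := by
  rcases root_dich ht (isRoot_Sm ht hb p) with h | h
  · exact h
  exfalso
  have h0 : ∀ a, a ≠ p → b a = 0 := by
    intro a ha
    have h1 := (h a).nonneg
    have h2 := (hp a).nonneg
    rw [Pi.neg_apply, Sm_mulVec_ne _ _ ha] at h1
    linarith
  have hbE : b = b p • E p := by
    ext a
    by_cases ha : a = p
    · subst ha; simp [E]
    · simp [E, ha, h0 a ha]
  have hn := root_norm ht hb
  have hn' : E p ⬝ᵥ (Gm (cc t) *ᵥ E p) = 1 := root_norm ht (isRoot_E ht p)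
  rw [hbE, mulVec_smul, smul_dotProduct, dotProduct_smul, hn'] at hn
  simp at hn
  have := (hp p).nonneg
  have h1 : b p = 1 := by nlinarith
  apply hne
  rw [hbE, h1, one_smul]

/-- Positive roots on which the functional is negative. -/
def Neg (x : Fin 3 → ℝ) : Set (Fin 3 → ℝ) := {b | isRoot ht b ∧ isPos b ∧ x ⬝ᵥ b < 0}

lemma Neg_act {x : Fin 3 → ℝ} (h : (Neg ht x).Finite) (p : Fin 3) :
    (Neg ht (x ᵥ* Sm (cc t) p)).Finite := by
  apply ((Set.finite_singleton (E p)).union (h.image (fun b => Sm (cc t) p *ᵥ b))).subset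
  rintro b ⟨hr, hp, hn⟩
  by_cases hb : b = E p
  · left; exact hb
  · right
    refine ⟨Sm (cc t) p *ᵥ b, ⟨isRoot_Sm ht hr p, Sm_pos ht hr hp hb, ?_⟩, Sm_Sm _ _ _⟩
    rwa [dotProduct_mulVec]

lemma Neg_act_rho {x : Fin 3 → ℝ} (h : (Neg ht x).Finite) (g : WW t ht) :
    (Neg ht (x ᵥ* rho t ht g)).Finite := by
  induction g using (cs t ht).simple_induction_right with
  | one => simpa using h
  | mul_simple_right w p ih =>
    rw [map_mul, rho_simple, ← vecMul_vecMul]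
    exact Neg_act ht ih p

lemma exists_chamber {x : Fin 3 → ℝ} (h : (Neg ht x).Finite) :
    ∃ g : WW t ht, ∀ a, 0 ≤ (x ᵥ* rho t ht g) a := by
  induction hl : (Neg ht x).ncard using Nat.strong_induction_on generalizing x with
  | _ L ih =>
  subst hl
  by_cases hx : ∀ a, 0 ≤ x a
  · exact ⟨1, by simpa using hx⟩
  push Not at hx
  obtain ⟨p, hp⟩ := hx
  have hE : E p ∈ Neg ht x := ⟨isRoot_E ht p, isPos_E p, by simpa [E] using hp⟩
  have hsub : Neg ht (x ᵥ* Sm (cc t) p) ⊆ (fun b => Sm (cc t) p *ᵥ b) '' (Neg ht x \ {E p}) := by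
    rintro b ⟨hr, hpos, hn⟩
    rw [← dotProduct_mulVec] at hn
    have hb : b ≠ E p := by
      rintro rfl
      rw [Sm_E_self] at hn
      simp [E] at hn
      linarith
    refine ⟨Sm (cc t) p *ᵥ b, ⟨⟨isRoot_Sm ht hr p, Sm_pos ht hr hpos hb, hn⟩, ?_⟩, Sm_Sm _ _ _⟩
    intro hc
    have hc' : Sm (cc t) p *ᵥ b = E p := hc
    have : b = - E p := by rw [← Sm_E_self (cc t), ← hc', Sm_Sm]
    have h2 := (hpos p).nonneg
    rw [this] at h2
    simp [E] at h2
    linarith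
  have hlt : (Neg ht (x ᵥ* Sm (cc t) p)).ncard < (Neg ht x).ncard := by
    calc _ ≤ ((fun b => Sm (cc t) p *ᵥ b) '' (Neg ht x \ {E p})).ncard :=
          Set.ncard_le_ncard hsub ((h.sdiff).image _)
      _ ≤ (Neg ht x \ {E p}).ncard := Set.ncard_image_le h.sdiff
      _ < _ := Set.ncard_sdiff_singleton_lt_of_mem hE h
  obtain ⟨g, hg⟩ := ih _ hlt (Neg_act ht h p) rfl
  refine ⟨(cs t ht).simple p * g, ?_⟩
  rw [map_mul, rho_simple, ← vecMul_vecMul]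
  exact hg

lemma delta_ge (w : WW t ht) (a : Fin 3) : 1 ≤ (rho t ht w *ᵥ (fun _ => 1)) a := by
  induction hl : (cs t ht).length w using Nat.strong_induction_on generalizing w with
  | _ L ih =>
  subst hl
  by_cases hw : w = 1
  · subst hw; simp
  obtain ⟨p, hp⟩ := (cs t ht).exists_rightDescent_of_ne_one hw
  have h' := ((cs t ht).isRightDescent_iff_not_isRightDescent_mul).1 hp
  have h1 := ih _ hp (w * (cs t ht).simple p) rfl
  have h2 := (tits ht _ p h' a).nonneg
  have e : w = (w * (cs t ht).simple p) * (cs t ht).simple p :=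
    ((cs t ht).simple_mul_simple_cancel_right p).symm
  have hS : ∃ k : ℝ, 0 ≤ k ∧ Sm (cc t) p *ᵥ (fun _ => 1) = (fun _ => 1) + k • E p := by
    have c0 := cc_ge ht 0
    have c1 := cc_ge ht 1
    have c2 := cc_ge ht 2
    refine ⟨-2 * (Gm (cc t) *ᵥ (fun _ => 1)) p, ?_, ?_⟩
    · fin_cases p <;> simp [Gm, mulVec, dotProduct, Fin.sum_univ_three] <;> linarith
    · ext a
      fin_cases p <;> fin_cases a <;>
        simp [Sm, E, Gm, mulVec, dotProduct, Fin.sum_univ_three] <;> ring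
  obtain ⟨k, hk, hS⟩ := hS
  rw [e, map_mul, rho_simple, ← mulVec_mulVec, hS, mulVec_add, mulVec_smul, Pi.add_apply,
    Pi.smul_apply, smul_eq_mul]
  have := mul_nonneg hk h2
  linarith

lemma stab {x : Fin 3 → ℝ} (hx : ∀ a, 0 ≤ x a) (g : WW t ht) (hg : x ᵥ* rho t ht g = x) :
    g ∈ Subgroup.closure ((cs t ht).simple '' {a | x a = 0}) := by
  induction hl : (cs t ht).length g using Nat.strong_induction_on generalizing g with
  | _ L ih =>
  subst hl
  by_cases hw : g = 1
  · subst hw; exact one_mem _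
  obtain ⟨p, hp⟩ := (cs t ht).exists_leftDescent_of_ne_one hw
  have h1 := neg_of_descent ht g⁻¹ p (((cs t ht).isRightDescent_inv_iff).2 hp)
  have hg' : x ᵥ* rho t ht g⁻¹ = x := by
    conv_lhs => rw [← hg]
    rw [vecMul_vecMul, rho_mul_inv, vecMul_one]
  have h2 : x p ≤ 0 := by
    have e : x p = x ⬝ᵥ E p := by simp [E]
    rw [e]
    conv_lhs => rw [← hg', ← dotProduct_mulVec]
    have h3 : 0 ≤ x ⬝ᵥ (-(rho t ht g⁻¹ *ᵥ E p)) :=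
      Finset.sum_nonneg fun a _ => mul_nonneg (hx a) (h1 a).nonneg
    rw [dotProduct_neg] at h3
    linarith
  have h0 : x p = 0 := le_antisymm h2 (hx p)
  have hs : x ᵥ* Sm (cc t) p = x := by
    ext b
    simp [Sm, vecMul, dotProduct, mul_sub, Finset.sum_sub_distrib, h0]
  have h4 := ih _ hp ((cs t ht).simple p * g) (by
    rw [map_mul, rho_simple, ← vecMul_vecMul, hs, hg]) rfl
  have e : g = (cs t ht).simple p * ((cs t ht).simple p * g) :=
    ((cs t ht).simple_mul_simple_cancel_left p).symm
  rw [e]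
  exact mul_mem (Subgroup.subset_closure ⟨p, h0, rfl⟩) h4

end TriZ

namespace TriZ
open Matrix

variable {t : Fin 3 → ℕ} (ht : ∀ p, 6 ≤ t p)

/-- The rotation generators. -/
def rr (p : Fin 3) : WW t ht := (cs t ht).simple (p + 1) * (cs t ht).simple (p + 2)

/-- The standard parabolic fixing vertex `p`. -/
def WP (p : Fin 3) : Subgroup (WW t ht) :=
  Subgroup.closure ((cs t ht).simple '' {a | E p a = 0})

lemma E_eq_zero {p a : Fin 3} : E p a = 0 ↔ a ≠ p := by
  by_cases h : a = p
  · subst h; simp [E]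
  · simp [E, h]

lemma fin3_ne {p a : Fin 3} (h : a ≠ p) : a = p + 1 ∨ a = p + 2 := by
  revert p a; decide

lemma fin3_ne1 (p : Fin 3) : p + 1 ≠ p := by revert p; decide

lemma fin3_ne12 (p : Fin 3) : p + 1 ≠ p + 2 := by revert p; decide

lemma fin3_neg (p : Fin 3) : -(p + 1 + (p + 2)) = p := by revert p; decide

lemma ss (p : Fin 3) : (cs t ht).simple p * (cs t ht).simple p = 1 :=
  (cs t ht).simple_mul_simple_self p

lemma sinv (p : Fin 3) : ((cs t ht).simple p)⁻¹ = (cs t ht).simple p :=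
  (cs t ht).inv_simple p

lemma rr_inv (p : Fin 3) :
    (rr ht p)⁻¹ = (cs t ht).simple (p + 2) * (cs t ht).simple (p + 1) := by
  rw [rr, _root_.mul_inv_rev, sinv, sinv]

lemma simple_conj_rr {p a : Fin 3} (h : a ≠ p) :
    (cs t ht).simple a * rr ht p * ((cs t ht).simple a)⁻¹ = (rr ht p)⁻¹ := by
  rw [rr_inv, sinv]
  rcases fin3_ne h with rfl | rfl
  · rw [rr, ← mul_assoc, ss, one_mul]
  · rw [rr, mul_assoc, mul_assoc, ss, mul_one]

lemma simple_conj_rr_zpow {p a : Fin 3} (h : a ≠ p) (m : ℤ) :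
    (cs t ht).simple a * rr ht p ^ m * ((cs t ht).simple a)⁻¹ = rr ht p ^ (-m) := by
  rw [← conj_zpow, simple_conj_rr ht h, _root_.inv_zpow, _root_.zpow_neg]

lemma simple_zpow {p a : Fin 3} (h : a ≠ p) (m : ℤ) :
    (cs t ht).simple a * rr ht p ^ m = rr ht p ^ (-m) * (cs t ht).simple a := by
  rw [← simple_conj_rr_zpow ht h, inv_mul_cancel_right]

lemma WP_cases {p : Fin 3} {g : WW t ht} (hg : g ∈ WP ht p) :
    ∃ m : ℤ, g = rr ht p ^ m ∨ g = rr ht p ^ m * (cs t ht).simple (p + 1) := by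
  have hne1 : p + 1 ≠ p := fin3_ne1 p
  have hstep : ∀ a, a ≠ p → ∀ g : WW t ht,
      (∃ m : ℤ, g = rr ht p ^ m ∨ g = rr ht p ^ m * (cs t ht).simple (p + 1)) →
      ∃ m : ℤ, (cs t ht).simple a * g = rr ht p ^ m ∨
        (cs t ht).simple a * g = rr ht p ^ m * (cs t ht).simple (p + 1) := by
    rintro a ha g ⟨m, hm⟩
    have h1 : ∃ k : ℤ, (cs t ht).simple a = rr ht p ^ k * (cs t ht).simple (p + 1) := by
      rcases fin3_ne ha with rfl | rfl
      · exact ⟨0, by simp⟩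
      · refine ⟨-1, ?_⟩
        rw [_root_.zpow_neg, zpow_one, rr_inv, mul_assoc, ss, mul_one]
    obtain ⟨k, hk⟩ := h1
    rcases hm with rfl | rfl
    · refine ⟨k - m, Or.inr ?_⟩
      rw [hk, mul_assoc, simple_zpow ht hne1, ← mul_assoc, ← _root_.zpow_add]
      rfl
    · refine ⟨k - m, Or.inl ?_⟩
      rw [hk, mul_assoc, ← mul_assoc _ _ ((cs t ht).simple (p + 1)), simple_zpow ht hne1,
        mul_assoc, ss, mul_one, ← _root_.zpow_add]
      rfl
  unfold WP at hg
  induction hg using Subgroup.closure_induction_left with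
  | one => exact ⟨0, by simp⟩
  | mul_left x hx y hy ih =>
    obtain ⟨a, ha, rfl⟩ := hx
    exact hstep a (E_eq_zero.1 ha) y ih
  | inv_mul_cancel x hx y hy ih =>
    obtain ⟨a, ha, rfl⟩ := hx
    rw [sinv]
    exact hstep a (E_eq_zero.1 ha) y ih

lemma rr_pow_t (p : Fin 3) : rr ht p ^ t p = 1 := by
  have h := (cs t ht).simple_mul_simple_pow (p + 1) (p + 2)
  have h1 : p + 1 ≠ p + 2 := fin3_ne12 p
  have h2 : -(p + 1 + (p + 2)) = p := fin3_neg p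
  rwa [CM_apply, if_neg h1, h2] at h

lemma zpow_red (p : Fin 3) (m : ℤ) : ∃ n : ℕ, n < t p ∧ rr ht p ^ m = rr ht p ^ n := by
  have h6 := ht p
  have hpos : (0 : ℤ) < t p := by omega
  refine ⟨(m % t p).toNat, ?_, ?_⟩
  · have := Int.emod_lt_of_pos m hpos
    have := Int.emod_nonneg m hpos.ne'
    omega
  · have h1 := Int.emod_nonneg m hpos.ne'
    rw [← zpow_natCast, Int.toNat_of_nonneg h1]
    conv_lhs => rw [← Int.emod_add_mul_ediv m (t p), _root_.zpow_add, _root_.zpow_mul, zpow_natCast, rr_pow_t,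
      _root_.one_zpow, mul_one]

lemma WP_conj {p : Fin 3} {g : WW t ht} (hg : g ∈ WP ht p) (m : ℕ) :
    ∃ n : ℕ, n < t p ∧ g * rr ht p ^ m * g⁻¹ = rr ht p ^ n := by
  have hne1 : p + 1 ≠ p := fin3_ne1 p
  obtain ⟨k, hk⟩ := WP_cases ht hg
  have : ∃ k : ℤ, g * rr ht p ^ m * g⁻¹ = rr ht p ^ k := by
    rcases hk with rfl | rfl
    · refine ⟨m, ?_⟩
      rw [← zpow_natCast, ← _root_.zpow_neg, ← _root_.zpow_add, ← _root_.zpow_add]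
      congr 1; ring
    · refine ⟨-m, ?_⟩
      rw [_root_.mul_inv_rev, ← zpow_natCast]
      have := simple_conj_rr_zpow ht hne1 m
      calc _ = rr ht p ^ k * ((cs t ht).simple (p + 1) * rr ht p ^ (m : ℤ) *
            ((cs t ht).simple (p + 1))⁻¹) * (rr ht p ^ k)⁻¹ := by group
        _ = _ := by
          rw [this, ← _root_.zpow_neg, ← _root_.zpow_add, ← _root_.zpow_add]
          congr 1; ring
  obtain ⟨k, hk⟩ := this
  obtain ⟨n, hn, h⟩ := zpow_red ht p k
  exact ⟨n, hn, hk.trans h⟩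

lemma parity_simple (p : Fin 3) :
    (cs t ht).lengthParity ((cs t ht).simple p) = Multiplicative.ofAdd 1 :=
  (cs t ht).lengthParity_simple p

lemma parity_rr (p : Fin 3) : (cs t ht).lengthParity (rr ht p) = 1 := by
  rw [rr, map_mul, parity_simple, parity_simple]
  decide

theorem torsion (g : WW t ht) (n : ℕ) (hn : 0 < n) (hg : g ^ n = 1)
    (he : (cs t ht).lengthParity g = 1) :
    ∃ (w : WW t ht) (p : Fin 3) (m : ℕ), m < t p ∧ g = w * rr ht p ^ m * w⁻¹ := by
  let d : Fin 3 → ℝ := fun _ => 1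
  let x : Fin 3 → ℝ := ∑ k ∈ Finset.range n, d ᵥ* rho t ht (g ^ k)
  have hfix : x ᵥ* rho t ht g = x := by
    have h1 : x ᵥ* rho t ht g = ∑ k ∈ Finset.range n, d ᵥ* rho t ht (g ^ (k + 1)) := by
      simp only [x, sum_vecMul]
      apply Finset.sum_congr rfl
      intro k _
      rw [vecMul_vecMul, ← map_mul, pow_succ]
    have h2 := Finset.sum_range_succ (fun k => d ᵥ* rho t ht (g ^ k)) n
    have h3 := Finset.sum_range_succ' (fun k => d ᵥ* rho t ht (g ^ k)) n
    rw [h1]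
    rw [h2, hg, pow_zero] at h3
    exact (add_right_cancel h3).symm
  have hfin : (Neg ht x).Finite := by
    have h0 : (Neg ht d).Finite := by
      convert Set.finite_empty
      ext b
      simp only [Neg, Set.mem_ofPred_eq, Set.mem_empty_iff_false, iff_false, not_and, not_lt]
      intro _ hb
      exact Finset.sum_nonneg fun a _ => mul_nonneg zero_le_one (hb a).nonneg
    have hU : (⋃ k ∈ Finset.range n, Neg ht (d ᵥ* rho t ht (g ^ k))).Finite :=
      Set.Finite.biUnion (Finset.finite_toSet _) fun k _ => Neg_act_rho ht h0 _
    apply hU.subset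
    rintro b ⟨hr, hp, hneg⟩
    simp only [x, sum_dotProduct] at hneg
    obtain ⟨k, hk, hk'⟩ := Finset.exists_lt_of_sum_lt (s := Finset.range n)
      (f := fun k => (d ᵥ* rho t ht (g ^ k)) ⬝ᵥ b) (g := fun _ => 0) (by simpa using hneg)
    simp only [Set.mem_iUnion]
    exact ⟨k, hk, hr, hp, hk'⟩
  have hx0 : x ≠ 0 := by
    intro h0
    have h1 : 0 < x ⬝ᵥ d := by
      simp only [x, sum_dotProduct]
      apply Finset.sum_pos
      · intro k _
        rw [← dotProduct_mulVec]
        apply Finset.sum_pos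
        · intro a _
          have := delta_ge ht (g ^ k) a
          simp only [d]
          linarith
        · exact ⟨0, Finset.mem_univ _⟩
      · exact ⟨0, by simpa using hn⟩
    rw [h0] at h1
    simp at h1
  obtain ⟨w, hw⟩ := exists_chamber ht hfin
  set y := x ᵥ* rho t ht w with hy
  have hxy : x = y ᵥ* rho t ht w⁻¹ := by
    rw [hy, vecMul_vecMul, rho_mul_inv, vecMul_one]
  have hyfix : y ᵥ* rho t ht (w⁻¹ * g * w) = y := by
    rw [map_mul, map_mul, ← vecMul_vecMul, ← vecMul_vecMul, ← hxy, hfix]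
  have hst := stab ht hw _ hyfix
  obtain ⟨p, hp⟩ : ∃ p, y p ≠ 0 := by
    by_contra hcon
    push Not at hcon
    apply hx0
    rw [hxy, show y = 0 from funext hcon, zero_vecMul]
  have hst' : w⁻¹ * g * w ∈ WP ht p := by
    refine Subgroup.closure_mono (Set.image_mono ?_) hst
    intro a ha
    refine E_eq_zero.2 ?_
    rintro rfl
    exact hp ha
  have hpar : (cs t ht).lengthParity (w⁻¹ * g * w) = 1 := by
    rw [map_mul, map_mul, he, mul_one, ← map_mul, inv_mul_cancel, map_one]
  obtain ⟨m, hm⟩ := WP_cases ht hst'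
  rcases hm with hm | hm
  · obtain ⟨k, hk, hk'⟩ := zpow_red ht p m
    refine ⟨w, p, k, hk, ?_⟩
    rw [← hk', ← hm]
    group
  · exfalso
    rw [hm, map_mul, map_zpow, parity_rr, _root_.one_zpow, one_mul, parity_simple] at hpar
    revert hpar
    decide

lemma rho_rr_pow (p : Fin 3) (m : ℕ) :
    rho t ht (rr ht p ^ m) = Nm (cc t) (E p) (U t p m) (Real.cos (m * th t p)) := by
  rw [map_pow, rr, map_mul, rho_simple, rho_simple, Sm_mul_Sm, Nm_pow ht]

lemma Qf_self (c : Fin 3 → ℝ) (p : Fin 3) : Qf c (E p) (E p) = 1 - c p ^ 2 := by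
  fin_cases p <;> simp [Qf, Qm, E]

lemma trace_conj (w g : WW t ht) : (rho t ht (w * g * w⁻¹)).trace = (rho t ht g).trace := by
  rw [map_mul, map_mul, trace_mul_comm, ← mul_assoc, rho_inv_mul, one_mul]

lemma torsion_trace (g : WW t ht) (n : ℕ) (hn : 0 < n) (hg : g ^ n = 1)
    (he : (cs t ht).lengthParity g = 1) : (rho t ht g).trace ≤ 3 := by
  obtain ⟨w, p, m, -, rfl⟩ := torsion ht g n hn hg he
  rw [trace_conj, rho_rr_pow, trace_Nm, Qf_self]
  have h1 := cc_ge ht p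
  have h2 := cc_lt ht p
  have h3 : 0 ≤ 1 - cc t p ^ 2 := by nlinarith
  have := mul_nonneg (sq_nonneg (U t p m)) h3
  linarith

lemma Qf_rho (x y : Fin 3 → ℝ) (g : WW t ht) :
    Qf (cc t) (x ᵥ* rho t ht g) (y ᵥ* rho t ht g) = Qf (cc t) x y := by
  induction g using (cs t ht).simple_induction_right with
  | one => simp
  | mul_simple_right w p ih =>
    rw [map_mul, rho_simple, ← vecMul_vecMul, ← vecMul_vecMul, Qf_act, ih]

lemma rho_conj_Nm (g : WW t ht) (x : Fin 3 → ℝ) (l m : ℝ) : ∃ m' : ℝ, (m' = m ∨ m' = -m) ∧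
    rho t ht g * Nm (cc t) x l m * rho t ht g⁻¹ = Nm (cc t) (x ᵥ* rho t ht g⁻¹) l m' := by
  induction g using (cs t ht).simple_induction_left with
  | one => exact ⟨m, Or.inl rfl, by simp⟩
  | mul_simple_left w p ih =>
    obtain ⟨m', hm', h⟩ := ih
    refine ⟨-m', ?_, ?_⟩
    · rcases hm' with rfl | rfl
      · right; rfl
      · left; ring
    · rw [_root_.mul_inv_rev, sinv, map_mul, map_mul, rho_simple, ← vecMul_vecMul, ← Sm_conj, ← h]
      simp only [mul_assoc]

/-- Minus the determinant of the Gram matrix. -/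
def Dd (c : Fin 3 → ℝ) : ℝ := c 0 ^ 2 + c 1 ^ 2 + c 2 ^ 2 + 2 * c 0 * c 1 * c 2 - 1

lemma Dd_ge {t : Fin 3 → ℕ} (ht : ∀ p, 6 ≤ t p) : 2 ≤ Dd (cc t) := by
  have c0 := cc_ge ht 0
  have c1 := cc_ge ht 1
  have c2 := cc_ge ht 2
  have h01 : (43 / 50) * (43 / 50) ≤ cc t 0 * cc t 1 := mul_le_mul c0 c1 (by norm_num) (by linarith)
  have h012 : (43 / 50) * (43 / 50) * (43 / 50) ≤ cc t 0 * cc t 1 * cc t 2 :=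
    mul_le_mul h01 c2 (by norm_num) (by nlinarith)
  unfold Dd
  nlinarith

lemma Qf_Gm (c y : Fin 3 → ℝ) (p : Fin 3) : Qf c (E p) (Gm c *ᵥ y) = - Dd c * y p := by
  fin_cases p <;>
    simp [Qf, Qm, E, Gm, Dd, mulVec, dotProduct, Fin.sum_univ_three] <;> ring

lemma Qf_lin (c x y z : Fin 3 → ℝ) : Qf c x (y - (2 : ℝ) • z) = Qf c x y - 2 * Qf c x z := by
  simp [Qf, mulVec_sub, mulVec_smul, dotProduct_sub]

lemma E_vecMul_ne (c : Fin 3 → ℝ) {q a : Fin 3} (h : a ≠ q) : E q ᵥ* Sm c a = E q := by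
  ext b
  fin_cases q <;> fin_cases a <;> first | exact absurd rfl h | skip
  all_goals fin_cases b
  all_goals simp [Sm, E]

lemma E_vecMul_self (c : Fin 3 → ℝ) (q : Fin 3) :
    E q ᵥ* Sm c q = E q - (2 : ℝ) • (Gm c *ᵥ E q) := by
  ext b
  fin_cases q <;> fin_cases b <;> simp [Sm, E, Gm] 

lemma dist_bound (p q : Fin 3) (g : WW t ht) :
    Qf (cc t) (E p) (E q) ≤ Qf (cc t) (E p) (E q ᵥ* rho t ht g⁻¹) ∧
    ((∃ h₁ ∈ WP ht p, ∃ h₂ ∈ WP ht q, g = h₁ * h₂) ∨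
      Qf (cc t) (E p) (E q) + 2 * Dd (cc t) ≤ Qf (cc t) (E p) (E q ᵥ* rho t ht g⁻¹)) := by
  induction hl : (cs t ht).length g using Nat.strong_induction_on generalizing g with
  | _ L ih =>
  subst hl
  by_cases hw : g = 1
  · subst hw
    exact ⟨by simp, Or.inl ⟨1, one_mem _, 1, one_mem _, by simp⟩⟩
  obtain ⟨a, ha⟩ := (cs t ht).exists_rightDescent_of_ne_one hw
  have h' := ((cs t ht).isRightDescent_iff_not_isRightDescent_mul).1 ha
  have ih' := ih _ ha (g * (cs t ht).simple a) rfl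
  have e : g = (g * (cs t ht).simple a) * (cs t ht).simple a :=
    ((cs t ht).simple_mul_simple_cancel_right a).symm
  set g' := g * (cs t ht).simple a with hg'
  have e2 : E q ᵥ* rho t ht g⁻¹ = (E q ᵥ* Sm (cc t) a) ᵥ* rho t ht g'⁻¹ := by
    rw [e, _root_.mul_inv_rev, sinv, map_mul, rho_simple, vecMul_vecMul]
  by_cases haq : a = q
  · subst haq
    rw [E_vecMul_self, sub_vecMul, smul_vecMul, ← Gm_rho] at e2
    rw [e2, Qf_lin, Qf_Gm]
    have hpos := tits ht g' a h' p
    have hD := Dd_ge ht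
    obtain ⟨h1, h2⟩ := ih'
    have hnn := mul_nonneg (by linarith : 0 ≤ Dd (cc t)) hpos.nonneg
    refine ⟨by linarith, ?_⟩
    rcases h2 with ⟨x₁, hx₁, x₂, hx₂, hx⟩ | h2
    · rcases hpos with h0 | hge
      · left
        have hmem : g' * (cs t ht).simple a * g'⁻¹ ∈ WP ht p := by
          apply stab ht (x := E p)
          · intro b; exact (isPos_E p b).nonneg
          · have hz : (E p ᵥ* rho t ht g') a = 0 := by
              rw [← h0]
              simp [E, mulVec, vecMul]
            have hs : (E p ᵥ* rho t ht g') ᵥ* Sm (cc t) a = E p ᵥ* rho t ht g' := by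
              generalize E p ᵥ* rho t ht g' = z at hz
              ext b
              simp [Sm, vecMul, dotProduct, mul_sub, Finset.sum_sub_distrib, hz]
            rw [map_mul, map_mul, ← vecMul_vecMul, ← vecMul_vecMul, rho_simple, hs, vecMul_vecMul,
              rho_mul_inv, vecMul_one]
        refine ⟨_, mul_mem hmem hx₁, x₂, hx₂, ?_⟩
        rw [mul_assoc, ← hx, inv_mul_cancel_right]
        exact e
      · right
        have := mul_le_mul_of_nonneg_left hge (by linarith : 0 ≤ Dd (cc t))
        linarith
    · right; linarith
  · rw [E_vecMul_ne _ haq] at e2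
    rw [e2]
    refine ⟨ih'.1, ?_⟩
    rcases ih'.2 with ⟨x₁, hx₁, x₂, hx₂, hx⟩ | h2
    · left
      refine ⟨x₁, hx₁, x₂ * (cs t ht).simple a, mul_mem hx₂ ?_, ?_⟩
      · exact Subgroup.subset_closure ⟨a, E_eq_zero.2 haq, rfl⟩
      · rw [← mul_assoc, ← hx]; exact e
    · right; exact h2

end TriZ

namespace TriZ
open Matrix

lemma U_sq {t : Fin 3 → ℕ} (ht : ∀ p, 6 ≤ t p) (p : Fin 3) (n : ℕ) :
    Real.cos (n * th t p) ^ 2 = 1 - U t p n ^ 2 * Qf (cc t) (E p) (E p) := by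
  have hs := sin_th_pos ht p
  have h1 := Real.sin_sq_add_cos_sq (n * th t p)
  have h2 := Real.sin_sq_add_cos_sq (th t p)
  have h3 : Qf (cc t) (E p) (E p) = Real.sin (th t p) ^ 2 := by
    rw [Qf_self, cc]; linarith
  rw [h3, U, ← mul_pow, div_mul_cancel₀ _ hs.ne']
  linarith

lemma Qf_ne {t : Fin 3 → ℕ} (ht : ∀ p, 6 ≤ t p) {p q : Fin 3} (h : p ≠ q) :
    43 / 50 + cc t p * cc t q ≤ Qf (cc t) (E p) (E q) := by
  have h0 := cc_ge ht 0
  have h1 := cc_ge ht 1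
  have h2 := cc_ge ht 2
  fin_cases p <;> fin_cases q <;> first | exact absurd rfl h | skip
  all_goals simp [Qf, Qm, E]
  all_goals nlinarith

lemma Qf_nonneg {t : Fin 3 → ℕ} (ht : ∀ p, 6 ≤ t p) (p q : Fin 3) :
    0 ≤ Qf (cc t) (E p) (E q) := by
  have h1 := cc_ge ht p
  have h2 := cc_ge ht q
  have h3 := cc_lt ht p
  by_cases h : p = q
  · subst h
    rw [Qf_self]; nlinarith
  · have := Qf_ne ht h
    nlinarith

/-- If the trace of a product of two rotations is at most `3`, the hyperbolic quantity is at most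
`1`. -/
lemma tr_aux {z : ℝ} (h : 4 * z ^ 2 - 1 ≤ 3) : z ≤ 1 := by nlinarith

lemma mul_bd {a b : ℝ} (ha : |a| ≤ 1) (hb : |b| ≤ 1) : a * b ≤ 1 := by
  have h := abs_mul a b
  have := le_abs_self (a * b)
  have := abs_nonneg b
  nlinarith [abs_nonneg a]

lemma U_ge2 {t : Fin 3 → ℕ} (ht : ∀ p, 6 ≤ t p) (p : Fin 3) (n : ℕ) (h1 : 2 ≤ n)
    (h2 : n + 2 ≤ t p) : 43 / 25 ≤ U t p n := by
  have hs := sin_th_pos ht p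
  have hc := cc_ge ht p
  unfold U
  rw [le_div_iff₀ hs]
  have hn : (2 : ℝ) ≤ n := by exact_mod_cast h1
  have hn' : (n : ℝ) + 2 ≤ t p := by exact_mod_cast h2
  have hp := th_pos ht p
  have hm := th_mul ht p
  have h : Real.sin (2 * th t p) ≤ Real.sin (n * th t p) := by
    apply sin_mono_aux (by linarith)
    · nlinarith
    · nlinarith
  rw [Real.sin_two_mul] at h
  unfold cc at hc
  nlinarith

lemma U_last {t : Fin 3 → ℕ} (ht : ∀ p, 6 ≤ t p) (p : Fin 3) (n : ℕ) (h : n + 1 = t p) :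
    Real.cos (n * th t p) = - cc t p := by
  have hm := th_mul ht p
  have : (n : ℝ) * th t p = Real.pi - th t p := by
    rw [← h] at hm; push_cast at hm; linarith
  rw [this, Real.cos_pi_sub, cc]

variable {t : Fin 3 → ℕ} (ht : ∀ p, 6 ≤ t p)

theorem nonadj (p q : Fin 3) (m n : ℕ) (hm : 1 ≤ m) (hm' : m < t p) (hn : 1 ≤ n) (hn' : n < t q)
    (g : WW t ht)
    (hg : Qf (cc t) (E p) (E q) + 2 * Dd (cc t) ≤ Qf (cc t) (E p) (E q ᵥ* rho t ht g⁻¹)) :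
    3 < (rho t ht (rr ht p ^ m * (g * rr ht q ^ n * g⁻¹))).trace := by
  by_contra hcon
  rw [not_lt] at hcon
  obtain ⟨m', hm1, h⟩ := rho_conj_Nm ht g (E q) (U t q n) (Real.cos (n * th t q))
  have hsq : m' ^ 2 = Real.cos (n * th t q) ^ 2 := by
    rcases hm1 with rfl | rfl <;> ring
  have habs : |m'| ≤ 1 := by
    rcases hm1 with rfl | rfl
    · exact Real.abs_cos_le_one _
    · rw [abs_neg]; exact Real.abs_cos_le_one _
  rw [map_mul, map_mul, map_mul, rho_rr_pow, rho_rr_pow, h, trace_Nm_mul _ _ _ _ _ _ _ (U_sq ht p m)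
    (by rw [hsq, U_sq ht q n, Qf_rho])] at hcon
  have h1 := tr_aux hcon
  have h2 := mul_bd (Real.abs_cos_le_one (m * th t p)) habs
  have h3 := U_ge ht p m hm hm'
  have h4 := U_ge ht q n hn hn'
  have h5 := Dd_ge ht
  have h6 := Qf_nonneg ht p q
  have h7 : 1 ≤ U t p m * U t q n := by nlinarith
  have h8 : 4 ≤ Qf (cc t) (E p) (E q ᵥ* rho t ht g⁻¹) := by linarith
  nlinarith

theorem adj (p q : Fin 3) (hpq : p ≠ q) (m n : ℕ) (hm : 1 ≤ m) (hm' : m < t p) (hn : 1 ≤ n)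
    (hn' : n < t q) (htr : (rho t ht (rr ht p ^ m * rr ht q ^ n)).trace ≤ 3) :
    (m = 1 ∧ n = 1) ∨ (m + 1 = t p ∧ n + 1 = t q) := by
  rw [map_mul, rho_rr_pow, rho_rr_pow, trace_Nm_mul _ _ _ _ _ _ _ (U_sq ht p m) (U_sq ht q n)] at htr
  have h1 := tr_aux htr
  have h2 := mul_bd (Real.abs_cos_le_one (m * th t p)) (Real.abs_cos_le_one (n * th t q))
  have h3 := U_ge ht p m hm hm'
  have h4 := U_ge ht q n hn hn'
  have hK := Qf_ne ht hpq
  have cp := cc_ge ht p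
  have cq := cc_ge ht q
  have hcc : (43 / 50) * (43 / 50) ≤ cc t p * cc t q := mul_le_mul cp cq (by norm_num) (by linarith)
  have hK' : 159 / 100 ≤ Qf (cc t) (E p) (E q) := by linarith
  have hmid : ∀ x : ℝ, 43 / 25 ≤ x → 2 < x * Qf (cc t) (E p) (E q) := by
    intro x hx; nlinarith
  have hmp : ¬ (2 ≤ m ∧ m + 2 ≤ t p) := by
    rintro ⟨ha, hb⟩
    have := U_ge2 ht p m ha hb
    have := hmid (U t p m * U t q n) (by nlinarith)
    linarith
  have hnq : ¬ (2 ≤ n ∧ n + 2 ≤ t q) := by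
    rintro ⟨ha, hb⟩
    have := U_ge2 ht q n ha hb
    have := hmid (U t p m * U t q n) (by nlinarith)
    linarith
  have h6p := ht p
  have h6q := ht q
  have hmm : m = 1 ∨ m + 1 = t p := by omega
  have hnn : n = 1 ∨ n + 1 = t q := by omega
  have hUU : Qf (cc t) (E p) (E q) ≤ U t p m * U t q n * Qf (cc t) (E p) (E q) := by
    have : 1 ≤ U t p m * U t q n := by nlinarith
    nlinarith
  have e1 : ∀ r, Real.cos ((1 : ℕ) * th t r) = cc t r := by intro r; simp [cc]
  rcases hmm with hmm | hmm <;> rcases hnn with hnn | hnn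
  · exact Or.inl ⟨hmm, hnn⟩
  · rw [U_last ht q n hnn] at h1
    subst hmm
    rw [e1] at h1
    nlinarith
  · rw [U_last ht p m hmm] at h1
    subst hnn
    rw [e1] at h1
    nlinarith
  · exact Or.inr ⟨hmm, hnn⟩

lemma rr_pow_last (p : Fin 3) (m : ℕ) (h : m + 1 = t p) : rr ht p ^ m = (rr ht p)⁻¹ := by
  rw [eq_inv_iff_mul_eq_one, ← pow_succ, h, rr_pow_t]

theorem rr_not_comm (p q : Fin 3) (hpq : p ≠ q) : ¬ Commute (rr ht p) (rr ht q) := by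
  intro hc
  have hp := ht p
  have hq := ht q
  have hc' : Commute (rr ht p ^ 1) (rr ht q ^ (t q - 1)) := hc.pow_pow _ _
  have htor : (rr ht p ^ 1 * rr ht q ^ (t q - 1)) ^ (t p * t q) = 1 := by
    rw [hc'.mul_pow, pow_one, pow_mul, rr_pow_t, one_pow, ← pow_mul, ← mul_assoc, mul_comm, pow_mul,
      rr_pow_t, one_pow, one_mul]
  have htr := torsion_trace ht _ (t p * t q) (by positivity) htor
    (by rw [map_mul, map_pow, map_pow, parity_rr, parity_rr, one_pow, one_pow, one_mul])
  rcases adj ht p q hpq 1 (t q - 1) (by omega) (by omega) (by omega) (by omega) htr with h | h <;>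
    omega

lemma parity_cases (w : WW t ht) : (cs t ht).lengthParity w = 1 ∨
    (cs t ht).lengthParity w = Multiplicative.ofAdd 1 := by
  generalize (cs t ht).lengthParity w = z
  revert z; decide

lemma fin3_third (p q : Fin 3) : ∃ r, r ≠ p ∧ r ≠ q := by
  revert p q; decide

theorem mainW (u v : WW t ht) (a b c : ℕ) (ha : 0 < a) (hb : 0 < b) (hc : 0 < c)
    (hu : u ^ a = 1) (hv : v ^ b = 1) (huv : (u * v) ^ c = 1)
    (eu : (cs t ht).lengthParity u = 1) (ev : (cs t ht).lengthParity v = 1)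
    (hnc : ¬ Commute u v) :
    ∃ (w : WW t ht) (p q : Fin 3) (ε : ℤ), (cs t ht).lengthParity w = 1 ∧ p ≠ q ∧
      (ε = 1 ∨ ε = -1) ∧ w * u * w⁻¹ = rr ht p ^ ε ∧ w * v * w⁻¹ = rr ht q ^ ε := by
  -- it is enough to find `w` of any parity
  suffices hs : ∃ (w : WW t ht) (p q : Fin 3) (ε : ℤ), p ≠ q ∧
      (ε = 1 ∨ ε = -1) ∧ w * u * w⁻¹ = rr ht p ^ ε ∧ w * v * w⁻¹ = rr ht q ^ ε by
    obtain ⟨w, p, q, ε, hpq, hε, h1, h2⟩ := hs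
    rcases parity_cases ht w with hw | hw
    · exact ⟨w, p, q, ε, hw, hpq, hε, h1, h2⟩
    · obtain ⟨r, hrp, hrq⟩ := fin3_third p q
      refine ⟨(cs t ht).simple r * w, p, q, -ε, ?_, hpq, ?_, ?_, ?_⟩
      · rw [map_mul, hw, parity_simple]; decide
      · rcases hε with rfl | rfl <;> simp
      · rw [← simple_conj_rr_zpow ht hrp, ← h1]; group
      · rw [← simple_conj_rr_zpow ht hrq, ← h2]; group
  obtain ⟨w₁, p, m, hm, rfl⟩ := torsion ht u a ha hu eu
  obtain ⟨w₂, q, n, hn, rfl⟩ := torsion ht v b hb hv ev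
  have hm0 : 1 ≤ m := by
    by_contra h
    obtain rfl : m = 0 := by omega
    apply hnc
    simp
  have hn0 : 1 ≤ n := by
    by_contra h
    obtain rfl : n = 0 := by omega
    apply hnc
    simp
  have htr := torsion_trace ht _ c hc huv (by rw [map_mul, eu, ev, one_mul])
  have hb := (dist_bound ht p q (w₁⁻¹ * w₂)).2
  rcases hb with ⟨x₁, hx₁, x₂, hx₂, hx⟩ | hb
  swap
  · exfalso
    have h3 := nonadj ht p q m n hm0 hm hn0 hn _ hb
    rw [← trace_conj ht w₁] at h3
    have e : w₁ * (rr ht p ^ m * (w₁⁻¹ * w₂ * rr ht q ^ n * (w₁⁻¹ * w₂)⁻¹)) * w₁⁻¹ =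
        w₁ * rr ht p ^ m * w₁⁻¹ * (w₂ * rr ht q ^ n * w₂⁻¹) := by group
    rw [e] at h3
    linarith
  have hw2 : w₂ = w₁ * x₁ * x₂ := by rw [mul_assoc, ← hx]; group
  subst hw2
  set w := x₁⁻¹ * w₁⁻¹ with hw
  obtain ⟨m', hm', e1⟩ := WP_conj ht (inv_mem hx₁) m
  obtain ⟨n', hn', e2⟩ := WP_conj ht hx₂ n
  have f1 : w * (w₁ * rr ht p ^ m * w₁⁻¹) * w⁻¹ = rr ht p ^ m' := by
    rw [← e1, hw]; group
  have f2 : w * (w₁ * x₁ * x₂ * rr ht q ^ n * (w₁ * x₁ * x₂)⁻¹) * w⁻¹ = rr ht q ^ n' := by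
    rw [← e2, hw]; group
  generalize w₁ * rr ht p ^ m * w₁⁻¹ = u at *
  generalize w₁ * x₁ * x₂ * rr ht q ^ n * (w₁ * x₁ * x₂)⁻¹ = v at *
  have hnc' : ¬ Commute (rr ht p ^ m') (rr ht q ^ n') := by
    rw [← f1, ← f2]
    intro hcom
    apply hnc
    have h := hcom.eq
    have h2 : w * (u * v) * w⁻¹ = w * (v * u) * w⁻¹ := by
      calc _ = w * u * w⁻¹ * (w * v * w⁻¹) := by group
        _ = w * v * w⁻¹ * (w * u * w⁻¹) := h
        _ = _ := by group
    exact mul_left_cancel (mul_right_cancel h2)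
  have hpq : p ≠ q := by
    rintro rfl
    exact hnc' ((Commute.refl _).pow_pow _ _)
  have hm0' : 1 ≤ m' := by
    by_contra h
    obtain rfl : m' = 0 := by omega
    apply hnc'
    simp
  have hn0' : 1 ≤ n' := by
    by_contra h
    obtain rfl : n' = 0 := by omega
    apply hnc'
    simp
  have htr' : (rho t ht (rr ht p ^ m' * rr ht q ^ n')).trace ≤ 3 := by
    rw [← trace_conj ht w] at htr
    rw [← f1, ← f2]
    convert htr using 3
    group
  rcases adj ht p q hpq m' n' hm0' hm' hn0' hn' htr' with ⟨h1, h2⟩ | ⟨h1, h2⟩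
  · refine ⟨w, p, q, 1, hpq, Or.inl rfl, ?_, ?_⟩
    · rw [f1, h1]; simp
    · rw [f2, h2]; simp
  · refine ⟨w, p, q, -1, hpq, Or.inr rfl, ?_, ?_⟩
    · rw [f1, rr_pow_last ht p m' h1, _root_.zpow_neg, zpow_one]
    · rw [f2, rr_pow_last ht q n' h2, _root_.zpow_neg, zpow_one]

end TriZ

namespace TriZ

variable {t : Fin 3 → ℕ} (ht : ∀ p, 6 ≤ t p)

lemma rels3 {G : Type*} [Group G] (x : Fin 3 → G) (hx : ∀ p, x p ^ t p = 1)
    (h : x 0 * x 1 * x 2 = 1) : ∀ r ∈ triangleRels₃ t, FreeGroup.lift x r = 1 := by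
  intro r hr
  rcases hr with rfl | rfl | rfl | rfl
  · simpa using hx 0
  · simpa using hx 1
  · simpa using hx 2
  · simpa using h

lemma of_pow (p : Fin 3) : (PresentedGroup.of p : TriangleGroup₃ t) ^ t p = 1 := by
  have h : FreeGroup.of p ^ t p ∈ triangleRels₃ t := by
    fin_cases p <;> simp [triangleRels₃]
  have := PresentedGroup.one_of_mem h
  exact this

lemma of_mul : (PresentedGroup.of 0 * PresentedGroup.of 1 * PresentedGroup.of 2 :
    TriangleGroup₃ t) = 1 := by
  have h : FreeGroup.of 0 * FreeGroup.of 1 * FreeGroup.of 2 ∈ triangleRels₃ t := by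
    simp [triangleRels₃]
  have := PresentedGroup.one_of_mem h
  exact this

lemma rr_prod : rr ht 0 * rr ht 1 * rr ht 2 = 1 := by
  have e1 : rr ht 0 = (cs t ht).simple 1 * (cs t ht).simple 2 := rfl
  have e2 : rr ht 1 = (cs t ht).simple 2 * (cs t ht).simple 0 := rfl
  have e3 : rr ht 2 = (cs t ht).simple 0 * (cs t ht).simple 1 := rfl
  rw [e1, e2, e3]
  generalize hx : (cs t ht).simple 0 = x
  generalize hy : (cs t ht).simple 1 = y
  generalize hz : (cs t ht).simple 2 = z
  have hx2 : x * x = 1 := hx ▸ ss ht 0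
  have hy2 : y * y = 1 := hy ▸ ss ht 1
  have hz2 : z * z = 1 := hz ▸ ss ht 2
  calc y * z * (z * x) * (x * y) = y * (z * z) * (x * x) * y := by simp only [mul_assoc]
    _ = 1 := by rw [hx2, hz2, mul_one, mul_one, hy2]

/-- The map to the Coxeter group. -/
def phi : TriangleGroup₃ t →* WW t ht :=
  PresentedGroup.toGroup (rels3 (rr ht) (rr_pow_t ht) (rr_prod ht))

lemma phi_of (p : Fin 3) : phi ht (PresentedGroup.of p) = rr ht p :=
  PresentedGroup.toGroup.of _

lemma parity_phi (h : TriangleGroup₃ t) : (cs t ht).lengthParity (phi ht h) = 1 := by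
  have : ((cs t ht).lengthParity).comp (phi ht) = 1 := by
    apply PresentedGroup.ext
    intro p
    simp only [MonoidHom.comp_apply, phi_of, parity_rr, MonoidHom.one_apply]
  exact DFunLike.congr_fun this h

lemma simple_mul_mem (a b : Fin 3) :
    (cs t ht).simple a * (cs t ht).simple b ∈ (phi ht).range := by
  have hr : ∀ p, rr ht p ∈ (phi ht).range := fun p => ⟨_, phi_of ht p⟩
  by_cases h : a = b
  · subst h; rw [ss]; exact one_mem _
  · obtain ⟨r, -, h'⟩ := fin3_cases h
    rcases h' with ⟨rfl, rfl⟩ | ⟨rfl, rfl⟩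
    · exact hr r
    · rw [← rr_inv]; exact inv_mem (hr r)

lemma range_aux (w : WW t ht) :
    w ∈ (phi ht).range ∨ ∀ a, w * (cs t ht).simple a ∈ (phi ht).range := by
  induction w using (cs t ht).simple_induction_right with
  | one => left; exact one_mem _
  | mul_simple_right w p ih =>
    rcases ih with h | h
    · right
      intro a
      rw [mul_assoc]
      exact mul_mem h (simple_mul_mem ht p a)
    · left; exact h p

lemma mem_range (w : WW t ht) (hw : (cs t ht).lengthParity w = 1) : ∃ h, phi ht h = w := by
  rcases range_aux ht w with h | h
  · exact h
  · exfalso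
    obtain ⟨x, hx⟩ := h 0
    have := parity_phi ht x
    rw [hx, map_mul, hw, one_mul, parity_simple] at this
    revert this; decide

lemma lift_aux {G : Type*} [Group G] (f : Fin 3 → G) (h2 : ∀ p, f p * f p = 1)
    (h : ∀ p, (f (p + 1) * f (p + 2)) ^ t p = 1) : (CM t ht).IsLiftable f := by
  intro p q
  by_cases hpq : p = q
  · subst hpq
    simp [CM_apply, h2]
  · rw [CM_apply, if_neg hpq]
    obtain ⟨r, hr, h'⟩ := fin3_cases hpq
    rw [hr]
    rcases h' with ⟨rfl, rfl⟩ | ⟨rfl, rfl⟩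
    · exact h r
    · have e : f (r + 2) * f (r + 1) = (f (r + 1) * f (r + 2))⁻¹ := by
        rw [eq_inv_iff_mul_eq_one, mul_assoc, ← mul_assoc (f (r + 1)), h2, one_mul, h2]
      rw [e, inv_pow, h, inv_one]

/-- The involution of the triangle group. -/
def tau (t : Fin 3 → ℕ) : TriangleGroup₃ t →* TriangleGroup₃ t :=
  PresentedGroup.toGroup (f := ![(PresentedGroup.of 0)⁻¹, (PresentedGroup.of 1)⁻¹,
    PresentedGroup.of 1 * PresentedGroup.of 0]) (rels3 _ (by
    intro p
    fin_cases p
    · simp [of_pow]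
    · simp [of_pow]
    · have h2 : (PresentedGroup.of 0 * PresentedGroup.of 1 : TriangleGroup₃ t) =
        (PresentedGroup.of 2)⁻¹ := eq_inv_of_mul_eq_one_left of_mul
      have h3 : (PresentedGroup.of 1 * PresentedGroup.of 0 : TriangleGroup₃ t) =
          PresentedGroup.of 1 * (PresentedGroup.of 2)⁻¹ * (PresentedGroup.of 1)⁻¹ := by
        rw [← h2]; group
      change (PresentedGroup.of 1 * PresentedGroup.of 0 : TriangleGroup₃ t) ^ t 2 = 1
      rw [h3, conj_pow, inv_pow, of_pow]
      simp) (by simp))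

lemma tau0 : tau t (PresentedGroup.of 0) = (PresentedGroup.of 0)⁻¹ :=
  PresentedGroup.toGroup.of _

lemma tau1 : tau t (PresentedGroup.of 1) = (PresentedGroup.of 1)⁻¹ :=
  PresentedGroup.toGroup.of _

lemma tau2 : tau t (PresentedGroup.of 2) = PresentedGroup.of 1 * PresentedGroup.of 0 :=
  PresentedGroup.toGroup.of _

lemma tau_tau (x : TriangleGroup₃ t) : tau t (tau t x) = x := by
  have : (tau t).comp (tau t) = MonoidHom.id _ := by
    apply PresentedGroup.ext
    intro p
    simp only [MonoidHom.comp_apply, MonoidHom.id_apply]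
    fin_cases p
    · change tau t (tau t (PresentedGroup.of 0)) = PresentedGroup.of 0
      rw [tau0, map_inv, tau0, inv_inv]
    · change tau t (tau t (PresentedGroup.of 1)) = PresentedGroup.of 1
      rw [tau1, map_inv, tau1, inv_inv]
    · change tau t (tau t (PresentedGroup.of 2)) = PresentedGroup.of 2
      rw [tau2, map_mul, tau0, tau1, ← mul_inv_rev]
      exact (eq_inv_of_mul_eq_one_right of_mul).symm
  exact DFunLike.congr_fun this x

/-- The involution as a permutation. -/
def tauP (t : Fin 3 → ℕ) : Equiv.Perm (TriangleGroup₃ t) :=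
  ⟨tau t, tau t, tau_tau, tau_tau⟩

/-- Left multiplication. -/
def LL (t : Fin 3 → ℕ) : TriangleGroup₃ t →* Equiv.Perm (TriangleGroup₃ t) :=
  MulAction.toPermHom _ _

lemma LL_apply (x y : TriangleGroup₃ t) : LL t x y = x * y := rfl

lemma tauP_apply (x : TriangleGroup₃ t) : tauP t x = tau t x := rfl

lemma tauP_sq : tauP t * tauP t = 1 := by
  ext x
  exact tau_tau x

/-- Images of the simple reflections. -/
def psiF (t : Fin 3 → ℕ) : Fin 3 → Equiv.Perm (TriangleGroup₃ t) :=
  ![tauP t * LL t (PresentedGroup.of 1), LL t (PresentedGroup.of 0) * tauP t, tauP t]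

lemma psiF_sq (p : Fin 3) : psiF t p * psiF t p = 1 := by
  fin_cases p
  · ext x
    change tau t (PresentedGroup.of 1 * tau t (PresentedGroup.of 1 * x)) = x
    rw [map_mul, tau_tau, tau1, inv_mul_cancel_left]
  · ext x
    change PresentedGroup.of 0 * tau t (PresentedGroup.of 0 * tau t x) = x
    rw [map_mul, tau_tau, tau0, mul_inv_cancel_left]
  · exact tauP_sq

lemma psiF_mul (p : Fin 3) :
    psiF t (p + 1) * psiF t (p + 2) = LL t (PresentedGroup.of p) := by
  fin_cases p
  · change LL t (PresentedGroup.of 0) * tauP t * tauP t = LL t (PresentedGroup.of 0)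
    rw [mul_assoc, tauP_sq, mul_one]
  · change tauP t * (tauP t * LL t (PresentedGroup.of 1)) = LL t (PresentedGroup.of 1)
    rw [← mul_assoc, tauP_sq, one_mul]
  · ext x
    change tau t (PresentedGroup.of 1 * (PresentedGroup.of 0 * tau t x)) = PresentedGroup.of 2 * x
    rw [← mul_assoc, ← tau2, map_mul, tau_tau, tau_tau]

lemma psi_lift : (CM t ht).IsLiftable (psiF t) :=
  lift_aux ht _ psiF_sq (fun p => by rw [psiF_mul, ← map_pow, of_pow, map_one])

/-- The map back from the Coxeter group. -/
def psi : WW t ht →* Equiv.Perm (TriangleGroup₃ t) := (cs t ht).lift ⟨psiF t, psi_lift ht⟩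

lemma psi_phi (x : TriangleGroup₃ t) : psi ht (phi ht x) = LL t x := by
  have : (psi ht).comp (phi ht) = LL t := by
    apply PresentedGroup.ext
    intro p
    rw [MonoidHom.comp_apply, phi_of, rr, map_mul, ← psiF_mul]
    have h : ∀ a, psi ht ((cs t ht).simple a) = psiF t a :=
      fun a => (cs t ht).lift_apply_simple (psi_lift ht) a
    rw [h, h]
  exact DFunLike.congr_fun this x

lemma phi_inj : Function.Injective (phi ht) := by
  intro x y h
  have h1 := congrArg (psi ht) h
  rw [psi_phi, psi_phi] at h1
  have h2 := DFunLike.congr_fun h1 1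
  rwa [LL_apply, LL_apply, mul_one, mul_one] at h2

end TriZ

theorem lem_extending_zieschang (i j k : ℕ) (hi : 6 ≤ i) (hj : 6 ≤ j) (hk : 6 ≤ k)
    (t : Fin 3 → ℕ) (σ : Equiv.Perm (Fin 3)) (ht : t = ![i, j, k] ∘ σ)
    (f : TriangleGroup i j k ≃* TriangleGroup₃ t) :
    ∃ γ : MulAut (TriangleGroup₃ t), γ ∈ Inn (TriangleGroup₃ t) ∧
      ∃ (p q : Fin 3) (ε : ℤ), p ≠ q ∧ (ε = 1 ∨ ε = -1) ∧
        γ (f (PresentedGroup.of 0)) = PresentedGroup.of p ^ ε ∧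
        γ (f (PresentedGroup.of 1)) = PresentedGroup.of q ^ ε := by
  have ht6 : ∀ p, 6 ≤ t p := by
    intro p
    rw [ht, Function.comp_apply]
    generalize σ p = r
    fin_cases r <;> simp [hi, hj, hk]
  clear ht
  have ra : (PresentedGroup.of 0 : TriangleGroup i j k) ^ i = 1 := by
    have h : FreeGroup.of 0 ^ i ∈ triangleRels i j k := by simp [triangleRels]
    exact PresentedGroup.one_of_mem h
  have rb : (PresentedGroup.of 1 : TriangleGroup i j k) ^ j = 1 := by
    have h : FreeGroup.of 1 ^ j ∈ triangleRels i j k := by simp [triangleRels]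
    exact PresentedGroup.one_of_mem h
  have rab : (PresentedGroup.of 0 * PresentedGroup.of 1 : TriangleGroup i j k) ^ k = 1 := by
    have h : (FreeGroup.of 0 * FreeGroup.of 1) ^ k ∈ triangleRels i j k := by simp [triangleRels]
    exact PresentedGroup.one_of_mem h
  have hnc : ¬ Commute (TriZ.phi ht6 (f (PresentedGroup.of 0)))
      (TriZ.phi ht6 (f (PresentedGroup.of 1))) := by
    intro hc
    have hc' : Commute (PresentedGroup.of 0 : TriangleGroup i j k) (PresentedGroup.of 1) := by
      have h := hc.eq
      rw [← map_mul, ← map_mul, ← map_mul, ← map_mul] at h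
      exact f.injective (TriZ.phi_inj ht6 h)
    have hgen : ∀ p q : Fin 2, Commute (PresentedGroup.of p : TriangleGroup i j k)
        (PresentedGroup.of q) := by
      intro p q
      fin_cases p <;> fin_cases q
      · exact Commute.refl _
      · exact hc'
      · exact hc'.symm
      · exact Commute.refl _
    have hgen2 : ∀ (p : Fin 2) (x : TriangleGroup i j k), Commute (PresentedGroup.of p) x := by
      intro p x
      have hx : x ∈ Subgroup.closure (Set.range (PresentedGroup.of (rels := triangleRels i j k))) := by
        rw [PresentedGroup.closure_range_of]; trivial
      induction hx using Subgroup.closure_induction with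
      | mem x hx => obtain ⟨q, rfl⟩ := hx; exact hgen p q
      | one => exact Commute.one_right _
      | mul x y _ _ h1 h2 => exact h1.mul_right h2
      | inv x _ h => exact h.inv_right
    have hgen3 : ∀ x y : TriangleGroup i j k, Commute x y := by
      intro x y
      have hx : x ∈ Subgroup.closure (Set.range (PresentedGroup.of (rels := triangleRels i j k))) := by
        rw [PresentedGroup.closure_range_of]; trivial
      induction hx using Subgroup.closure_induction with
      | mem x hx => obtain ⟨q, rfl⟩ := hx; exact hgen2 q y
      | one => exact Commute.one_left _
      | mul x y _ _ h1 h2 => exact h1.mul_left h2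
      | inv x _ h => exact h.inv_left
    apply TriZ.rr_not_comm ht6 0 1 (by decide)
    rw [← TriZ.phi_of, ← TriZ.phi_of]
    have h := ((hgen3 (f.symm (PresentedGroup.of 0)) (f.symm (PresentedGroup.of 1))).map f)
    rw [MulEquiv.apply_symm_apply, MulEquiv.apply_symm_apply] at h
    exact h.map _
  obtain ⟨w, p, q, ε, hw, hpq, hε, h1, h2⟩ := TriZ.mainW ht6
    (TriZ.phi ht6 (f (PresentedGroup.of 0))) (TriZ.phi ht6 (f (PresentedGroup.of 1))) i j k
    (by omega) (by omega) (by omega)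
    (by rw [← map_pow, ← map_pow, ra, map_one, map_one])
    (by rw [← map_pow, ← map_pow, rb, map_one, map_one])
    (by rw [← map_mul, ← map_mul, ← map_pow, ← map_pow, rab, map_one, map_one])
    (TriZ.parity_phi ht6 _) (TriZ.parity_phi ht6 _) hnc
  obtain ⟨h, rfl⟩ := TriZ.mem_range ht6 w hw
  refine ⟨MulAut.conj h, ⟨h, rfl⟩, p, q, ε, hpq, hε, ?_, ?_⟩
  · apply TriZ.phi_inj ht6
    rw [MulAut.conj_apply, map_mul, map_mul, map_inv, map_zpow, TriZ.phi_of, h1]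
  · apply TriZ.phi_inj ht6
    rw [MulAut.conj_apply, map_mul, map_mul, map_inv, map_zpow, TriZ.phi_of, h2]
end

section
/- Let i, j, k ≥ 6 and consider T_{i,j,k} = ⟨a, b; a^i, b^j, (ab)^k⟩. Define twelve maps on the generators: ψ_{(1,ε)}: a ↦ a^ε, b ↦ b^ε; ψ_{(2,ε)}: a ↦ a^ε, b ↦ (ab)^{-ε}; ψ_{(3,ε)}: a ↦ (ab)^ε, b ↦ b^{-ε}; ψ_{(4,ε)}: a ↦ b^ε, b ↦ a^ε; ψ_{(5,ε)}: a ↦ b^ε, b ↦ (ab)^{-ε}; ψ_{(6,ε)}: a ↦ (ab)^ε, b ↦ a^{-ε}, for ε = ±1. Then: (1) if i, j, k are pairwise distinct, the maps ψ_{(1,1)} and ψ_{(1,-1)} extend to automorphisms of T_{i,j,k} and every automorphism of T_{i,j,k} differs from exactly one of them by an inner automorphism (so Out(T_{i,j,k}) has order 2); (2) if i = j ≠ k, the maps ψ_{(1,±1)} and ψ_{(4,±1)} extend to automorphisms and form a complete, irredundant set of coset representatives for Inn(T_{i,j,k}) in Aut(T_{i,j,k}) (so Out has order 4); (3) if i =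 j = k, all twelve maps extend to automorphisms and form a complete, irredundant set of coset representatives for Inn(T_{i,i,i}) in Aut(T_{i,i,i}) (so Out has order 12). -/
instance Inn.normal (G : Type*) [Group G] : (Inn G).Normal := by
  constructor
  intro n hn f
  obtain ⟨g, rfl⟩ := hn
  refine ⟨f g, ?_⟩
  ext x
  simp [MulAut.conj, mul_assoc]

/-- The outer automorphism group of `G`. -/
abbrev Out (G : Type*) [Group G] := MulAut G ⧸ Inn G

/-- The generator `a` of the free group of rank two. -/
def fa : FreeGroup (Fin 2) := FreeGroup.of 0

/-- The generator `b` of the free group of rank two. -/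
def fb : FreeGroup (Fin 2) := FreeGroup.of 1

/-- The image of `a` under the map `ψ_{(n+1, ε)}`. -/
def psiA (n : Fin 6) (ε : ℤ) : FreeGroup (Fin 2) :=
  ![fa ^ ε, fa ^ ε, (fa * fb) ^ ε, fb ^ ε, fb ^ ε, (fa * fb) ^ ε] n

/-- The image of `b` under the map `ψ_{(n+1, ε)}`. -/
def psiB (n : Fin 6) (ε : ℤ) : FreeGroup (Fin 2) :=
  ![fb ^ ε, (fa * fb) ^ (-ε), fb ^ (-ε), fa ^ ε, (fa * fb) ^ (-ε), fa ^ (-ε)] n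

/-- The automorphism `δ` of `T_{i,j,k}` extends the map `ψ_{(n+1, ε)}` on the
generators `a`, `b`. -/
def ExtendsPsi (i j k : ℕ) (n : Fin 6) (ε : ℤ)
    (δ : MulAut (TriangleGroup i j k)) : Prop :=
  δ (PresentedGroup.of 0) = PresentedGroup.mk (triangleRels i j k) (psiA n ε) ∧
  δ (PresentedGroup.of 1) = PresentedGroup.mk (triangleRels i j k) (psiB n ε)

/-- The family of maps `ψ_{(n+1, ε)}` for `(n, ε) ∈ S` is a transversal of
`Out(T_{i,j,k})`: each of them extends to an automorphism of `T_{i,j,k}`, and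
every automorphism of `T_{i,j,k}` differs by an inner automorphism from the
extension of exactly one of them. -/
def IsPsiTransversal (i j k : ℕ) (S : Set (Fin 6 × ℤ)) : Prop :=
  (∀ p ∈ S, ∃ δ : MulAut (TriangleGroup i j k), ExtendsPsi i j k p.1 p.2 δ) ∧
  (∀ δ' : MulAut (TriangleGroup i j k),
    ∃! p : Fin 6 × ℤ, p ∈ S ∧ ∃ δ : MulAut (TriangleGroup i j k),
      ExtendsPsi i j k p.1 p.2 δ ∧ δ⁻¹ * δ' ∈ Inn (TriangleGroup i j k))

open Real in
/-- Geometric data: three reflections in `sl₂(ℝ)`. -/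
structure TD where
  n : Fin 3 → ℕ
  hn : ∀ p, 6 ≤ n p
  E : Fin 3 → Matrix (Fin 2) (Fin 2) ℝ
  trE : ∀ s, (E s).trace = 0
  sq : ∀ s, E s * E s = 1
  rel : ∀ p, E (p+1) * E (p+2) + E (p+2) * E (p+1) = (-2 * cos (π / n p)) • 1
  ori : (E 0 * E 1 * E 2).trace < 0

abbrev Mat := Matrix (Fin 2) (Fin 2) ℝ

/-- bilinear form -/
noncomputable def bf (u v : Mat) : ℝ := (u * v).trace / 2

lemma bf_add_left (u v w : Mat) : bf (u+v) w = bf u w + bf v w := by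
  simp [bf, add_mul]; ring
lemma bf_add_right (u v w : Mat) : bf w (u+v) = bf w u + bf w v := by
  simp [bf, mul_add]; ring
lemma bf_smul_left (c : ℝ) (u v : Mat) : bf (c • u) v = c * bf u v := by
  simp [bf]; ring
lemma bf_smul_right (c : ℝ) (u v : Mat) : bf u (c • v) = c * bf u v := by
  simp [bf]; ring
lemma bf_neg_left (u v : Mat) : bf (-u) v = - bf u v := by simp [bf]; ring
lemma bf_neg_right (u v : Mat) : bf u (-v) = - bf u v := by simp [bf]; ring
lemma bf_sub_left (u v w : Mat) : bf (u-v) w = bf u w - bf v w := by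
  simp [bf, sub_mul]; ring
lemma bf_sub_right (u v w : Mat) : bf w (u-v) = bf w u - bf w v := by
  simp [bf, mul_sub]; ring
lemma bf_comm (u v : Mat) : bf u v = bf v u := by simp [bf, Matrix.trace_mul_comm u v]
lemma bf_sum_right {ι : Type*} (s : Finset ι) (f : ι → Mat) (v : Mat) :
    bf v (∑ x ∈ s, f x) = ∑ x ∈ s, bf v (f x) := by
  classical
  induction s using Finset.induction_on with
  | empty => simp [bf]
  | insert a s ha ih => rw [Finset.sum_insert ha, Finset.sum_insert ha, bf_add_right, ih]
lemma bf_sum_left {ι : Type*} (s : Finset ι) (f : ι → Mat) (v : Mat) :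
    bf (∑ x ∈ s, f x) v = ∑ x ∈ s, bf (f x) v := by
  rw [bf_comm, bf_sum_right]; exact Finset.sum_congr rfl fun x _ => bf_comm _ _

/-- anticommutator of traceless matrices -/
lemma anticomm (u v : Mat) (hu : u.trace = 0) (hv : v.trace = 0) :
    u * v + v * u = (2 * bf u v) • 1 := by
  simp only [Matrix.trace_fin_two] at hu hv
  have hu' : u 1 1 = - u 0 0 := by linarith
  have hv' : v 1 1 = - v 0 0 := by linarith
  ext a b
  fin_cases a <;> fin_cases b <;>
    simp [bf, Matrix.mul_apply, Fin.sum_univ_two, Matrix.trace_fin_two, hu', hv'] <;> ring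

/-- the square root of -1 associated with a rotation -/
noncomputable def JJ (θ : ℝ) (u v : Mat) : Mat := (-(1 / Real.sin θ)) • (u * v + Real.cos θ • 1)

lemma JJ_eq (θ : ℝ) (u v : Mat) (hs : Real.sin θ ≠ 0) :
    u * v = -(Real.cos θ • 1 + Real.sin θ • JJ θ u v) := by
  rw [JJ, smul_smul]
  have : Real.sin θ * -(1 / Real.sin θ) = -1 := by field_simp
  rw [this]; simp

lemma JJ_sq (θ : ℝ) (u v : Mat) (hs : Real.sin θ ≠ 0) (hu : u * u = 1) (hv : v * v = 1)
    (h : u * v + v * u = (-2 * Real.cos θ) • 1) : JJ θ u v * JJ θ u v = -1 := by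
  have h1 : (u * v) * (u * v) = (-2 * Real.cos θ) • (u * v) - 1 := by
    have h2 : v * u = (-2 * Real.cos θ) • 1 - u * v := by rw [← h]; abel
    calc (u * v) * (u * v) = u * (v * u) * v := by noncomm_ring
      _ = (-2 * Real.cos θ) • (u * v) - (u * u) * (v * v) := by
        rw [h2, mul_sub, sub_mul]; simp [mul_assoc]
      _ = _ := by rw [hu, hv, one_mul]
  have h3 : (u * v + Real.cos θ • 1) * (u * v + Real.cos θ • 1) = (-(Real.sin θ)^2) • (1 : Mat) := by
    rw [add_mul, mul_add, mul_add, h1]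
    have : -(Real.sin θ)^2 = (Real.cos θ)^2 - 1 := by linarith [Real.sin_sq_add_cos_sq θ]
    rw [this]
    simp only [mul_smul_comm, smul_mul_assoc, mul_one, one_mul]
    module
  rw [JJ, smul_mul_assoc, mul_smul_comm, h3, smul_smul, smul_smul]
  have : -(1 / Real.sin θ) * -(1 / Real.sin θ) * -Real.sin θ ^ 2 = -1 := by field_simp
  rw [this]; simp

lemma rot_pow (θ : ℝ) (J : Mat) (hJ : J * J = -1) (m : ℕ) :
    (-(Real.cos θ • 1 + Real.sin θ • J)) ^ m =
      ((-1 : ℝ)^m) • (Real.cos (m * θ) • 1 + Real.sin (m * θ) • J) := by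
  induction m with
  | zero => simp
  | succ m ih =>
    rw [pow_succ, ih, smul_mul_assoc, mul_neg, add_mul, mul_add, mul_add]
    simp only [mul_smul_comm, smul_mul_assoc, mul_one, one_mul, hJ]
    push_cast
    rw [add_mul, one_mul, Real.cos_add, Real.sin_add]
    module

lemma rot_pow_m (m : ℕ) (hm : 2 ≤ m) (u v : Mat) (hu : u * u = 1) (hv : v * v = 1)
    (h : u * v + v * u = (-2 * Real.cos (Real.pi / m)) • 1) :
    (u * v) ^ m = ((-1 : ℝ)^(m+1)) • 1 := by
  have hm0 : (m : ℝ) ≠ 0 := by positivity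
  have hs : Real.sin (Real.pi / m) ≠ 0 := by
    apply ne_of_gt
    apply Real.sin_pos_of_pos_of_lt_pi (by positivity)
    apply div_lt_self Real.pi_pos
    exact_mod_cast hm
  rw [JJ_eq _ u v hs, rot_pow _ _ (JJ_sq _ u v hs hu hv h)]
  have : (m : ℝ) * (Real.pi / m) = Real.pi := by field_simp
  rw [this, pow_succ]; simp

namespace TD
variable (D : TD)

/-- The angles. -/
noncomputable def θ (p : Fin 3) : ℝ := Real.pi / D.n p

/-- The Coxeter matrix -/
def M : CoxeterMatrix (Fin 3) where
  M := fun s t => if s = t then 1 else D.n (-(s+t))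
  isSymm := by
    ext s t
    change (if t = s then 1 else D.n (-(t+s))) = if s = t then 1 else D.n (-(s+t))
    rw [add_comm t s]
    by_cases h : s = t
    · simp [h]
    · rw [if_neg h, if_neg (Ne.symm h)]
  diagonal := by simp
  off_diagonal := by
    intro s t h
    have := D.hn (-(s+t))
    rw [if_neg h]; omega

lemma M_apply (s t : Fin 3) : D.M s t = if s = t then 1 else D.n (-(s+t)) := rfl

lemma M_ne (s t : Fin 3) (h : s ≠ t) : 6 ≤ D.M s t := by
  rw [M_apply, if_neg h]; exact D.hn _

lemma rel' (s t : Fin 3) :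
    D.E s * D.E t + D.E t * D.E s = (-2 * Real.cos (Real.pi / D.M s t)) • 1 := by
  have h0 : D.E 1 * D.E 2 + D.E 2 * D.E 1 = _ := D.rel 0
  have h1 : D.E 2 * D.E 0 + D.E 0 * D.E 2 = _ := D.rel 1
  have h2 : D.E 0 * D.E 1 + D.E 1 * D.E 0 = _ := D.rel 2
  have hd : ∀ s, D.E s * D.E s + D.E s * D.E s =
      (-2 * Real.cos (Real.pi / D.M s s)) • (1 : Mat) := by
    intro s
    rw [D.M.diagonal, D.sq]
    simp only [Nat.cast_one, div_one, Real.cos_pi]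
    rw [← two_smul ℝ (1 : Mat)]; norm_num
  fin_cases s <;> fin_cases t
  · exact hd 0
  · exact h2
  · exact (add_comm _ _).trans h1
  · exact (add_comm _ _).trans h2
  · exact hd 1
  · exact h0
  · exact h1
  · exact (add_comm _ _).trans h0
  · exact hd 2

abbrev W := D.M.Group
def cs : CoxeterSystem D.M D.W := D.M.toCoxeterSystem

/-- The reflections -/
noncomputable def refl (s : Fin 3) : Module.End ℝ Mat :=
  -(LinearMap.mulLeft ℝ (D.E s) * LinearMap.mulRight ℝ (D.E s))

lemma refl_apply (s : Fin 3) (v : Mat) : D.refl s v = -(D.E s * v * D.E s) := by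
  simp [refl, mul_assoc]

lemma refl_pow (s t : Fin 3) (m : ℕ) (v : Mat) :
    ((D.refl s * D.refl t) ^ m) v = (D.E s * D.E t)^m * v * (D.E t * D.E s)^m := by
  induction m with
  | zero => simp
  | succ m ih =>
    rw [pow_succ', Module.End.mul_apply, ih, Module.End.mul_apply, refl_apply, refl_apply,
      pow_succ', pow_succ]
    noncomm_ring

lemma liftable : D.M.IsLiftable D.refl := by
  intro s t
  ext1 v
  rw [refl_pow]
  by_cases h : s = t
  · subst h; simp [D.sq]
  · have hm := D.M_ne s t h
    have hm' := D.M_ne t s (Ne.symm h)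
    rw [rot_pow_m _ (by omega) _ _ (D.sq s) (D.sq t) (D.rel' s t)]
    rw [D.M.symmetric s t, rot_pow_m _ (by omega) _ _ (D.sq t) (D.sq s) (D.rel' t s)]
    simp only [smul_mul_assoc, one_mul, mul_smul_comm, mul_one, smul_smul, ← mul_pow]
    simp

/-- The geometric representation -/
noncomputable def ρ : D.W →* Module.End ℝ Mat := D.cs.lift ⟨D.refl, D.liftable⟩

lemma ρ_simple (s : Fin 3) : D.ρ (D.cs.simple s) = D.refl s := D.cs.lift_apply_simple _ _

lemma ρ_mul (w w' : D.W) (v : Mat) : D.ρ (w * w') v = D.ρ w (D.ρ w' v) := by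
  rw [map_mul]; rfl

lemma ρ_inv_self (w : D.W) (v : Mat) : D.ρ w⁻¹ (D.ρ w v) = v := by
  rw [← ρ_mul]; simp
lemma ρ_self_inv (w : D.W) (v : Mat) : D.ρ w (D.ρ w⁻¹ v) = v := by
  rw [← ρ_mul]; simp

lemma refl_formula (s : Fin 3) (v : Mat) (hv : v.trace = 0) :
    D.refl s v = v - (2 * bf v (D.E s)) • D.E s := by
  rw [refl_apply]
  have h := anticomm v (D.E s) hv (D.trE s)
  have h2 : D.E s * v = (2 * bf v (D.E s)) • 1 - v * D.E s := by rw [← h]; abel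
  rw [h2, sub_mul, mul_assoc, D.sq]; simp

lemma refl_trace (s : Fin 3) (v : Mat) (hv : v.trace = 0) : (D.refl s v).trace = 0 := by
  rw [refl_formula _ _ _ hv]; simp [hv, D.trE]

lemma refl_bf (s : Fin 3) (u v : Mat) : bf (D.refl s u) (D.refl s v) = bf u v := by
  simp only [refl_apply, bf]
  have : -(D.E s * u * D.E s) * -(D.E s * v * D.E s) = D.E s * (u * (D.E s * D.E s) * v * D.E s) := by
    noncomm_ring
  rw [this, Matrix.trace_mul_comm, D.sq, mul_assoc, D.sq]; simp

lemma ρ_trace (w : D.W) (v : Mat) (hv : v.trace = 0) : (D.ρ w v).trace = 0 := by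
  induction w using D.cs.simple_induction_left with
  | one => simpa
  | mul_simple_left w i h => rw [ρ_mul, ρ_simple]; exact D.refl_trace _ _ h

lemma ρ_bf (w : D.W) (u v : Mat) : bf (D.ρ w u) (D.ρ w v) = bf u v := by
  induction w using D.cs.simple_induction_left with
  | one => simp
  | mul_simple_left w i h => rw [ρ_mul, ρ_simple, ρ_mul, ρ_simple, refl_bf, h]

lemma ρ_bf_left (w : D.W) (u v : Mat) : bf (D.ρ w u) v = bf u (D.ρ w⁻¹ v) := by
  rw [← D.ρ_bf w u, ρ_self_inv]

/-- the matrix lift -/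
lemma lift_exists (w : D.W) : ∃ A B : Mat, A * B = 1 ∧ B * A = 1 ∧
    ∀ v, D.ρ w v = ((-1 : ℝ) ^ D.cs.length w) • (A * v * B) := by
  induction w using D.cs.simple_induction_left with
  | one => exact ⟨1, 1, by simp, by simp, by simp⟩
  | mul_simple_left w i h =>
    obtain ⟨A, B, h1, h2, h3⟩ := h
    refine ⟨D.E i * A, B * D.E i, ?_, ?_, ?_⟩
    · calc _ = D.E i * (A * B) * D.E i := by noncomm_ring
        _ = 1 := by rw [h1, mul_one, D.sq]
    · calc _ = B * (D.E i * D.E i) * A := by noncomm_ring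
        _ = 1 := by rw [D.sq, mul_one, h2]
    · intro v
      rw [ρ_mul, ρ_simple, h3, refl_apply]
      have : ((-1:ℝ)) ^ D.cs.length (D.cs.simple i * w) = - (-1) ^ D.cs.length w := by
        rcases D.cs.length_simple_mul w i with h | h
        · rw [h, pow_succ]; ring
        · rw [← h, pow_succ]; ring
      rw [this]
      simp [mul_assoc]

end TD

namespace TD
variable (D : TD)

lemma θ_pos (p : Fin 3) : 0 < D.θ p := by
  have := D.hn p
  unfold θ
  have : (0 : ℝ) < D.n p := by exact_mod_cast (by omega)
  positivity

lemma θ_le (p : Fin 3) : D.θ p ≤ Real.pi / 6 := by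
  unfold θ
  have h : (6 : ℝ) ≤ D.n p := by exact_mod_cast D.hn p
  exact div_le_div_of_nonneg_left Real.pi_pos.le (by norm_num) h

lemma sin_pos (p : Fin 3) : 0 < Real.sin (D.θ p) :=
  Real.sin_pos_of_pos_of_lt_pi (D.θ_pos p) (by linarith [D.θ_le p, Real.pi_pos])

lemma cos_pos (p : Fin 3) : 0 < Real.cos (D.θ p) :=
  Real.cos_pos_of_mem_Ioo ⟨by linarith [D.θ_pos p, Real.pi_pos], by linarith [D.θ_le p, Real.pi_pos]⟩

/-- The vertices of the triangle -/
noncomputable def J (p : Fin 3) : Mat := JJ (D.θ p) (D.E (p+1)) (D.E (p+2))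

lemma J_sq (p : Fin 3) : D.J p * D.J p = -1 :=
  JJ_sq _ _ _ (D.sin_pos p).ne' (D.sq _) (D.sq _) (D.rel p)

lemma EE_eq (p : Fin 3) : D.E (p+1) * D.E (p+2) =
    -(Real.cos (D.θ p) • 1 + Real.sin (D.θ p) • D.J p) := JJ_eq _ _ _ (D.sin_pos p).ne'

lemma bf_EE (s t : Fin 3) : bf (D.E s) (D.E t) = - Real.cos (Real.pi / D.M s t) := by
  have h := congrArg Matrix.trace (D.rel' s t)
  rw [Matrix.trace_add, Matrix.trace_mul_comm (D.E t)] at h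
  simp at h
  unfold bf; linarith

lemma bf_EE_self (s : Fin 3) : bf (D.E s) (D.E s) = 1 := by
  rw [bf_EE]; simp

lemma bf_EE' (p : Fin 3) : bf (D.E (p+1)) (D.E (p+2)) = - Real.cos (D.θ p) := by
  rw [bf_EE]; fin_cases p <;> rfl

lemma J_trace (p : Fin 3) : (D.J p).trace = 0 := by
  have h := D.bf_EE' p
  unfold bf at h
  unfold J JJ
  simp
  have := (D.sin_pos p).ne'
  field_simp
  linarith

/-- the orientation constant -/
noncomputable def κ : ℝ := -(D.E 0 * D.E 1 * D.E 2).trace / 2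

lemma κ_pos : 0 < D.κ := by
  have := D.ori
  unfold κ; linarith

lemma bf_J_E1 (p : Fin 3) : bf (D.J p) (D.E (p+1)) = 0 := by
  unfold J JJ bf
  have h := D.trE (p+2)
  have : (D.E (p+1) * D.E (p+2) * D.E (p+1)).trace = 0 := by
    rw [Matrix.trace_mul_comm, ← mul_assoc, D.sq, one_mul, h]
  simp [add_mul, this, D.trE]

lemma bf_J_E2 (p : Fin 3) : bf (D.J p) (D.E (p+2)) = 0 := by
  unfold J JJ bf
  have h := D.trE (p+1)
  have : (D.E (p+1) * D.E (p+2) * D.E (p+2)).trace = 0 := by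
    rw [mul_assoc, D.sq, mul_one, h]
  simp [add_mul, this, D.trE]

lemma trace_cyc (p : Fin 3) : (D.E (p+1) * D.E (p+2) * D.E p).trace = -2 * D.κ := by
  unfold κ
  fin_cases p
  · change (D.E 1 * D.E 2 * D.E 0).trace = _
    rw [Matrix.trace_mul_comm, ← mul_assoc]; ring
  · change (D.E 2 * D.E 0 * D.E 1).trace = _
    rw [mul_assoc, Matrix.trace_mul_comm]; ring
  · change (D.E 0 * D.E 1 * D.E 2).trace = _
    ring

lemma bf_J_E (p : Fin 3) : bf (D.J p) (D.E p) = D.κ / Real.sin (D.θ p) := by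
  have h := D.trace_cyc p
  unfold J JJ bf
  simp [add_mul, h, D.trE]
  field_simp

lemma bf_J_E_pos (p : Fin 3) : 0 < bf (D.J p) (D.E p) := by
  rw [bf_J_E]; exact div_pos D.κ_pos (D.sin_pos p)

lemma bf_J_E_ne (p s : Fin 3) (h : s ≠ p) : bf (D.J p) (D.E s) = 0 := by
  have : s = p + 1 ∨ s = p + 2 := by revert p s; decide
  rcases this with rfl | rfl
  · exact D.bf_J_E1 p
  · exact D.bf_J_E2 p

lemma bf_J_E_nonneg (p s : Fin 3) : 0 ≤ bf (D.J p) (D.E s) := by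
  by_cases h : s = p
  · subst h; exact (D.bf_J_E_pos s).le
  · exact (D.bf_J_E_ne p s h).ge

lemma bf_J_sum (p : Fin 3) (c : Fin 3 → ℝ) :
    bf (D.J p) (∑ s, c s • D.E s) = c p * bf (D.J p) (D.E p) := by
  rw [bf_sum_right, Finset.sum_eq_single p]
  · rw [bf_smul_right]
  · intro s _ h; rw [bf_smul_right, D.bf_J_E_ne p s h, mul_zero]
  · simp

lemma bf_JJ_self (p : Fin 3) : bf (D.J p) (D.J p) = -1 := by
  unfold bf; rw [J_sq]; simp

lemma bf_JJ_succ (p : Fin 3) : bf (D.J p) (D.J (p+1)) =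
    -((Real.cos (D.θ (p+2)) + Real.cos (D.θ p) * Real.cos (D.θ (p+1))) /
      (Real.sin (D.θ p) * Real.sin (D.θ (p+1)))) := by
  have h1 : p + 1 + 1 = p + 2 := by revert p; decide
  have h2 : p + 1 + 2 = p := by revert p; decide
  have h3 : p + 2 + 1 = p := by revert p; decide
  have h4 : p + 2 + 2 = p + 1 := by revert p; decide
  have a0 := D.bf_EE' p
  have a1 := D.bf_EE' (p+1)
  have a2 := D.bf_EE' (p+2)
  rw [h1, h2] at a1
  rw [h3, h4] at a2
  have e : bf (D.E (p+1) * D.E (p+2)) (D.E (p+2) * D.E p) = - Real.cos (D.θ (p+2)) := by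
    rw [← a2, bf_comm (D.E p)]; unfold bf
    have : D.E (p+1) * D.E (p+2) * (D.E (p+2) * D.E p) =
      D.E (p+1) * (D.E (p+2) * D.E (p+2)) * D.E p := by noncomm_ring
    rw [this, D.sq, mul_one]
  have e1 : bf (D.E (p+1) * D.E (p+2)) 1 = - Real.cos (D.θ p) := by
    rw [← a0]; simp [bf]
  have e2 : bf 1 (D.E (p+2) * D.E p) = - Real.cos (D.θ (p+1)) := by
    rw [← a1]; simp [bf]
  have e3 : bf (1 : Mat) 1 = 1 := by simp [bf]
  unfold J JJ
  rw [h1, h2]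
  simp only [bf_smul_left, bf_smul_right, bf_add_left, bf_add_right, e, e1, e2, e3]
  have := (D.sin_pos p).ne'
  have := (D.sin_pos (p+1)).ne'
  field_simp
  ring

lemma bf_JJ_neg (p q : Fin 3) : bf (D.J p) (D.J q) < 0 := by
  have key : ∀ p, bf (D.J p) (D.J (p+1)) < 0 := by
    intro p
    rw [bf_JJ_succ]
    have := D.sin_pos p
    have := D.sin_pos (p+1)
    have := D.cos_pos p
    have := D.cos_pos (p+1)
    have := D.cos_pos (p+2)
    have : 0 < (Real.cos (D.θ (p+2)) + Real.cos (D.θ p) * Real.cos (D.θ (p+1))) /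
      (Real.sin (D.θ p) * Real.sin (D.θ (p+1))) := by positivity
    linarith
  have : q = p ∨ q = p + 1 ∨ p = q + 1 := by revert p q; decide
  rcases this with rfl | rfl | rfl
  · rw [bf_JJ_self]; norm_num
  · exact key p
  · rw [bf_comm]; exact key q

/-- The positive cone -/
def Pos (v : Mat) : Prop := ∃ c : Fin 3 → ℝ, (∀ s, 0 ≤ c s) ∧ v = ∑ s, c s • D.E s

variable {D}

lemma Pos.add {u v : Mat} (hu : D.Pos u) (hv : D.Pos v) : D.Pos (u + v) := by
  obtain ⟨c, hc, rfl⟩ := hu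
  obtain ⟨d, hd, rfl⟩ := hv
  exact ⟨c + d, fun s => add_nonneg (hc s) (hd s), by simp [add_smul, Finset.sum_add_distrib]⟩

lemma Pos.smul {u : Mat} (hu : D.Pos u) {a : ℝ} (ha : 0 ≤ a) : D.Pos (a • u) := by
  obtain ⟨c, hc, rfl⟩ := hu
  exact ⟨fun s => a * c s, fun s => mul_nonneg ha (hc s), by simp [Finset.smul_sum, smul_smul]⟩

lemma Pos.bf_nonneg {u : Mat} (hu : D.Pos u) (p : Fin 3) : 0 ≤ bf (D.J p) u := by
  obtain ⟨c, hc, rfl⟩ := hu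
  rw [bf_J_sum]; exact mul_nonneg (hc p) (D.bf_J_E_pos p).le

lemma Pos.eq_zero {u : Mat} (hu : D.Pos u) (h : ∀ p, bf (D.J p) u ≤ 0) : u = 0 := by
  obtain ⟨c, hc, rfl⟩ := hu
  have : ∀ p, c p = 0 := by
    intro p
    have := h p
    rw [bf_J_sum] at this
    have h2 := D.bf_J_E_pos p
    nlinarith [hc p]
  simp [this]

lemma Pos.antisymm {u : Mat} (hu : D.Pos u) (hv : D.Pos (-u)) : u = 0 := by
  apply hu.eq_zero
  intro p
  have := hv.bf_nonneg p
  rw [bf_neg_right] at this; linarith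

lemma Pos.add_eq_zero {u v : Mat} (hu : D.Pos u) (hv : D.Pos v) (h : u + v = 0) : u = 0 :=
  hu.antisymm (by rw [eq_neg_of_add_eq_zero_left h]; simpa)

variable (D)

lemma pos_E (s : Fin 3) : D.Pos (D.E s) :=
  ⟨fun t => if t = s then 1 else 0, fun t => by positivity, by simp⟩

lemma pos_zero : D.Pos 0 := ⟨0, by simp, by simp⟩

lemma E_ne (s : Fin 3) : D.E s ≠ 0 := by
  intro h; have := D.sq s; rw [h] at this; simp at this

lemma refl_E (s t : Fin 3) : D.refl s (D.E t) = D.E t + (2 * Real.cos (Real.pi / D.M s t)) • D.E s := by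
  rw [refl_formula _ _ _ (D.trE t), bf_EE, D.M.symmetric t s]
  module

open CoxeterSystem in
/-- action of alternating words -/
lemma alt_E (s t : Fin 3) (h : s ≠ t) (k : ℕ) :
    let θ := Real.pi / D.M s t
    D.ρ (D.cs.wordProd (alternatingWord s t k)) (D.E s) =
      (Real.sin ((k + 1) * θ) / Real.sin θ) • D.E (if Even k then s else t) +
      (Real.sin (k * θ) / Real.sin θ) • D.E (if Even k then t else s) := by
  intro θ
  have hm : (6 : ℝ) ≤ D.M s t := by exact_mod_cast D.M_ne s t h
  have hs : 0 < Real.sin θ := by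
    apply Real.sin_pos_of_pos_of_lt_pi
    · have := Real.pi_pos; positivity
    · apply div_lt_self Real.pi_pos; linarith
  induction k with
  | zero =>
    simp [alternatingWord, hs.ne']
  | succ k ih =>
    rw [alternatingWord_succ', wordProd_cons, ρ_mul, ih, ρ_simple]
    have key : Real.sin (((k + 1 : ℕ) + 1) * θ) / Real.sin θ =
        (Real.sin ((k + 1) * θ) / Real.sin θ) * (2 * Real.cos θ) - Real.sin (k * θ) / Real.sin θ := by
      have e1 : (((k + 1 : ℕ) : ℝ) + 1) * θ = (k+1) * θ + θ := by push_cast; ring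
      have e2 : (k : ℝ) * θ = (k+1) * θ - θ := by ring
      rw [e1, e2, Real.sin_add, Real.sin_sub]
      field_simp; ring
    rw [key]
    have self : ∀ s, D.refl s (D.E s) = - D.E s := by
      intro s; rw [refl_E]; simp; rw [two_smul]; abel
    by_cases hk : Even k
    · have hk' : ¬ Even (k+1) := by simp [hk, parity_simps]
      simp only [hk, hk', if_true, if_false]
      rw [map_add, map_smul, map_smul, self, refl_E, D.M.symmetric t s]
      push_cast
      module
    · have hk' : Even (k+1) := by simp [hk, parity_simps]
      simp only [hk, hk', if_true, if_false]
      rw [map_add, map_smul, map_smul, self, refl_E]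
      push_cast
      module

lemma refl_self (s : Fin 3) : D.refl s (D.E s) = - D.E s := by
  rw [refl_E]; simp; rw [two_smul]; abel

open CoxeterSystem in
/-- the theorem of Tits -/
lemma tits (w : D.W) : ∀ s, ¬ D.cs.IsRightDescent w s → D.Pos (D.ρ w (D.E s)) := by
  induction hl : D.cs.length w using Nat.strong_induction_on generalizing w with
  | _ N IH =>
  intro s hs
  by_cases hw : w = 1
  · subst hw; simpa using D.pos_E s
  obtain ⟨t, ht⟩ := D.cs.exists_rightDescent_of_ne_one hw
  have hst : s ≠ t := by rintro rfl; exact hs ht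
  -- maximal k
  let P : ℕ → Prop := fun k => ∃ v : D.W, w = v * D.cs.wordProd (alternatingWord s t k) ∧
    D.cs.length w = D.cs.length v + k
  have P1 : P 1 := by
    refine ⟨w * D.cs.simple t, by simp [alternatingWord], ?_⟩
    have := D.cs.isRightDescent_iff.mp ht; omega
  have hb : ∀ k, P k → k ≤ N := by rintro k ⟨v, _, h⟩; omega
  classical
  obtain ⟨k, hk1, hPk, hmax⟩ : ∃ k, 1 ≤ k ∧ P k ∧ ¬ P (k+1) := by
    have h1N := hb 1 P1
    refine ⟨Nat.findGreatest P N, Nat.le_findGreatest h1N P1, Nat.findGreatest_spec h1N P1, ?_⟩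
    intro h
    have := Nat.le_findGreatest (hb _ h) h
    omega
  obtain ⟨v, hv, hlv⟩ := hPk
  -- k < M s t
  have hM := D.M_ne s t hst
  have hkM : k + 1 ≤ D.M s t := by
    by_contra hcon
    push Not at hcon
    apply hs
    -- w = (v * u) * alt s t M, alt s t M = alt t s M ends in s
    have hsplit : ∀ m j, alternatingWord s t (j + m) = 
        (if Even m then alternatingWord s t j else alternatingWord t s j) ++ alternatingWord s t m := by
      intro m
      have : ∀ (a b : Fin 3) m j, alternatingWord a b (j + m) = 
        (if Even m then alternatingWord a b j else alternatingWord b a j) ++ alternatingWord a b m := by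
        intro a b m
        induction m generalizing a b with
        | zero => intro j; simp [alternatingWord]
        | succ m ih =>
          intro j
          rw [← add_assoc, alternatingWord_succ, ih b a, alternatingWord_succ]
          by_cases h : Even m
          · have h' : ¬ Even (m+1) := by simp [h, parity_simps]
            simp [h, h']
          · have h' : Even (m+1) := by simp [h, parity_simps]
            simp [h, h']
      exact this s t m
    obtain ⟨j, hj⟩ : ∃ j, k = j + D.M s t := ⟨k - D.M s t, by omega⟩
    rw [hj, hsplit, wordProd_append] at hv
    set L := (if Even (D.M s t) then alternatingWord s t j else alternatingWord t s j) with hL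
    have hLl : L.length = j := by
      rw [hL]; split_ifs <;> simp
    have hbr2 := D.cs.prod_alternatingWord_eq_prod_alternatingWord_sub s t (D.M s t) (by omega)
    have e : D.M s t * 2 - D.M s t = (D.M s t - 1) + 1 := by omega
    rw [e, alternatingWord_succ, wordProd_concat] at hbr2
    rw [hbr2] at hv
    have hws : w * D.cs.simple s = v * D.cs.wordProd L *
        D.cs.wordProd (alternatingWord s t (D.M s t - 1)) := by
      rw [hv]; simp [mul_assoc]
    unfold IsRightDescent
    rw [hws]
    have l1 := D.cs.length_mul_le (v * D.cs.wordProd L) (D.cs.wordProd (alternatingWord s t (D.M s t - 1)))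
    have l2 := D.cs.length_mul_le v (D.cs.wordProd L)
    have l3 := D.cs.length_wordProd_le L
    have l4 := D.cs.length_wordProd_le (alternatingWord s t (D.M s t - 1))
    rw [length_alternatingWord] at l4
    omega
  -- v has no descents in {s,t}
  have hdesc : ∀ r, (r = s ∨ r = t) → ¬ D.cs.IsRightDescent v r := by
    intro r hr hd
    rw [isRightDescent_iff] at hd
    -- next letter
    by_cases hrn : r = if Even k then t else s
    · apply hmax
      refine ⟨v * D.cs.simple r, ?_, by omega⟩
      rw [alternatingWord_succ', wordProd_cons, ← hrn, hv]
      simp [mul_assoc]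
    · -- r is the first letter of the word
      obtain ⟨j, rfl⟩ : ∃ j, k = j + 1 := ⟨k - 1, by omega⟩
      have hr' : r = if Even j then t else s := by
        by_cases hj : Even j
        · have h' : ¬ Even (j+1) := by simp [hj, parity_simps]
          simp only [h', hj, if_true, if_false] at hrn ⊢
          tauto
        · have h' : Even (j+1) := by simp [hj, parity_simps]
          simp only [h', hj, if_true, if_false] at hrn ⊢
          tauto
      have hw' : w = v * D.cs.simple r * D.cs.wordProd (alternatingWord s t j) := by
        rw [hv, alternatingWord_succ', wordProd_cons, ← hr']; simp [mul_assoc]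
      have l1 := D.cs.length_mul_le (v * D.cs.simple r) (D.cs.wordProd (alternatingWord s t j))
      have l4 := D.cs.length_wordProd_le (alternatingWord s t j)
      rw [length_alternatingWord] at l4
      rw [← hw'] at l1
      omega
  have hvs := IH (D.cs.length v) (by omega) v rfl s (hdesc s (Or.inl rfl))
  have hvt := IH (D.cs.length v) (by omega) v rfl t (hdesc t (Or.inr rfl))
  have hva : ∀ r, (r = s ∨ r = t) → D.Pos (D.ρ v (D.E r)) := by
    rintro r (rfl | rfl) <;> assumption
  rw [hv, ρ_mul, alt_E _ _ _ hst, map_add, map_smul, map_smul]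
  have hm : (6 : ℝ) ≤ D.M s t := by exact_mod_cast hM
  have hsin : ∀ a : ℝ, 0 ≤ a → a ≤ D.M s t → 0 ≤ Real.sin (a * (Real.pi / D.M s t)) := by
    intro a h0 h1
    have := Real.pi_pos
    apply Real.sin_nonneg_of_nonneg_of_le_pi (by positivity)
    rw [mul_div_assoc', div_le_iff₀ (by linarith)]
    nlinarith
  have hs1 := hsin 1 (by norm_num) (by linarith)
  rw [one_mul] at hs1
  have hkM' : (k : ℝ) + 1 ≤ D.M s t := by exact_mod_cast hkM
  apply Pos.add
  · apply Pos.smul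
    · apply hva; split_ifs <;> simp
    · exact div_nonneg (hsin _ (by positivity) hkM') hs1
  · apply Pos.smul
    · apply hva; split_ifs <;> simp
    · exact div_nonneg (hsin _ (by positivity) (by linarith)) hs1

lemma tits_neg (w : D.W) (s : Fin 3) (h : D.cs.IsRightDescent w s) : D.Pos (-D.ρ w (D.E s)) := by
  rw [D.cs.isRightDescent_iff_not_isRightDescent_mul] at h
  have := D.tits _ _ h
  rwa [ρ_mul, ρ_simple, refl_self, map_neg] at this

/-- dominant vectors -/
def Dom (v : Mat) : Prop := v.trace = 0 ∧ ∀ s, 0 ≤ bf v (D.E s)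

lemma dom_J (p : Fin 3) : D.Dom (D.J p) := ⟨D.J_trace p, D.bf_J_E_nonneg p⟩

lemma ρ_mul_simple (w : D.W) (s : Fin 3) (v : Mat) (hv : v.trace = 0) :
    D.ρ (w * D.cs.simple s) v = D.ρ w v - (2 * bf v (D.E s)) • D.ρ w (D.E s) := by
  rw [ρ_mul, ρ_simple, refl_formula _ _ _ hv, map_sub, map_smul]

/-- length induction -/
lemma len_ind {P : D.W → Prop} (h1 : P 1)
    (hs : ∀ w s, ¬ D.cs.IsRightDescent w s → P w → P (w * D.cs.simple s)) (w : D.W) : P w := by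
  induction hl : D.cs.length w generalizing w with
  | zero => rw [D.cs.length_eq_zero_iff] at hl; rwa [hl]
  | succ n ih =>
    have hw : w ≠ 1 := by rintro rfl; simp at hl
    obtain ⟨t, ht⟩ := D.cs.exists_rightDescent_of_ne_one hw
    have h2 := D.cs.isRightDescent_iff.mp ht
    have h3 := hs (w * D.cs.simple t) t (D.cs.isRightDescent_iff_not_isRightDescent_mul.mp ht)
      (ih _ (by omega))
    simpa using h3

lemma F3 (v : Mat) (hv : D.Dom v) (w : D.W) : D.Pos (v - D.ρ w v) := by
  refine D.len_ind (P := fun w => D.Pos (v - D.ρ w v)) ?_ ?_ w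
  · simpa using D.pos_zero
  · intro w s hs ih
    rw [ρ_mul_simple _ _ _ _ hv.1]
    have : v - (D.ρ w v - (2 * bf v (D.E s)) • D.ρ w (D.E s)) =
      (v - D.ρ w v) + (2 * bf v (D.E s)) • D.ρ w (D.E s) := by abel
    rw [this]
    exact ih.add ((D.tits w s hs).smul (by linarith [hv.2 s]))

lemma ρE_ne (w : D.W) (s : Fin 3) : D.ρ w (D.E s) ≠ 0 := by
  intro h
  have := D.ρ_inv_self w (D.E s)
  rw [h, map_zero] at this
  exact D.E_ne s this.symm

/-- stabilizers of dominant vectors -/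
lemma F4 (v : Mat) (hv : D.Dom v) (w : D.W) (h : D.ρ w v = v) :
    w ∈ Subgroup.closure (D.cs.simple '' {s | bf v (D.E s) = 0}) := by
  revert h
  refine D.len_ind (P := fun w => D.ρ w v = v →
    w ∈ Subgroup.closure (D.cs.simple '' {s | bf v (D.E s) = 0})) ?_ ?_ w
  · intro _; exact one_mem _
  · intro w s hs ih h
    rw [ρ_mul_simple _ _ _ _ hv.1] at h
    have h1 := D.F3 v hv w
    have h2 := D.tits w s hs
    have h3 := h2.smul (a := 2 * bf v (D.E s)) (by linarith [hv.2 s])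
    have h4 : v - D.ρ w v = 0 := h1.add_eq_zero h3 (by nth_rw 1 [← h]; abel)
    have h5 : D.ρ w v = v := (sub_eq_zero.mp h4).symm
    rw [h5, sub_eq_self, smul_eq_zero] at h
    have h6 : bf v (D.E s) = 0 := by
      rcases h with h | h
      · linarith
      · exact absurd h (D.ρE_ne w s)
    exact mul_mem (ih h5) (Subgroup.subset_closure ⟨s, h6, rfl⟩)

/-- nearest neighbours -/
lemma F5 (p q : Fin 3) (hpq : p ≠ q) (w : D.W) (h : bf (D.J p) (D.ρ w (D.J q)) = bf (D.J p) (D.J q)) :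
    ∃ u ∈ Subgroup.closure (D.cs.simple '' {s | s ≠ p}),
    ∃ v ∈ Subgroup.closure (D.cs.simple '' {s | s ≠ q}), w = u * v := by
  induction hl : D.cs.length w using Nat.strong_induction_on generalizing w with
  | _ N IH =>
  have fixJ : ∀ p s, s ≠ p → D.refl s (D.J p) = D.J p := by
    intro p s hsp
    rw [refl_formula _ _ _ (D.J_trace p), D.bf_J_E_ne p s hsp]; simp
  by_cases hw : w = 1
  · exact ⟨1, one_mem _, 1, one_mem _, by simp [hw]⟩
  by_cases hL : ∃ s, s ≠ p ∧ D.cs.IsLeftDescent w s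
  · obtain ⟨s, hs, hd⟩ := hL
    obtain ⟨u, hu, v, hv, e⟩ := IH (D.cs.length (D.cs.simple s * w)) (by rw [← hl]; exact hd)
      (D.cs.simple s * w) (by
        rw [ρ_mul, ρ_simple, ← h]
        nth_rw 1 [← fixJ p s hs]
        rw [refl_bf]) rfl
    refine ⟨D.cs.simple s * u, mul_mem (Subgroup.subset_closure ⟨s, hs, rfl⟩) hu, v, hv, ?_⟩
    rw [mul_assoc, ← e]; simp
  by_cases hR : ∃ s, s ≠ q ∧ D.cs.IsRightDescent w s
  · obtain ⟨s, hs, hd⟩ := hR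
    obtain ⟨u, hu, v, hv, e⟩ := IH (D.cs.length (w * D.cs.simple s)) (by rw [← hl]; exact hd)
      (w * D.cs.simple s) (by rw [ρ_mul, ρ_simple, fixJ q s hs, h]) rfl
    refine ⟨u, hu, v * D.cs.simple s, mul_mem hv (Subgroup.subset_closure ⟨s, hs, rfl⟩), ?_⟩
    rw [← mul_assoc, ← e]; simp
  exfalso
  obtain ⟨t, ht⟩ := D.cs.exists_rightDescent_of_ne_one hw
  have htq : t = q := by by_contra hc; exact hR ⟨t, hc, ht⟩
  subst htq
  -- `w = w' * s t`
  set w' := w * D.cs.simple t with hw'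
  have hww : w = w' * D.cs.simple t := by simp [hw']
  have hnd : ¬ D.cs.IsRightDescent w' t := D.cs.isRightDescent_iff_not_isRightDescent_mul.mp ht
  have hpos := D.tits w' t hnd
  have hwE : D.ρ w (D.E t) = - D.ρ w' (D.E t) := by
    rw [hww, ρ_mul, ρ_simple, refl_self, map_neg]
  have hc0 : bf (D.J p) (D.ρ w' (D.E t)) ≤ 0 := by
    rw [hww, ρ_mul_simple _ _ _ _ (D.J_trace t), bf_sub_right, bf_smul_right] at h
    have h1 := (D.F3 _ (D.dom_J t) w').bf_nonneg p
    rw [bf_sub_right] at h1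
    have h2 := D.bf_J_E_pos t
    nlinarith
  obtain ⟨c, hc, hce⟩ := hpos
  rw [hce, bf_J_sum] at hc0
  have hcp : c p = 0 := by
    have h2 := D.bf_J_E_pos p
    nlinarith [hc p]
  have hleft : ∀ s, s ≠ p → D.Pos (D.ρ w⁻¹ (D.E s)) := by
    intro s hs
    apply D.tits
    rw [CoxeterSystem.isRightDescent_inv_iff]
    intro hd; exact hL ⟨s, hs, hd⟩
  have hfin : D.Pos (-D.E t) := by
    have e1 : D.ρ w⁻¹ (D.ρ w (D.E t)) = D.E t := D.ρ_inv_self _ _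
    rw [← e1, hwE, hce, map_neg, neg_neg, map_sum]
    rw [← Finset.sum_erase (a := p) _ (by rw [hcp]; simp)]
    apply Finset.sum_induction _ D.Pos (fun a b => Pos.add) D.pos_zero
    intro s hs
    rw [map_smul]
    exact (hleft s (Finset.ne_of_mem_erase hs)).smul (hc s)
  exact D.E_ne t ((D.pos_E t).antisymm hfin)

end TD

namespace TD
variable (D : TD)

/-! ### torsion -/

lemma refl_invol (s : Fin 3) (v : Mat) : D.refl s (D.refl s v) = v := by
  rw [← ρ_simple, ← ρ_mul]; simp

lemma refl_bf_left (s : Fin 3) (u v : Mat) : bf (D.refl s u) v = bf u (D.refl s v) := by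
  rw [← D.refl_bf s u, refl_invol]

lemma refl_pos (s : Fin 3) (w : D.W) (t : Fin 3) (hp : D.Pos (D.ρ w (D.E t)))
    (hne : D.ρ w (D.E t) ≠ D.E s) : D.Pos (D.refl s (D.ρ w (D.E t))) := by
  have e : D.refl s (D.ρ w (D.E t)) = D.ρ (D.cs.simple s * w) (D.E t) := by
    rw [ρ_mul, ρ_simple]
  by_cases hd : D.cs.IsRightDescent (D.cs.simple s * w) t
  swap
  · rw [e]; exact D.tits _ _ hd
  exfalso
  have hn := D.tits_neg _ _ hd
  rw [← e] at hn
  obtain ⟨c, hc, hce⟩ := hp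
  have hz : ∀ p, p ≠ s → c p = 0 := by
    intro p hps
    have h1 := hn.bf_nonneg p
    rw [bf_neg_right, ← refl_bf_left, refl_formula _ _ _ (D.J_trace p),
      D.bf_J_E_ne p s (Ne.symm hps)] at h1
    simp only [mul_zero, zero_smul, sub_zero] at h1
    rw [hce, bf_J_sum] at h1
    have h2 := D.bf_J_E_pos p
    nlinarith [hc p]
  have hb : D.ρ w (D.E t) = c s • D.E s := by
    rw [hce, Finset.sum_eq_single s]
    · intro p _ hp; rw [hz p hp, zero_smul]
    · simp
  have hnorm : bf (D.ρ w (D.E t)) (D.ρ w (D.E t)) = 1 := by rw [ρ_bf, bf_EE_self]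
  rw [hb, bf_smul_left, bf_smul_right, bf_EE_self] at hnorm
  have : c s = 1 := by nlinarith [hc s]
  rw [this, one_smul] at hb
  exact hne hb

/-- roots negative on `v` -/
def Neg (v : Mat) : Set Mat := {β | (∃ w s, β = D.ρ w (D.E s)) ∧ D.Pos β ∧ bf v β < 0}

lemma neg_refl_subset (s : Fin 3) (v : Mat) :
    D.Neg (D.refl s v) ⊆ insert (D.E s) (D.refl s '' (D.Neg v)) := by
  rintro β ⟨⟨w, t, rfl⟩, hp, hn⟩
  by_cases h : D.ρ w (D.E t) = D.E s
  · left; exact h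
  · right
    refine ⟨D.refl s (D.ρ w (D.E t)), ⟨⟨D.cs.simple s * w, t, by rw [ρ_mul, ρ_simple]⟩,
      D.refl_pos s w t hp h, by rwa [← refl_bf_left]⟩, D.refl_invol _ _⟩

lemma neg_refl_subset' (s : Fin 3) (v : Mat) (hv : bf v (D.E s) < 0) :
    D.Neg (D.refl s v) ⊆ D.refl s '' (D.Neg v \ {D.E s}) := by
  rintro β ⟨⟨w, t, rfl⟩, hp, hn⟩
  by_cases h : D.ρ w (D.E t) = D.E s
  · exfalso
    rw [h, refl_bf_left, refl_self, bf_neg_right] at hn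
    linarith
  · refine ⟨D.refl s (D.ρ w (D.E t)), ⟨⟨⟨D.cs.simple s * w, t, by rw [ρ_mul, ρ_simple]⟩,
      D.refl_pos s w t hp h, by rwa [← refl_bf_left]⟩, ?_⟩, D.refl_invol _ _⟩
    intro hc
    rw [Set.mem_singleton_iff] at hc
    have h2 := D.refl_invol s (D.ρ w (D.E t))
    rw [hc, refl_self] at h2
    rw [← h2] at hp
    exact D.E_ne s ((D.pos_E s).antisymm hp)

/-- Weyl vector -/
noncomputable def wv : Mat := ∑ p, D.J p

lemma wv_trace : (D.wv).trace = 0 := by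
  unfold wv; simp [Matrix.trace_sum, D.J_trace]

lemma wv_pos {β : Mat} (h : D.Pos β) : 0 ≤ bf D.wv β := by
  unfold wv; rw [bf_sum_left]
  exact Finset.sum_nonneg fun p _ => h.bf_nonneg p

lemma wv_dom : D.Dom D.wv := ⟨D.wv_trace, fun s => D.wv_pos (D.pos_E s)⟩

lemma wv_self : bf D.wv D.wv < 0 := by
  unfold wv
  simp only [Fin.sum_univ_three, bf_add_left, bf_add_right]
  linarith [D.bf_JJ_neg 0 0, D.bf_JJ_neg 0 1, D.bf_JJ_neg 0 2, D.bf_JJ_neg 1 0, D.bf_JJ_neg 1 1,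
    D.bf_JJ_neg 1 2, D.bf_JJ_neg 2 0, D.bf_JJ_neg 2 1, D.bf_JJ_neg 2 2]

lemma neg_wv (w : D.W) : (D.Neg (D.ρ w D.wv)).Finite := by
  induction w using D.cs.simple_induction_left with
  | one =>
    have : D.Neg (D.ρ 1 D.wv) = ∅ := by
      ext β
      simp only [map_one, Module.End.one_apply, Set.mem_empty_iff_false, iff_false]
      rintro ⟨_, hp, hn⟩
      linarith [D.wv_pos hp]
    rw [this]; exact Set.finite_empty
  | mul_simple_left w i h =>
    rw [ρ_mul, ρ_simple]
    exact ((h.image _).insert _).subset (D.neg_refl_subset i _)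

lemma exists_dom (v : Mat) (hv : v.trace = 0) (hf : (D.Neg v).Finite) : ∃ u, D.Dom (D.ρ u v) := by
  induction hN : (D.Neg v).ncard using Nat.strong_induction_on generalizing v with
  | _ N IH =>
  by_cases hd : D.Dom v
  · exact ⟨1, by simpa⟩
  obtain ⟨s, hs⟩ : ∃ s, bf v (D.E s) < 0 := by
    by_contra hc; push Not at hc; exact hd ⟨hv, hc⟩
  have hsub := D.neg_refl_subset' s v hs
  have hmem : D.E s ∈ D.Neg v := ⟨⟨1, s, by simp⟩, D.pos_E s, hs⟩
  have hfin' : (D.refl s '' (D.Neg v \ {D.E s})).Finite := (hf.subset Set.sdiff_subset).image _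
  have hlt : (D.Neg (D.refl s v)).ncard < N := by
    calc _ ≤ (D.refl s '' (D.Neg v \ {D.E s})).ncard := Set.ncard_le_ncard hsub hfin'
      _ ≤ (D.Neg v \ {D.E s}).ncard := Set.ncard_image_le (hf.subset Set.sdiff_subset)
      _ < (D.Neg v).ncard := Set.ncard_sdiff_singleton_lt_of_mem hmem hf
      _ = N := hN
  obtain ⟨u, hu⟩ := IH _ hlt (D.refl s v) (D.refl_trace s v hv) (hfin'.subset hsub) rfl
  exact ⟨u * D.cs.simple s, by rwa [ρ_mul, ρ_simple]⟩

lemma nondeg (v : Mat) (hv : v.trace = 0) (h : ∀ s, bf v (D.E s) = 0) : v = 0 := by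
  have hac : ∀ s, D.E s * v = - (v * D.E s) := by
    intro s
    have := anticomm v (D.E s) hv (D.trE s)
    rw [h s, mul_zero, zero_smul] at this
    exact eq_neg_of_add_eq_zero_right this
  set A := D.E 0 * D.E 1 * D.E 2 with hA
  have hA1 : A * v = - (v * A) := by
    calc A * v = D.E 0 * D.E 1 * (D.E 2 * v) := by rw [hA]; noncomm_ring
      _ = -(D.E 0 * (D.E 1 * v) * D.E 2) := by rw [hac]; noncomm_ring
      _ = (D.E 0 * v) * D.E 1 * D.E 2 := by rw [hac]; noncomm_ring
      _ = _ := by rw [hac, hA]; noncomm_ring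
  have htr : A.trace ≠ 0 := D.ori.ne
  set A0 := A - (A.trace / 2) • (1 : Mat) with hA0
  have h0 : A0.trace = 0 := by rw [hA0]; simp
  have h1 := anticomm A0 v h0 hv
  have h2 : A0 * v + v * A0 = - A.trace • v := by
    rw [hA0, sub_mul, mul_sub, hA1]
    simp only [smul_mul_assoc, mul_smul_comm, one_mul, mul_one]
    module
  rw [h1] at h2
  have h3 := congrArg Matrix.trace h2
  simp [hv] at h3
  rw [h3] at h2
  simp at h2
  tauto

lemma torsion (f : D.W) (N : ℕ) (hN : 0 < N) (hf : f ^ N = 1) :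
    ∃ (u : D.W) (p : Fin 3), u * f * u⁻¹ ∈ Subgroup.closure (D.cs.simple '' {s | s ≠ p}) := by
  set v : Mat := ∑ x ∈ Finset.range N, D.ρ (f ^ x) D.wv with hv
  have hvt : v.trace = 0 := by
    rw [hv, Matrix.trace_sum]
    exact Finset.sum_eq_zero fun x _ => D.ρ_trace _ _ D.wv_trace
  have hfv : D.ρ f v = v := by
    rw [hv, map_sum]
    have : ∀ x, D.ρ f (D.ρ (f^x) D.wv) = D.ρ (f^(x+1)) D.wv := by
      intro x; rw [← ρ_mul, ← pow_succ']
    simp only [this]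
    have h1 := Finset.sum_range_succ (fun x => D.ρ (f ^ x) D.wv) N
    have h2 := Finset.sum_range_succ' (fun x => D.ρ (f ^ x) D.wv) N
    rw [h1, hf, pow_zero] at h2
    exact (add_right_cancel h2).symm
  have hneg : bf D.wv v < 0 := by
    rw [hv, bf_sum_right]
    apply Finset.sum_neg
    · intro x _
      have h1 := D.wv_pos (D.F3 _ D.wv_dom (f^x))
      rw [bf_sub_right] at h1
      linarith [D.wv_self]
    · exact ⟨0, by simpa using hN⟩
  have hfin : (D.Neg v).Finite := by
    apply ((Finset.range N).finite_toSet.biUnion (fun x _ => D.neg_wv (f^x))).subset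
    rintro β ⟨hr, hp, hn⟩
    rw [hv, bf_sum_left] at hn
    obtain ⟨x, hx, hlt⟩ := Finset.exists_lt_of_sum_lt (s := Finset.range N)
      (f := fun x => bf (D.ρ (f^x) D.wv) β) (g := fun _ => 0) (by simpa using hn)
    simp only [Set.mem_iUnion]
    exact ⟨x, hx, hr, hp, hlt⟩
  obtain ⟨u, hu⟩ := D.exists_dom v hvt hfin
  have hne : D.ρ u v ≠ 0 := by
    intro h
    have := D.ρ_inv_self u v
    rw [h, map_zero] at this
    rw [← this] at hneg
    simp [bf] at hneg
  obtain ⟨p, hp⟩ : ∃ p, bf (D.ρ u v) (D.E p) ≠ 0 := by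
    by_contra hc; push Not at hc
    exact hne (D.nondeg _ hu.1 hc)
  refine ⟨u, p, ?_⟩
  have h4 := D.F4 _ hu (u * f * u⁻¹) (by rw [ρ_mul, ρ_inv_self, ρ_mul, hfv])
  refine Subgroup.closure_mono (Set.image_mono ?_) h4
  intro s hs
  rintro rfl
  exact hp hs

/-! ### rotations -/

/-- The rotations -/
def r (p : Fin 3) : D.W := D.cs.simple (p+1) * D.cs.simple (p+2)

lemma r_conj (p : Fin 3) (m : ℤ) :
    D.cs.simple (p+1) * D.r p ^ m = D.r p ^ (-m) * D.cs.simple (p+1) := by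
  have h : D.cs.simple (p+1) * D.r p * (D.cs.simple (p+1))⁻¹ = (D.r p)⁻¹ := by
    unfold r; simp
  have h2 : (D.cs.simple (p+1) * D.r p * (D.cs.simple (p+1))⁻¹) ^ m = (D.r p)^(-m) := by
    rw [h]; simp
  rw [conj_zpow] at h2
  rw [← h2]; simp

lemma fin3_cases : ∀ p s : Fin 3, s ≠ p → s = p + 1 ∨ s = p + 2 := by decide

lemma dihedral (p : Fin 3) (g : D.W) (hg : g ∈ Subgroup.closure (D.cs.simple '' {s | s ≠ p})) :
    ∃ m : ℤ, g = D.r p ^ m ∨ g = D.r p ^ m * D.cs.simple (p+1) := by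
  have hs2 : D.cs.simple (p+2) = D.cs.simple (p+1) * D.r p := by unfold r; simp
  have key : ∀ x : D.W, (∃ m : ℤ, x = D.r p ^ m ∨ x = D.r p ^ m * D.cs.simple (p+1)) →
      ∀ s, s ≠ p → (∃ m : ℤ, x * D.cs.simple s = D.r p ^ m ∨
        x * D.cs.simple s = D.r p ^ m * D.cs.simple (p+1)) := by
    rintro x ⟨m, hx⟩ s hs
    have := fin3_cases p s hs
    rcases this with rfl | rfl
    · rcases hx with rfl | rfl
      · exact ⟨m, Or.inr rfl⟩
      · exact ⟨m, Or.inl (by simp)⟩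
    · rcases hx with rfl | rfl
      · refine ⟨m - 1, Or.inr ?_⟩
        have h1 := D.r_conj p 1
        rw [zpow_one] at h1
        rw [hs2, h1, ← mul_assoc, ← zpow_add]; rfl
      · refine ⟨m + 1, Or.inl ?_⟩
        rw [hs2, zpow_add_one]; simp [mul_assoc]
  induction hg using Subgroup.closure_induction_right with
  | one => exact ⟨0, Or.inl (by simp)⟩
  | mul_right x hx y hy ih =>
    obtain ⟨s, hs, rfl⟩ := hy
    exact key x ih s hs
  | mul_inv_cancel x hx y hy ih =>
    obtain ⟨s, hs, rfl⟩ := hy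
    rw [CoxeterSystem.inv_simple]
    exact key x ih s hs

/-- even elements -/
def Ev (w : D.W) : Prop := D.cs.lengthParity w = 1

lemma ev_r (p : Fin 3) (m : ℤ) : D.Ev (D.r p ^ m) := by
  unfold Ev r
  rw [map_zpow, map_mul, CoxeterSystem.lengthParity_simple, CoxeterSystem.lengthParity_simple]
  have : Multiplicative.ofAdd (1 : ZMod 2) * Multiplicative.ofAdd (1 : ZMod 2) = 1 := by decide
  rw [this, one_zpow]

lemma not_ev_simple (s : Fin 3) : ¬ D.Ev (D.cs.simple s) := by
  unfold Ev
  rw [CoxeterSystem.lengthParity_simple]; decide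

lemma dihedral_ev (p : Fin 3) (g : D.W) (hg : g ∈ Subgroup.closure (D.cs.simple '' {s | s ≠ p}))
    (he : D.Ev g) : ∃ m : ℤ, g = D.r p ^ m := by
  obtain ⟨m, h | h⟩ := D.dihedral p g hg
  · exact ⟨m, h⟩
  · exfalso
    have h1 := D.ev_r p m
    unfold Ev at *
    rw [h, map_mul, h1, one_mul] at he
    exact D.not_ev_simple (p+1) he

lemma r_pow_n (p : Fin 3) : D.r p ^ D.n p = 1 := by
  have := D.cs.simple_mul_simple_pow (p+1) (p+2)
  have e : D.M (p+1) (p+2) = D.n p := by fin_cases p <;> rfl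
  rwa [e] at this

/-- lifts of even elements to `SL₂(ℝ)` -/
def Lift (w : D.W) (A B : Mat) : Prop := A * B = 1 ∧ A.det = 1 ∧ ∀ v, D.ρ w v = A * v * B

lemma E_det (s : Fin 3) : (D.E s).det = -1 := by
  have h1 := D.trE s
  have h2 := congrFun (congrFun (D.sq s) 0) 0
  rw [Matrix.trace_fin_two] at h1
  simp [Matrix.mul_apply, Fin.sum_univ_two] at h2
  rw [Matrix.det_fin_two]
  have : D.E s 1 1 = - D.E s 0 0 := by linarith
  rw [this]; linarith

variable {D}

lemma Lift.mul {w w' : D.W} {A B A' B' : Mat} (h : D.Lift w A B) (h' : D.Lift w' A' B') :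
    D.Lift (w * w') (A * A') (B' * B) := by
  refine ⟨?_, by rw [Matrix.det_mul, h.2.1, h'.2.1, one_mul], ?_⟩
  · calc _ = A * (A' * B') * B := by noncomm_ring
      _ = 1 := by rw [h'.1, mul_one, h.1]
  · intro v; rw [ρ_mul, h'.2.2, h.2.2]; noncomm_ring

lemma Lift.inv {w : D.W} {A B : Mat} (h : D.Lift w A B) : D.Lift w⁻¹ B A := by
  have h1 : B * A = 1 := mul_eq_one_comm.mp h.1
  refine ⟨h1, ?_, ?_⟩
  · have := congrArg Matrix.det h1
    rwa [Matrix.det_mul, h.2.1, mul_one, Matrix.det_one] at this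
  · intro v
    have h2 := h.2.2 (B * v * A)
    have h3 : A * (B * v * A) * B = (A * B) * v * (A * B) := by noncomm_ring
    rw [h3, h.1, one_mul, mul_one] at h2
    have h4 := congrArg (D.ρ w⁻¹) h2
    rw [ρ_inv_self] at h4
    exact h4.symm

lemma Lift.unique {w : D.W} {A B A' B' : Mat} (h : D.Lift w A B) (h' : D.Lift w A' B') :
    ∃ c : ℝ, (c = 1 ∨ c = -1) ∧ A = c • A' := by
  have hBA : B * A = 1 := mul_eq_one_comm.mp h.1
  have hBA' : B' * A' = 1 := mul_eq_one_comm.mp h'.1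
  have hcomm : ∀ v, (B' * A) * v = v * (B' * A) := by
    intro v
    have h1 : A * v * B = A' * v * B' := by rw [← h.2.2, h'.2.2]
    calc (B' * A) * v = B' * (A * v * B) * A := by
          rw [show B' * (A * v * B) * A = B' * A * v * (B * A) by noncomm_ring, hBA, mul_one]
      _ = (B' * A') * v * (B' * A) := by rw [h1]; noncomm_ring
      _ = _ := by rw [hBA', one_mul]
  obtain ⟨c, hc⟩ : ∃ c : ℝ, B' * A = c • 1 := by
    set X := B' * A with hX
    refine ⟨X 0 0, ?_⟩
    have e1 := hcomm !![0, 1; 0, 0]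
    have e2 := hcomm !![0, 0; 1, 0]
    have a1 := congrFun (congrFun e1 0) 0
    have a2 := congrFun (congrFun e1 0) 1
    have a3 := congrFun (congrFun e2 0) 0
    simp [Matrix.mul_apply, Fin.sum_univ_two] at a1 a2 a3
    ext i j
    fin_cases i <;> fin_cases j <;> simp [a1.symm, a2, a3]
  have hA : A = c • A' := by
    calc A = (A' * B') * A := by rw [h'.1, one_mul]
      _ = A' * (B' * A) := by noncomm_ring
      _ = _ := by rw [hc]; simp
  refine ⟨c, ?_, hA⟩
  have hd := h.2.1
  rw [hA, Matrix.det_smul, h'.2.1] at hd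
  simp at hd
  exact hd

variable (D)

lemma lift_ev (w : D.W) (he : D.Ev w) : ∃ A B, D.Lift w A B := by
  have gen : ∀ w : D.W, ∃ A B : Mat, A * B = 1 ∧
      ((D.cs.lengthParity w = 1 ∧ A.det = 1 ∧ ∀ v, D.ρ w v = A * v * B) ∨
       (D.cs.lengthParity w = Multiplicative.ofAdd 1 ∧ A.det = -1 ∧ ∀ v, D.ρ w v = -(A * v * B))) := by
    intro w
    induction w using D.cs.simple_induction_left with
    | one => exact ⟨1, 1, by simp, Or.inl ⟨by simp, by simp, by simp⟩⟩
    | mul_simple_left w i h =>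
      obtain ⟨A, B, h1, h2⟩ := h
      refine ⟨D.E i * A, B * D.E i, ?_, ?_⟩
      · calc _ = D.E i * (A * B) * D.E i := by noncomm_ring
          _ = 1 := by rw [h1, mul_one, D.sq]
      · rw [map_mul, CoxeterSystem.lengthParity_simple, Matrix.det_mul, E_det]
        rcases h2 with ⟨h2, h3, h4⟩ | ⟨h2, h3, h4⟩
        · right
          refine ⟨by rw [h2, mul_one], by rw [h3]; norm_num, ?_⟩
          intro v; rw [ρ_mul, ρ_simple, h4, refl_apply]; noncomm_ring
        · left
          refine ⟨by rw [h2]; decide, by rw [h3]; norm_num, ?_⟩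
          intro v; rw [ρ_mul, ρ_simple, h4, refl_apply]; noncomm_ring
  obtain ⟨A, B, h1, h2 | h2⟩ := gen w
  · exact ⟨A, B, h1, h2.2⟩
  · exfalso
    unfold Ev at he
    rw [he] at h2
    exact absurd h2.1 (by decide)

/-- rotation matrices -/
noncomputable def Q (p : Fin 3) (m : ℕ) : Mat :=
  Real.cos (m * D.θ p) • 1 + Real.sin (m * D.θ p) • D.J p
noncomputable def Q' (p : Fin 3) (m : ℕ) : Mat :=
  Real.cos (m * D.θ p) • 1 - Real.sin (m * D.θ p) • D.J p

lemma QQ' (p : Fin 3) (m : ℕ) : D.Q p m * D.Q' p m = 1 := by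
  unfold Q Q'
  rw [add_mul, mul_sub, mul_sub]
  simp only [smul_mul_assoc, mul_smul_comm, one_mul, mul_one, J_sq]
  have := Real.sin_sq_add_cos_sq (m * D.θ p)
  calc _ = (Real.sin (m * D.θ p) ^ 2 + Real.cos (m * D.θ p) ^ 2) • (1 : Mat) := by module
    _ = 1 := by rw [this, one_smul]

lemma lift_r (p : Fin 3) (m : ℕ) : D.Lift (D.r p ^ m) (D.Q p m) (D.Q' p m) := by
  refine ⟨D.QQ' p m, ?_, ?_⟩
  · have h1 := D.EE_eq p
    have h2 : ((D.E (p+1) * D.E (p+2))^m).det = 1 := by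
      rw [Matrix.det_pow, Matrix.det_mul, E_det, E_det]; norm_num
    rw [h1, rot_pow _ _ (D.J_sq p), Matrix.det_smul] at h2
    simp only [Fintype.card_fin] at h2
    rw [← pow_mul, mul_comm m 2, pow_mul] at h2
    simpa [Q] using h2
  · intro v
    have h1 : D.ρ (D.r p ^ m) = (D.refl (p+1) * D.refl (p+2))^m := by
      rw [map_pow, r, map_mul, ρ_simple, ρ_simple]
    rw [h1, refl_pow]
    have h2 : (D.E (p+1) * D.E (p+2))^m = ((-1:ℝ)^m) • D.Q p m := by
      rw [EE_eq, rot_pow _ _ (D.J_sq p)]; rfl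
    have h3 : (D.E (p+2) * D.E (p+1))^m = ((-1:ℝ)^m) • D.Q' p m := by
      have e : D.E (p+2) * D.E (p+1) = -(Real.cos (D.θ p) • 1 + Real.sin (D.θ p) • (- D.J p)) := by
        have h := D.rel p
        have h' : D.E (p+2) * D.E (p+1) = (-2 * Real.cos (D.θ p)) • 1 - D.E (p+1) * D.E (p+2) := by
          rw [← show _ = (-2 * Real.cos (D.θ p)) • (1 : Mat) from h]; abel
        rw [h', EE_eq]; module
      rw [e, rot_pow _ _ (by rw [neg_mul_neg, J_sq])]
      unfold Q'; module
    rw [h2, h3]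
    simp only [smul_mul_assoc, mul_smul_comm, smul_smul, ← mul_pow]
    simp

lemma mθ_sin_pos (p : Fin 3) (m : ℕ) (h0 : 0 < m) (h1 : m < D.n p) : 0 < Real.sin (m * D.θ p) := by
  have hn : (0:ℝ) < D.n p := by exact_mod_cast (by omega)
  have h0' : (0 : ℝ) < m := by exact_mod_cast h0
  have h1' : (m : ℝ) < D.n p := by exact_mod_cast h1
  apply Real.sin_pos_of_pos_of_lt_pi (mul_pos h0' (D.θ_pos p))
  unfold θ
  rw [mul_div_assoc', div_lt_iff₀ hn]
  nlinarith [Real.pi_pos]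

lemma fixed_vec (p : Fin 3) (m : ℕ) (h0 : 0 < m) (h1 : m < D.n p) (v : Mat) (hv : v.trace = 0)
    (h : D.ρ (D.r p ^ m) v = v) : v = (-bf (D.J p) v) • D.J p := by
  have hl := D.lift_r p m
  rw [hl.2.2] at h
  have hQ : D.Q' p m * D.Q p m = 1 := mul_eq_one_comm.mp hl.1
  have h2 : D.Q p m * v = v * D.Q p m := by
    calc _ = D.Q p m * v * (D.Q' p m * D.Q p m) := by rw [hQ, mul_one]
      _ = (D.Q p m * v * D.Q' p m) * D.Q p m := by noncomm_ring
      _ = _ := by rw [h]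
  have hs := D.mθ_sin_pos p m h0 h1
  have h3 : D.J p * v = v * D.J p := by
    unfold Q at h2
    rw [add_mul, mul_add] at h2
    simp only [smul_mul_assoc, mul_smul_comm, one_mul, mul_one] at h2
    have h4 := add_left_cancel h2
    exact smul_right_injective _ hs.ne' h4
  have h4 := anticomm (D.J p) v (D.J_trace p) hv
  rw [← h3, ← two_smul ℝ, mul_smul] at h4
  have h5 : D.J p * v = bf (D.J p) v • 1 := smul_right_injective _ (two_ne_zero) h4
  have h6 : D.J p * (D.J p * v) = - v := by rw [← mul_assoc, J_sq]; simp
  rw [h5] at h6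
  simp only [mul_smul_comm, mul_one] at h6
  rw [neg_smul, h6, neg_neg]

lemma r_pow_ne (p : Fin 3) (m : ℕ) (h0 : 0 < m) (h1 : m < D.n p) : D.r p ^ m ≠ 1 := by
  intro h
  have h2 := D.fixed_vec p m h0 h1 (D.E (p+1)) (D.trE _) (by rw [h]; simp)
  rw [D.bf_J_E1] at h2
  simp at h2
  exact D.E_ne _ h2

lemma orderOf_r (p : Fin 3) : orderOf (D.r p) = D.n p := by
  have := D.hn p
  rw [orderOf_eq_iff (by omega)]
  exact ⟨D.r_pow_n p, fun m h1 h0 => D.r_pow_ne p m h0 h1⟩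

lemma J_line (w : D.W) (p q : Fin 3) (c : ℝ) (h : D.ρ w (D.J p) = c • D.J q) :
    p = q ∧ D.ρ w (D.J p) = D.J p := by
  have h1 := D.F3 _ (D.dom_J p) w
  have hc : 0 < c := by
    by_contra hc
    push Not at hc
    have h2 := h1.bf_nonneg 0
    rw [h, bf_sub_right, bf_smul_right] at h2
    nlinarith [D.bf_JJ_neg 0 p, D.bf_JJ_neg 0 q]
  have h3 := (D.F3 _ (D.dom_J q) w⁻¹).smul hc.le
  have h4 : c • D.ρ w⁻¹ (D.J q) = D.J p := by rw [← map_smul, ← h, ρ_inv_self]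
  rw [smul_sub, h4] at h3
  rw [h] at h1
  have h5 : D.J p - c • D.J q = 0 := h1.antisymm (by rwa [neg_sub])
  have h6 : D.J p = c • D.J q := sub_eq_zero.mp h5
  refine ⟨?_, by rw [h, h6]⟩
  by_contra hne
  have h7 := D.bf_J_E_pos p
  rw [h6, bf_smul_left, D.bf_J_E_ne q p hne] at h7
  simp at h7

lemma nonconj (w : D.W) (p q : Fin 3) (m n : ℕ) (h0 : 0 < n) (h1 : n < D.n q)
    (h : w * D.r p ^ m * w⁻¹ = D.r q ^ n) : p = q ∧ D.ρ w (D.J p) = D.J p := by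
  have hfix : D.ρ (D.r p ^ m) (D.J p) = D.J p := by
    rw [(D.lift_r p m).2.2]
    have : D.Q p m * D.J p = D.J p * D.Q p m := by
      unfold Q; rw [add_mul, mul_add]; simp
    rw [this, mul_assoc, QQ', mul_one]
  have h2 := D.fixed_vec q n h0 h1 (D.ρ w (D.J p)) (D.ρ_trace _ _ (D.J_trace p))
    (by rw [← h, ρ_mul, ρ_inv_self, ρ_mul, hfix])
  exact D.J_line w p q _ h2

lemma not_inv (w : D.W) (he : D.Ev w) (p : Fin 3) : w * D.r p * w⁻¹ ≠ (D.r p)⁻¹ := by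
  intro h
  have hn := D.hn p
  have hinv : (D.r p)⁻¹ = D.r p ^ (D.n p - 1) := by
    rw [inv_eq_iff_mul_eq_one, ← pow_succ']
    rw [show D.n p - 1 + 1 = D.n p by omega, r_pow_n]
  have h1 := D.nonconj w p p 1 (D.n p - 1) (by omega) (by omega) (by rw [pow_one, h, hinv])
  have h2 := D.F4 _ (D.dom_J p) w h1.2
  have h3 : w ∈ Subgroup.closure (D.cs.simple '' {s | s ≠ p}) := by
    refine Subgroup.closure_mono (Set.image_mono ?_) h2
    rintro s hs rfl
    exact (D.bf_J_E_pos s).ne' hs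
  obtain ⟨m, rfl⟩ := D.dihedral_ev p w h3 he
  have h4 : D.r p ^ m * D.r p * (D.r p ^ m)⁻¹ = D.r p := by group
  rw [h4] at h
  apply D.r_pow_ne p 2 (by norm_num) (by omega)
  rw [pow_two]; nth_rw 1 [h]; simp

lemma cos_bound (p : Fin 3) (m : ℕ) (h0 : 0 < m) (h1 : m < D.n p) :
    Real.cos (m * D.θ p) ≤ Real.cos (D.θ p) ∧ -Real.cos (D.θ p) ≤ Real.cos (m * D.θ p) ∧
    (Real.cos (m * D.θ p) = Real.cos (D.θ p) → m = 1) ∧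
    (Real.cos (m * D.θ p) = -Real.cos (D.θ p) → m = D.n p - 1) := by
  have hn : (0:ℝ) < D.n p := by exact_mod_cast (by omega)
  have hθ := D.θ_pos p
  have hπ : Real.pi = D.n p * D.θ p := by unfold θ; field_simp
  have hle : D.θ p ≤ Real.pi := by linarith [D.θ_le p, Real.pi_pos]
  have a1 : D.θ p ≤ m * D.θ p := by
    have : (1 : ℝ) ≤ m := by exact_mod_cast h0
    nlinarith
  have a2 : m * D.θ p ≤ Real.pi - D.θ p := by
    have : (m : ℝ) + 1 ≤ D.n p := by exact_mod_cast h1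
    rw [hπ]; nlinarith
  have inj := Real.injOn_cos
  refine ⟨Real.cos_le_cos_of_nonneg_of_le_pi hθ.le (by linarith) a1, ?_, ?_, ?_⟩
  · rw [← Real.cos_pi_sub]
    exact Real.cos_le_cos_of_nonneg_of_le_pi (by linarith) (by linarith) a2
  · intro h
    have := inj ⟨by linarith, by linarith⟩ ⟨hθ.le, hle⟩ h
    have h2 : (m : ℝ) = 1 := by
      have : ((m : ℝ) - 1) * D.θ p = 0 := by linarith
      rcases mul_eq_zero.mp this with h | h <;> linarith
    exact_mod_cast h2
  · intro h
    rw [← Real.cos_pi_sub] at h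
    have := inj ⟨by linarith, by linarith⟩ ⟨by linarith, by linarith⟩ h
    have h2 : (m : ℝ) + 1 = D.n p := by
      have : ((m : ℝ) + 1 - D.n p) * D.θ p = 0 := by rw [hπ] at this; linarith
      rcases mul_eq_zero.mp this with h | h <;> linarith
    have h3 : m + 1 = D.n p := by exact_mod_cast h2
    omega

set_option maxHeartbeats 1000000 in
lemma rigidity (p : Fin 3) (g h k : D.W) (hg : D.Ev g) (hh : D.Ev h) (hk : D.Ev k)
    (m n l : ℕ) (hm0 : 0 < m) (hm : m < D.n p) (hn0 : 0 < n) (hn : n < D.n (p+1))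
    (hl0 : 0 < l) (hl : l < D.n (p+2))
    (hrel : (g * D.r p ^ m * g⁻¹) * (h * D.r (p+1) ^ n * h⁻¹) * (k * D.r (p+2) ^ l * k⁻¹) = 1) :
    ((m = 1 ∧ n = 1) ∨ (m = D.n p - 1 ∧ n = D.n (p+1) - 1)) ∧
    bf (D.J p) (D.ρ (g⁻¹ * h) (D.J (p+1))) = bf (D.J p) (D.J (p+1)) := by
  obtain ⟨A, A', hA⟩ := D.lift_ev g hg
  obtain ⟨B, B', hB⟩ := D.lift_ev h hh
  obtain ⟨C, C', hC⟩ := D.lift_ev k hk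
  have l1 := (hA.mul (D.lift_r p m)).mul hA.inv
  have l2 := (hB.mul (D.lift_r (p+1) n)).mul hB.inv
  have l3 := (hC.mul (D.lift_r (p+2) l)).mul hC.inv
  have l12 := l1.mul l2
  rw [eq_inv_of_mul_eq_one_left hrel] at l12
  obtain ⟨c, hc, e⟩ := l12.unique l3.inv
  have tr := congrArg Matrix.trace e
  have hCC : C' * C = 1 := mul_eq_one_comm.mp hC.1
  have hAJ : A * D.J p * A' = D.ρ g (D.J p) := (hA.2.2 _).symm
  have hBJ : B * D.J (p+1) * B' = D.ρ h (D.J (p+1)) := (hB.2.2 _).symm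
  have t1 : A * D.Q p m * A' = Real.cos (m * D.θ p) • 1 + Real.sin (m * D.θ p) • D.ρ g (D.J p) := by
    unfold Q
    rw [mul_add, add_mul, ← hAJ]
    simp only [smul_mul_assoc, mul_smul_comm, mul_one, hA.1]
  have t2 : B * D.Q (p+1) n * B' = Real.cos (n * D.θ (p+1)) • 1 +
      Real.sin (n * D.θ (p+1)) • D.ρ h (D.J (p+1)) := by
    unfold Q
    rw [mul_add, add_mul, ← hBJ]
    simp only [smul_mul_assoc, mul_smul_comm, mul_one, hB.1]
  have t3 : (C * (D.Q' (p+2) l * C')).trace = 2 * Real.cos (l * D.θ (p+2)) := by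
    rw [Matrix.trace_mul_comm, mul_assoc, hCC, mul_one]
    unfold Q'
    simp [D.J_trace]; ring
  rw [Matrix.trace_smul, t3, t1, t2] at tr
  have tJ1 := D.ρ_trace g _ (D.J_trace p)
  have tJ2 := D.ρ_trace h _ (D.J_trace (p+1))
  have hK : (D.ρ g (D.J p) * D.ρ h (D.J (p+1))).trace =
      2 * bf (D.J p) (D.ρ (g⁻¹ * h) (D.J (p+1))) := by
    rw [ρ_mul, bf_comm, ρ_bf_left, inv_inv, bf_comm]; unfold bf; ring
  rw [add_mul, mul_add, mul_add] at tr
  simp only [smul_mul_assoc, mul_smul_comm, mul_one, one_mul, Matrix.trace_add, Matrix.trace_smul,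
    tJ1, tJ2, hK, Matrix.trace_one, Fintype.card_fin, smul_eq_mul] at tr
  set K := bf (D.J p) (D.ρ (g⁻¹ * h) (D.J (p+1))) with hKdef
  have hK0 := D.bf_JJ_succ p
  have hKle : K ≤ bf (D.J p) (D.J (p+1)) := by
    have := (D.F3 _ (D.dom_J (p+1)) (g⁻¹ * h)).bf_nonneg p
    rw [bf_sub_right] at this; linarith
  set K0 := bf (D.J p) (D.J (p+1)) with hK0def
  obtain ⟨x1, x2, x3, x4⟩ := D.cos_bound p m hm0 hm
  obtain ⟨y1, y2, y3, y4⟩ := D.cos_bound (p+1) n hn0 hn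
  obtain ⟨z1, z2, -, -⟩ := D.cos_bound (p+2) l hl0 hl
  have S1 := D.mθ_sin_pos p m hm0 hm
  have S2 := D.mθ_sin_pos (p+1) n hn0 hn
  have s1 := D.sin_pos p
  have s2 := D.sin_pos (p+1)
  have c1 := D.cos_pos p
  have c2 := D.cos_pos (p+1)
  have c3 := D.cos_pos (p+2)
  have q1 := Real.sin_sq_add_cos_sq (m * D.θ p)
  have q2 := Real.sin_sq_add_cos_sq (n * D.θ (p+1))
  have q3 := Real.sin_sq_add_cos_sq (D.θ p)
  have q4 := Real.sin_sq_add_cos_sq (D.θ (p+1))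
  generalize Real.cos (m * D.θ p) = x at *
  generalize Real.cos (n * D.θ (p+1)) = y at *
  generalize Real.cos (l * D.θ (p+2)) = z at *
  generalize Real.sin (m * D.θ p) = X at *
  generalize Real.sin (n * D.θ (p+1)) = Y at *
  generalize Real.sin (D.θ p) = X0 at *
  generalize Real.sin (D.θ (p+1)) = Y0 at *
  generalize Real.cos (D.θ p) = x0 at *
  generalize Real.cos (D.θ (p+1)) = y0 at *
  generalize Real.cos (D.θ (p+2)) = z0 at *
  have hX : X0 ≤ X := by
    by_contra hcon
    push Not at hcon
    nlinarith
  have hY : Y0 ≤ Y := by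
    by_contra hcon
    push Not at hcon
    nlinarith
  have hK0' : X0 * Y0 * (-K0) = z0 + x0 * y0 := by
    rw [hK0]; field_simp
  have hcz : -c * z ≤ z0 := by
    rcases hc with rfl | rfl <;> linarith
  have hXY : X0 * Y0 ≤ X * Y := mul_le_mul hX hY s2.le S1.le
  have hXY0 : 0 < X0 * Y0 := mul_pos s1 s2
  have hK0pos : 0 < -K0 := by
    have : 0 < z0 + x0 * y0 := by positivity
    by_contra hcon
    nlinarith
  have hmain : X * Y * (-K) = x * y - c * z := by
    push_cast at tr
    linarith
  have hxy : x * y ≤ x0 * y0 := by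
    nlinarith [mul_nonneg (sub_nonneg.mpr x1) (by linarith : 0 ≤ y0 + y),
      mul_nonneg (by linarith : 0 ≤ x0 + x) (sub_nonneg.mpr y1)]
  have hXYK0 : X0 * Y0 * (-K0) ≤ X * Y * (-K0) := mul_le_mul_of_nonneg_right hXY hK0pos.le
  have hXYK : X * Y * (-K0) ≤ X * Y * (-K) :=
    mul_le_mul_of_nonneg_left (by linarith) (mul_pos S1 S2).le
  have hKK : K = K0 := by
    have h1 : X * Y * (-K0) = X * Y * (-K) := by linarith
    have h2 := mul_left_cancel₀ (mul_pos S1 S2).ne' h1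
    linarith
  refine ⟨?_, hKK⟩
  have hxye : x * y = x0 * y0 := by linarith
  have p1 : 0 ≤ (x0 - x) * (y0 + y) := mul_nonneg (by linarith) (by linarith)
  have p2 : 0 ≤ (x0 + x) * (y0 - y) := mul_nonneg (by linarith) (by linarith)
  have p3 : (x0 - x) * (y0 + y) + (x0 + x) * (y0 - y) = 0 := by linear_combination (-2) * hxye
  have e1 : (x0 - x) * (y0 + y) = 0 := by linarith
  have e2 : (x0 + x) * (y0 - y) = 0 := by linarith
  rcases mul_eq_zero.mp e1 with h1 | h1
  · left
    refine ⟨x3 (by linarith), y3 ?_⟩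
    rcases mul_eq_zero.mp e2 with h2 | h2 <;> linarith
  · right
    refine ⟨x4 ?_, y4 (by linarith)⟩
    rcases mul_eq_zero.mp e2 with h2 | h2 <;> linarith

end TD

open Real in
lemma exists_TD (i j k : ℕ) (hi : 6 ≤ i) (hj : 6 ≤ j) (hk : 6 ≤ k) :
    ∃ D : TD, D.n = ![j, k, i] := by
  have bounds : ∀ n : ℕ, 6 ≤ n → √3 / 2 ≤ cos (π / n) ∧ 0 < sin (π / n) := by
    intro n hn
    have hn' : (6 : ℝ) ≤ n := by exact_mod_cast hn
    have h1 : π / n ≤ π / 6 := div_le_div_of_nonneg_left pi_pos.le (by norm_num) hn'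
    have h0 : 0 < π / n := div_pos pi_pos (by linarith)
    constructor
    · rw [← cos_pi_div_six]
      exact cos_le_cos_of_nonneg_of_le_pi h0.le (by linarith [pi_pos]) h1
    · exact sin_pos_of_pos_of_lt_pi h0 (by linarith [pi_pos])
  obtain ⟨c0, s0⟩ := bounds j hj
  obtain ⟨c1, s1⟩ := bounds k hk
  obtain ⟨c2, s2⟩ := bounds i hi
  have q0 := sin_sq_add_cos_sq (π / j)
  have q1 := sin_sq_add_cos_sq (π / k)
  have q2 := sin_sq_add_cos_sq (π / i)
  obtain ⟨r, t, hrt, hsum, hlt⟩ : ∃ r t : ℝ, r * t = sin (π / j) ^ 2 ∧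
      sin (π / i) * (r + t) = -2 * (cos (π / k) + cos (π / i) * cos (π / j)) ∧ r < t := by
    have h3 : √3 ^ 2 = 3 := Real.sq_sqrt (by norm_num)
    have h3p : 0 < √3 := by positivity
    generalize sin (π / j) = S0 at *
    generalize sin (π / i) = S2 at *
    generalize cos (π / j) = C0 at *
    generalize cos (π / k) = C1 at *
    generalize cos (π / i) = C2 at *
    have hd0 : S0 ^ 2 ≤ 1/4 := by nlinarith
    have hd2 : S2 ^ 2 ≤ 1/4 := by nlinarith
    set m := -(C1 + C2 * C0) / S2 with hm
    have hmS : S2 * m = -(C1 + C2 * C0) := by rw [hm]; field_simp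
    have hb : 1 < C1 + C2 * C0 := by nlinarith
    have hm2 : 1 < m ^ 2 := by
      have : S2 ^ 2 * m ^ 2 = (C1 + C2 * C0) ^ 2 := by rw [← mul_pow, hmS]; ring
      nlinarith
    have hd : 0 < m ^ 2 - S0 ^ 2 := by linarith
    refine ⟨m - √(m ^ 2 - S0 ^ 2), m + √(m ^ 2 - S0 ^ 2), ?_, ?_, ?_⟩
    · have := Real.sq_sqrt hd.le
      linear_combination -this
    · linear_combination 2 * hmS
    · have := Real.sqrt_pos.mpr hd
      linarith
  refine ⟨⟨![j, k, i], ?_, ![!![-cos (π / i), sin (π / i); sin (π / i), cos (π / i)],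
    !![1, 0; 0, -1], !![-cos (π / j), r; t, cos (π / j)]], ?_, ?_, ?_, ?_⟩, rfl⟩
  · intro p; fin_cases p <;> simp [hi, hj, hk]
  · intro p; fin_cases p <;> simp [Matrix.trace_fin_two]
  · intro p
    fin_cases p <;> ext a b <;> fin_cases a <;> fin_cases b <;>
      simp [Matrix.mul_apply, Fin.sum_univ_two] <;> linarith
  · intro p
    fin_cases p <;> ext a b <;> fin_cases a <;> fin_cases b <;>
      simp [Matrix.mul_apply, Fin.sum_univ_two] <;> linarith
  · simp [Matrix.trace_fin_two, Matrix.mul_apply, Fin.sum_univ_two]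
    nlinarith

/-! ### the triangle group -/

section tri
variable {i j k : ℕ}

/-- first generator -/
def ga (i j k : ℕ) : TriangleGroup i j k := PresentedGroup.of 0
/-- second generator -/
def gb (i j k : ℕ) : TriangleGroup i j k := PresentedGroup.of 1

lemma ga_pow : ga i j k ^ i = 1 :=
  PresentedGroup.one_of_mem (rels := triangleRels i j k) (x := FreeGroup.of 0 ^ i)
    (by simp [triangleRels])

lemma gb_pow : gb i j k ^ j = 1 :=
  PresentedGroup.one_of_mem (rels := triangleRels i j k) (x := FreeGroup.of 1 ^ j)
    (by simp [triangleRels])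

lemma gab_pow : (ga i j k * gb i j k) ^ k = 1 :=
  PresentedGroup.one_of_mem (rels := triangleRels i j k)
    (x := (FreeGroup.of 0 * FreeGroup.of 1) ^ k) (by simp [triangleRels])

lemma tri_ext {G : Type*} [Group G] {f g : TriangleGroup i j k →* G}
    (h1 : f (ga i j k) = g (ga i j k)) (h2 : f (gb i j k) = g (gb i j k)) : f = g := by
  apply PresentedGroup.ext
  intro x
  fin_cases x
  · exact h1
  · exact h2

lemma tri_hom {G : Type*} [Group G] (x y : G) (hx : x ^ i = 1) (hy : y ^ j = 1)
    (hxy : (x * y) ^ k = 1) :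
    ∃ f : TriangleGroup i j k →* G, f (ga i j k) = x ∧ f (gb i j k) = y := by
  refine ⟨PresentedGroup.toGroup (f := ![x, y]) ?_, ?_, ?_⟩
  · intro r hr
    simp only [triangleRels, Set.mem_insert_iff, Set.mem_singleton_iff] at hr
    rcases hr with rfl | rfl | rfl <;> simp [hx, hy, hxy]
  · exact PresentedGroup.toGroup.of _
  · exact PresentedGroup.toGroup.of _

lemma tri_invol (x y : TriangleGroup i j k) (hx : x ^ i = 1) (hy : y ^ j = 1)
    (hxy : (x * y) ^ k = 1)
    (h : ∀ f : TriangleGroup i j k →* TriangleGroup i j k, f (ga i j k) = x → f (gb i j k) = y →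
      f x = ga i j k ∧ f y = gb i j k) :
    ∃ δ : MulAut (TriangleGroup i j k), δ (ga i j k) = x ∧ δ (gb i j k) = y ∧ δ * δ = 1 := by
  obtain ⟨f, h1, h2⟩ := tri_hom x y hx hy hxy
  obtain ⟨h3, h4⟩ := h f h1 h2
  have hff : f.comp f = MonoidHom.id _ := by
    apply tri_ext <;> simp [h1, h2, h3, h4]
  refine ⟨MonoidHom.toMulEquiv f f hff hff, h1, h2, ?_⟩
  ext t
  exact DFunLike.congr_fun hff t

lemma swap_pow {G : Type*} [Group G] (x y : G) (n : ℕ) (h : (x * y) ^ n = 1) :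
    (y * x) ^ n = 1 := by
  have : y * x = x⁻¹ * (x * y) * (x⁻¹)⁻¹ := by group
  rw [this, conj_pow, h]; simp

lemma exists_tau (i j k : ℕ) : ∃ δ : MulAut (TriangleGroup i j k), δ (ga i j k) = (ga i j k)⁻¹ ∧
    δ (gb i j k) = (gb i j k)⁻¹ ∧ δ * δ = 1 := by
  apply tri_invol
  · rw [inv_pow, ga_pow, inv_one]
  · rw [inv_pow, gb_pow, inv_one]
  · rw [← mul_inv_rev, inv_pow, swap_pow _ _ _ gab_pow, inv_one]
  · intro f h1 h2; simp [h1, h2]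

/-- inversion of the generators -/
noncomputable def tau (i j k : ℕ) : MulAut (TriangleGroup i j k) := (exists_tau i j k).choose

lemma tau_a : tau i j k (ga i j k) = (ga i j k)⁻¹ := (exists_tau i j k).choose_spec.1
lemma tau_b : tau i j k (gb i j k) = (gb i j k)⁻¹ := (exists_tau i j k).choose_spec.2.1
lemma tau_tau : tau i j k * tau i j k = 1 := (exists_tau i j k).choose_spec.2.2

lemma aut_ext {f g : MulAut (TriangleGroup i j k)}
    (h1 : f (ga i j k) = g (ga i j k)) (h2 : f (gb i j k) = g (gb i j k)) : f = g := by
  have : f.toMonoidHom = g.toMonoidHom := tri_ext h1 h2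
  ext t
  exact DFunLike.congr_fun this t

lemma exists_tri_swap (hij : i = j) : ∃ δ : MulAut (TriangleGroup i j k),
    δ (ga i j k) = gb i j k ∧ δ (gb i j k) = ga i j k := by
  obtain ⟨δ, h1, h2, -⟩ := tri_invol (gb i j k) (ga i j k) (by rw [hij]; exact gb_pow)
    (by have := ga_pow (i := i) (j := j) (k := k); rw [← hij] at this ⊢; exact this)
    (swap_pow _ _ _ gab_pow) (by intro f h1 h2; simp [h1, h2])
  exact ⟨δ, h1, h2⟩

lemma exists_three (hik : i = k) : ∃ δ : MulAut (TriangleGroup i j k),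
    δ (ga i j k) = ga i j k * gb i j k ∧ δ (gb i j k) = (gb i j k)⁻¹ := by
  obtain ⟨δ, h1, h2, -⟩ := tri_invol (ga i j k * gb i j k) (gb i j k)⁻¹
    (by rw [hik]; exact gab_pow) (by rw [inv_pow, gb_pow, inv_one])
    (by
      have := ga_pow (i := i) (j := j) (k := k)
      rw [hik] at this ⊢
      simpa using this)
    (by intro f h1 h2; simp [h1, h2])
  exact ⟨δ, h1, h2⟩

end tri

namespace TD
variable (D : TD)

/-- the triangle group attached to `D` -/
abbrev T := TriangleGroup (D.n 2) (D.n 0) (D.n 1)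
/-- generator -/
def a : D.T := ga _ _ _
/-- generator -/
def b : D.T := gb _ _ _
/-- inversion -/
noncomputable def τ : MulAut D.T := tau _ _ _

/-- rotations in the triangle group -/
def rT : Fin 3 → D.T := ![D.b, (D.a * D.b)⁻¹, D.a]

lemma rT_pow_n (p : Fin 3) : D.rT p ^ D.n p = 1 := by
  fin_cases p
  · exact gb_pow
  · change ((D.a * D.b)⁻¹) ^ D.n 1 = 1
    rw [inv_pow, inv_eq_one]; exact gab_pow
  · exact ga_pow

lemma exists_ι : ∃ f : D.T →* D.W, f D.a = D.r 2 ∧ f D.b = D.r 0 := by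
  apply tri_hom
  · exact D.r_pow_n 2
  · exact D.r_pow_n 0
  · have h : D.r 2 * D.r 0 = (D.r 1)⁻¹ := by
      change D.cs.simple 0 * D.cs.simple 1 * (D.cs.simple 1 * D.cs.simple 2) =
        (D.cs.simple 2 * D.cs.simple 0)⁻¹
      simp [mul_assoc]
    rw [h, inv_pow, D.r_pow_n 1, inv_one]

/-- embedding -/
noncomputable def ι : D.T →* D.W := D.exists_ι.choose
lemma ι_a : D.ι D.a = D.r 2 := D.exists_ι.choose_spec.1
lemma ι_b : D.ι D.b = D.r 0 := D.exists_ι.choose_spec.2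

lemma r_rel : D.r 2 * D.r 0 * D.r 1 = 1 := by
  change D.cs.simple 0 * D.cs.simple 1 * (D.cs.simple 1 * D.cs.simple 2) *
        (D.cs.simple 2 * D.cs.simple 0) = 1
  simp [mul_assoc]

lemma ι_rT (p : Fin 3) : D.ι (D.rT p) = D.r p := by
  fin_cases p
  · exact D.ι_b
  · change D.ι (D.a * D.b)⁻¹ = D.r 1
    rw [map_inv, map_mul, ι_a, ι_b, inv_eq_iff_mul_eq_one, r_rel]
  · exact D.ι_a

lemma ι_inj : Function.Injective D.ι := by
  let G := D.T ⋊[MonoidHom.id (MulAut D.T)] MulAut D.T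
  let x : Fin 3 → D.T := ![D.a, 1, D.b⁻¹]
  have hτ : ∀ s, D.τ (x s) = (x s)⁻¹ := by
    intro s
    fin_cases s
    · exact tau_a
    · change D.τ 1 = 1⁻¹
      simp
    · change D.τ (D.b)⁻¹ = (D.b⁻¹)⁻¹
      rw [map_inv]; congr 1; exact tau_b
  let f : Fin 3 → G := fun s => ⟨x s, D.τ⟩
  have hff : ∀ s t, f s * f t = SemidirectProduct.inl (x s * (x t)⁻¹) := by
    intro s t
    apply SemidirectProduct.ext
    · change x s * D.τ (x t) = _
      rw [hτ]; rfl
    · exact tau_tau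
  have hl : D.M.IsLiftable f := by
    intro s t
    rw [hff, ← map_pow]
    have : (x s * (x t)⁻¹) ^ D.M s t = 1 := by
      have e0 : D.a ^ D.n 2 = 1 := ga_pow
      have e1 : D.b ^ D.n 0 = 1 := gb_pow
      have e2 : (D.a * D.b) ^ D.n 1 = 1 := gab_pow
      fin_cases s <;> fin_cases t
      · change (D.a * D.a⁻¹) ^ _ = 1
        simp
      · change (D.a * 1⁻¹) ^ (D.n 2) = 1
        simpa
      · change (D.a * (D.b⁻¹)⁻¹) ^ (D.n 1) = 1
        simpa
      · change (1 * D.a⁻¹) ^ (D.n 2) = 1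
        simpa
      · change (1 * 1⁻¹) ^ _ = (1 : D.T)
        simp
      · change (1 * (D.b⁻¹)⁻¹) ^ (D.n 0) = 1
        simpa
      · change (D.b⁻¹ * D.a⁻¹) ^ (D.n 1) = 1
        rw [← mul_inv_rev, inv_pow, e2, inv_one]
      · change (D.b⁻¹ * 1⁻¹) ^ (D.n 0) = 1
        simpa
      · change (D.b⁻¹ * (D.b⁻¹)⁻¹) ^ _ = 1
        simp
    rw [this, map_one]
  let F : D.W →* G := D.cs.lift ⟨f, hl⟩
  have hF : ∀ s, F (D.cs.simple s) = f s := fun s => D.cs.lift_apply_simple hl s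
  have hc : F.comp D.ι = SemidirectProduct.inl := by
    apply tri_ext
    · change F (D.ι D.a) = SemidirectProduct.inl D.a
      rw [ι_a]
      change F (D.cs.simple 0 * D.cs.simple 1) = _
      rw [map_mul, hF, hF, hff]
      congr 1
    · change F (D.ι D.b) = SemidirectProduct.inl D.b
      rw [ι_b]
      change F (D.cs.simple 1 * D.cs.simple 2) = _
      rw [map_mul, hF, hF, hff]
      congr 1
  intro y z hyz
  have h1 := DFunLike.congr_fun hc y
  have h2 := DFunLike.congr_fun hc z
  simp only [MonoidHom.comp_apply] at h1 h2
  rw [hyz, h2] at h1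
  exact SemidirectProduct.inl_injective h1.symm

lemma ev_ι (t : D.T) : D.Ev (D.ι t) := by
  have : D.cs.lengthParity.comp D.ι = 1 := by
    apply tri_ext
    · change D.Ev (D.ι D.a)
      rw [ι_a]; simpa using D.ev_r 2 1
    · change D.Ev (D.ι D.b)
      rw [ι_b]; simpa using D.ev_r 0 1
  exact DFunLike.congr_fun this t

lemma ss_mem (s t : Fin 3) : ∃ x, D.ι x = D.cs.simple s * D.cs.simple t := by
  by_cases h : s = t
  · exact ⟨1, by simp [h]⟩
  · have : ∀ s t : Fin 3, s ≠ t → ∃ p : Fin 3, (s = p+1 ∧ t = p+2) ∨ (s = p+2 ∧ t = p+1) := by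
      decide
    obtain ⟨p, ⟨rfl, rfl⟩ | ⟨rfl, rfl⟩⟩ := this s t h
    · exact ⟨D.rT p, by rw [ι_rT]; rfl⟩
    · exact ⟨(D.rT p)⁻¹, by rw [map_inv, ι_rT]; simp [r]⟩

lemma ι_or (w : D.W) : ∃ t, w = D.ι t ∨ w = D.ι t * D.cs.simple 0 := by
  induction w using D.cs.simple_induction_right with
  | one => exact ⟨1, by simp⟩
  | mul_simple_right w s h =>
    obtain ⟨t, rfl | rfl⟩ := h
    · obtain ⟨x, hx⟩ := D.ss_mem s 0
      exact ⟨t * x, Or.inr (by rw [map_mul, hx]; simp [mul_assoc])⟩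
    · obtain ⟨x, hx⟩ := D.ss_mem 0 s
      exact ⟨t * x, Or.inl (by rw [map_mul, hx]; simp [mul_assoc])⟩

lemma ev_mul_left {x y : D.W} (hx : D.Ev x) : D.Ev (x * y) ↔ D.Ev y := by
  unfold Ev at *; rw [map_mul, hx, one_mul]

lemma ev_mem (w : D.W) (h : D.Ev w) : ∃ t, w = D.ι t := by
  obtain ⟨t, ht | ht⟩ := D.ι_or w
  · exact ⟨t, ht⟩
  · rw [ht, ev_mul_left _ (D.ev_ι t)] at h
    exact absurd h (D.not_ev_simple 0)

lemma not_ev_mul {x y : D.W} (hx : ¬ D.Ev x) (hy : ¬ D.Ev y) : D.Ev (x * y) := by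
  unfold Ev at *
  rw [map_mul]
  generalize D.cs.lengthParity x = u at *
  generalize D.cs.lengthParity y = v at *
  revert u v; decide

lemma torsionT (f : D.T) (N : ℕ) (hN : 0 < N) (hf : f ^ N = 1) :
    ∃ (g : D.T) (p : Fin 3) (m : ℤ), f = g * D.rT p ^ m * g⁻¹ := by
  obtain ⟨u, p, h⟩ := D.torsion (D.ι f) N hN (by rw [← map_pow, hf, map_one])
  have hev : D.Ev (u * D.ι f * u⁻¹) := by
    have := D.ev_ι f
    unfold Ev at *
    rw [map_mul, map_mul, this, map_inv]; simp
  obtain ⟨m, hm⟩ := D.dihedral_ev p _ h hev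
  by_cases he : D.Ev u
  · obtain ⟨t, rfl⟩ := D.ev_mem u he
    refine ⟨t⁻¹, p, m, D.ι_inj ?_⟩
    rw [map_mul, map_mul, map_zpow, ι_rT, ← hm]
    simp [mul_assoc]
  · obtain ⟨t, ht⟩ := D.ev_mem _ (D.not_ev_mul (D.not_ev_simple (p+1)) he)
    refine ⟨t⁻¹, p, -m, D.ι_inj ?_⟩
    have h2 := D.r_conj p m
    simp only [map_mul, map_zpow, ι_rT, map_inv, ← ht]
    rw [show D.r p ^ (-m) = D.cs.simple (p+1) * D.r p ^ m * (D.cs.simple (p+1))⁻¹ by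
      rw [h2]; simp, ← hm]
    group

lemma norm_pow (p : Fin 3) (m : ℤ) (h : D.rT p ^ m ≠ 1) :
    ∃ l : ℕ, 0 < l ∧ l < D.n p ∧ D.rT p ^ m = D.rT p ^ l := by
  have hn := D.hn p
  have hpos : (0 : ℤ) < D.n p := by omega
  have h1 := Int.emod_nonneg m hpos.ne'
  have h2 := Int.emod_lt_of_pos m hpos
  have h3 : D.rT p ^ m = D.rT p ^ (m % D.n p).toNat := by
    rw [← zpow_natCast, Int.toNat_of_nonneg h1]
    conv_lhs => rw [← Int.emod_add_mul_ediv m (D.n p)]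
    rw [zpow_add, zpow_mul, zpow_natCast, rT_pow_n, one_zpow, mul_one]
  refine ⟨(m % D.n p).toNat, ?_, by omega, h3⟩
  rw [Nat.pos_iff_ne_zero]
  intro h0
  rw [h0, pow_zero] at h3
  exact h h3

lemma orderOf_rT (p : Fin 3) : orderOf (D.rT p) = D.n p := by
  rw [← orderOf_injective D.ι D.ι_inj, ι_rT, orderOf_r]

lemma rT_ne (p : Fin 3) : D.rT p ≠ 1 := by
  intro h
  have := D.orderOf_rT p
  rw [h, orderOf_one] at this
  have := D.hn p
  omega

lemma nonconjT (g h : D.T) (p q : Fin 3) (m n : ℤ) (hne : D.rT p ^ m ≠ 1)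
    (e : g * D.rT p ^ m * g⁻¹ = h * D.rT q ^ n * h⁻¹) : p = q := by
  have hne' : D.rT q ^ n ≠ 1 := by
    intro h0
    rw [h0] at e
    apply hne
    rw [mul_one, mul_inv_cancel, mul_inv_eq_one] at e
    simpa using e
  obtain ⟨m', -, -, e1⟩ := D.norm_pow p m hne
  obtain ⟨n', n1, n2, e2⟩ := D.norm_pow q n hne'
  rw [e1, e2] at e
  refine (D.nonconj (D.ι (h⁻¹ * g)) p q m' n' n1 n2 ?_).1
  rw [← ι_rT, ← ι_rT, ← map_pow, ← map_pow, ← map_inv, ← map_mul, ← map_mul]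
  congr 1
  calc _ = h⁻¹ * (g * D.rT p ^ m' * g⁻¹) * h := by group
    _ = _ := by rw [e]; group

end TD

namespace TD
variable (D : TD)

/-- `δ` permutes the conjugacy classes of maximal cyclic subgroups via `π` -/
def HasType (δ : MulAut D.T) (π : Fin 3 → Fin 3) : Prop :=
  ∀ p, ∃ (g : D.T) (m : ℤ), δ (D.rT p) = g * D.rT (π p) ^ m * g⁻¹

lemma exists_type (δ : MulAut D.T) : ∃ π, D.HasType δ π := by
  have : ∀ p, ∃ (q : Fin 3) (g : D.T) (m : ℤ), δ (D.rT p) = g * D.rT q ^ m * g⁻¹ := by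
    intro p
    have hn := D.hn p
    obtain ⟨g, q, m, h⟩ := D.torsionT (δ (D.rT p)) (D.n p) (by omega)
      (by rw [← map_pow, rT_pow_n, map_one])
    exact ⟨q, g, m, h⟩
  choose π hπ using this
  exact ⟨π, hπ⟩

variable {D}

lemma HasType.unique {δ : MulAut D.T} {π π' : Fin 3 → Fin 3} (h : D.HasType δ π)
    (h' : D.HasType δ π') : π = π' := by
  funext p
  obtain ⟨g, m, e⟩ := h p
  obtain ⟨g', m', e'⟩ := h' p
  refine D.nonconjT g g' _ _ m m' ?_ (e.symm.trans e')
  intro h0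
  rw [h0, mul_one, mul_inv_cancel] at e
  exact D.rT_ne p (by simpa using e)

lemma HasType.mul {δ δ' : MulAut D.T} {π π' : Fin 3 → Fin 3} (h : D.HasType δ π)
    (h' : D.HasType δ' π') : D.HasType (δ * δ') (π ∘ π') := by
  intro p
  obtain ⟨g', m', e'⟩ := h' p
  obtain ⟨g, m, e⟩ := h (π' p)
  refine ⟨δ g' * g, m * m', ?_⟩
  rw [MulAut.mul_apply, e', map_mul, map_mul, map_zpow, e, map_inv, conj_zpow, zpow_mul]
  simp only [Function.comp_apply, mul_inv_rev, mul_assoc]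

lemma hasType_conj (g : D.T) : D.HasType (MulAut.conj g) id := by
  intro p
  exact ⟨g, 1, by simp⟩

lemma hasType_one : D.HasType 1 id := fun p => ⟨1, 1, by simp⟩

lemma τ_a : D.τ D.a = D.a⁻¹ := tau_a
lemma τ_b : D.τ D.b = D.b⁻¹ := tau_b

lemma hasType_τ : D.HasType D.τ id := by
  intro p
  fin_cases p
  · refine ⟨1, -1, ?_⟩
    change D.τ D.b = 1 * D.b ^ (-1 : ℤ) * 1⁻¹
    rw [τ_b]; simp
  · refine ⟨D.a⁻¹, -1, ?_⟩
    change D.τ (D.a * D.b)⁻¹ = D.a⁻¹ * ((D.a * D.b)⁻¹) ^ (-1 : ℤ) * (D.a⁻¹)⁻¹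
    rw [map_inv, map_mul, τ_a, τ_b]; group
  · refine ⟨1, -1, ?_⟩
    change D.τ D.a = 1 * D.a ^ (-1 : ℤ) * 1⁻¹
    rw [τ_a]; simp

lemma HasType.dvd {δ : MulAut D.T} {π : Fin 3 → Fin 3} (h : D.HasType δ π) (p : Fin 3) :
    D.n p ∣ D.n (π p) := by
  obtain ⟨g, m, e⟩ := h p
  rw [← D.orderOf_rT p, ← MulEquiv.orderOf_eq δ, orderOf_dvd_iff_pow_eq_one, e, conj_pow,
    ← zpow_natCast, ← zpow_mul, mul_comm, zpow_mul, zpow_natCast, rT_pow_n]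
  simp

lemma HasType.inj {δ : MulAut D.T} {π : Fin 3 → Fin 3} (h : D.HasType δ π) :
    Function.Injective π ∧ ∀ p, D.n (π p) = D.n p := by
  obtain ⟨π', h'⟩ := D.exists_type δ⁻¹
  have h1 := h'.mul h
  rw [inv_mul_cancel] at h1
  have h2 := h1.unique hasType_one
  refine ⟨Function.LeftInverse.injective (g := π') (fun p => congrFun h2 p), fun p => ?_⟩
  refine Nat.dvd_antisymm ?_ (h.dvd p)
  have := h'.dvd (π p)
  rwa [show π' (π p) = p from congrFun h2 p] at this

lemma aut_ext' {f g : MulAut D.T} (h1 : f D.a = g D.a) (h2 : f D.b = g D.b) : f = g :=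
  aut_ext h1 h2

lemma lemmaA {δ : MulAut D.T} (h : D.HasType δ id) :
    ∃ g, δ = MulAut.conj g ∨ δ = MulAut.conj g * D.τ := by
  have nat : ∀ p, ∃ (g : D.T) (m : ℕ), 0 < m ∧ m < D.n p ∧ δ (D.rT p) = g * D.rT p ^ m * g⁻¹ := by
    intro p
    obtain ⟨g, m, e⟩ := h p
    simp only [id] at e
    obtain ⟨l, l0, l1, e2⟩ := D.norm_pow p m (by
      intro h0
      rw [h0, mul_one, mul_inv_cancel] at e
      exact D.rT_ne p (by simpa using e))
    exact ⟨g, l, l0, l1, by rw [e, e2]⟩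
  obtain ⟨g, m, m0, m1, eg⟩ := nat 2
  obtain ⟨h, n, n0, n1, eh⟩ := nat 0
  obtain ⟨k, l, l0, l1, ek⟩ := nat 1
  have hrel : D.rT 2 * D.rT 0 * D.rT 1 = 1 := by
    change D.a * D.b * (D.a * D.b)⁻¹ = 1
    simp
  have hrel2 := congrArg (fun x => D.ι (δ x)) hrel
  simp only [map_mul, map_one, eg, eh, ek, map_pow, map_inv, ι_rT] at hrel2
  obtain ⟨hmn, hbf⟩ := D.rigidity 2 (D.ι g) (D.ι h) (D.ι k) (D.ev_ι g) (D.ev_ι h) (D.ev_ι k)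
    m n l m0 m1 n0 n1 l0 l1 hrel2
  obtain ⟨u, hu, v, hv, huv⟩ := D.F5 2 0 (by decide) _ hbf
  have key : ∃ x y : ℤ, (D.ι g)⁻¹ * D.ι h = D.r 2 ^ x * D.r 0 ^ y := by
    have hev : D.Ev ((D.ι g)⁻¹ * D.ι h) := by
      rw [← map_inv, ← map_mul]; exact D.ev_ι _
    have r2 : D.r 2 = D.cs.simple 0 * D.cs.simple 1 := rfl
    obtain ⟨x, rfl | rfl⟩ := D.dihedral 2 u hu
    · obtain ⟨y, rfl | rfl⟩ := D.dihedral 0 v hv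
      · exact ⟨x, y, huv⟩
      · exfalso
        rw [huv, ev_mul_left _ (D.ev_r 2 x), ev_mul_left _ (D.ev_r 0 y)] at hev
        exact D.not_ev_simple _ hev
    · obtain ⟨y, rfl | rfl⟩ := D.dihedral 0 v hv
      · exfalso
        rw [huv, mul_assoc, ev_mul_left _ (D.ev_r 2 x)] at hev
        have h1 := D.ev_r 0 y
        unfold Ev at hev h1
        rw [map_mul, h1, mul_one] at hev
        exact D.not_ev_simple _ hev
      · refine ⟨x + 1, -y, ?_⟩
        have h1 := D.r_conj 0 (-y)
        rw [neg_neg] at h1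
        rw [huv, ← h1, zpow_add_one, r2]
        change _ * D.cs.simple 0 * (D.cs.simple 1 * _) = _
        simp only [mul_assoc]
  obtain ⟨x, y, hxy⟩ := key
  have hxyT : g⁻¹ * h = D.a ^ x * D.b ^ y := by
    apply D.ι_inj
    rw [map_mul, map_inv, hxy, map_mul, map_zpow, map_zpow, ι_a, ι_b]
  have hh : h = g * D.a ^ x * D.b ^ y := by
    rw [mul_assoc, ← hxyT]; group
  have e2 : D.rT 2 = D.a := rfl
  have e0 : D.rT 0 = D.b := rfl
  rw [e2] at eg
  rw [e0] at eh
  refine ⟨g * D.a ^ x, ?_⟩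
  rcases hmn with ⟨rfl, rfl⟩ | ⟨rfl, rfl⟩
  · left
    apply aut_ext'
    · rw [eg, MulAut.conj_apply]; group
    · rw [eh, MulAut.conj_apply, hh]; group
  · right
    have ha : D.a ^ (D.n 2 - 1) = D.a⁻¹ := by
      have hn := D.hn 2
      rw [eq_inv_iff_mul_eq_one, ← pow_succ, show D.n 2 - 1 + 1 = D.n 2 by omega]
      exact ga_pow
    have hb : D.b ^ (D.n 0 - 1) = D.b⁻¹ := by
      have hn := D.hn 0
      rw [eq_inv_iff_mul_eq_one, ← pow_succ, show D.n 0 - 1 + 1 = D.n 0 by omega]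
      exact gb_pow
    apply aut_ext'
    · rw [eg, ha, MulAut.mul_apply, τ_a, MulAut.conj_apply]; group
    · rw [eh, show D.b ^ (D.n (2+1) - 1) = D.b⁻¹ from hb, MulAut.mul_apply, τ_b,
        MulAut.conj_apply, hh]; group

lemma τ_not_inner : D.τ ∉ Inn D.T := by
  rintro ⟨g, hg⟩
  have h1 := congrArg (fun f => D.ι (f D.a)) hg
  simp only [MulAut.conj_apply, τ_a, map_mul, map_inv, ι_a] at h1
  exact D.not_inv _ (D.ev_ι g) 2 h1

/-! ### the twelve maps -/

/-- the permutations induced by the `ψ` -/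
def pi : Fin 6 → Fin 3 → Fin 3 :=
  ![![0, 1, 2], ![1, 0, 2], ![0, 2, 1], ![2, 1, 0], ![1, 2, 0], ![2, 0, 1]]

lemma pi_inj : ∀ n m, pi n = pi m → n = m := by decide
lemma pi_surj : ∀ π : Fin 3 → Fin 3, Function.Injective π → ∃ n, pi n = π := by decide
lemma pi_surj2 : ∀ π : Fin 3 → Fin 3, Function.Injective π → π 1 = 1 →
    pi 0 = π ∨ pi 3 = π := by decide

/-- abbreviation -/
def Ext (D : TD) (n : Fin 6) (ε : ℤ) (δ : MulAut D.T) : Prop :=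
  ExtendsPsi (D.n 2) (D.n 0) (D.n 1) n ε δ

lemma ext_iff (n : Fin 6) (ε : ℤ) (δ : MulAut D.T) : D.Ext n ε δ ↔
    δ D.a = ![D.a ^ ε, D.a ^ ε, (D.a * D.b) ^ ε, D.b ^ ε, D.b ^ ε, (D.a * D.b) ^ ε] n ∧
    δ D.b = ![D.b ^ ε, (D.a * D.b) ^ (-ε), D.b ^ (-ε), D.a ^ ε, (D.a * D.b) ^ (-ε), D.a ^ (-ε)] n := by
  unfold Ext ExtendsPsi
  fin_cases n <;> exact Iff.rfl

lemma Ext.mul_τ {n : Fin 6} {ε : ℤ} {δ : MulAut D.T} (h : D.Ext n ε δ) :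
    D.Ext n (-ε) (δ * D.τ) := by
  rw [ext_iff] at *
  rw [MulAut.mul_apply, MulAut.mul_apply, τ_a, τ_b, map_inv, map_inv, h.1, h.2]
  fin_cases n <;> simp

lemma Ext.unique {n : Fin 6} {ε : ℤ} {δ δ' : MulAut D.T} (h : D.Ext n ε δ) (h' : D.Ext n ε δ') :
    δ = δ' := by
  rw [ext_iff] at *
  exact aut_ext' (by rw [h.1, h'.1]) (by rw [h.2, h'.2])

lemma type_of {δ : MulAut D.T} {π : Fin 3 → Fin 3} (g0 g1 g2 : D.T) (m0 m1 m2 : ℤ)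
    (h0 : δ D.b = g0 * D.rT (π 0) ^ m0 * g0⁻¹)
    (h1 : δ (D.a * D.b)⁻¹ = g1 * D.rT (π 1) ^ m1 * g1⁻¹)
    (h2 : δ D.a = g2 * D.rT (π 2) ^ m2 * g2⁻¹) : D.HasType δ π := by
  intro p
  fin_cases p
  · exact ⟨g0, m0, h0⟩
  · exact ⟨g1, m1, h1⟩
  · exact ⟨g2, m2, h2⟩

lemma Ext.type_one {n : Fin 6} {δ : MulAut D.T} (h : D.Ext n 1 δ) : D.HasType δ (pi n) := by
  rw [ext_iff] at h
  obtain ⟨ha, hb⟩ := h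
  have r0 : D.rT 0 = D.b := rfl
  have r1 : D.rT 1 = (D.a * D.b)⁻¹ := rfl
  have r2 : D.rT 2 = D.a := rfl
  fin_cases n
  · apply type_of 1 1 1 1 1 1 <;> simp [pi, r0, r1, r2, ha, hb]
  · apply type_of 1 D.a 1 1 1 1 <;> simp [pi, r0, r1, r2, ha, hb, mul_assoc]
  · apply type_of 1 1 1 (-1) (-1) (-1) <;> simp [pi, r0, r1, r2, ha, hb, mul_assoc]
  · apply type_of 1 D.b 1 1 1 1 <;> simp [pi, r0, r1, r2, ha, hb, mul_assoc]
  · apply type_of 1 1 1 1 1 1 <;> simp [pi, r0, r1, r2, ha, hb, mul_assoc]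
  · apply type_of 1 D.a 1 (-1) (-1) (-1) <;> simp [pi, r0, r1, r2, ha, hb, mul_assoc]

lemma τ_τ : D.τ * D.τ = 1 := tau_tau

lemma Ext.type {n : Fin 6} {ε : ℤ} (hε : ε = 1 ∨ ε = -1) {δ : MulAut D.T} (h : D.Ext n ε δ) :
    D.HasType δ (pi n) := by
  rcases hε with rfl | rfl
  · exact h.type_one
  · have h1 := h.mul_τ
    rw [neg_neg] at h1
    have h2 := h1.type_one.mul hasType_τ
    rwa [mul_assoc, τ_τ, mul_one] at h2

lemma inn_mem (g : D.T) : MulAut.conj g ∈ Inn D.T := ⟨g, rfl⟩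

lemma hasType_inn {δ : MulAut D.T} (h : δ ∈ Inn D.T) : D.HasType δ id := by
  obtain ⟨g, rfl⟩ := h
  exact hasType_conj g

lemma transversal (N : Set (Fin 6)) (hext : ∀ n ∈ N, ∃ δ, D.Ext n 1 δ)
    (htype : ∀ δ π, D.HasType δ π → ∃ n ∈ N, pi n = π) (S : Set (Fin 6 × ℤ))
    (hS : ∀ p, p ∈ S ↔ p.1 ∈ N ∧ (p.2 = 1 ∨ p.2 = -1)) :
    IsPsiTransversal (D.n 2) (D.n 0) (D.n 1) S := by
  have hext' : ∀ p ∈ S, ∃ δ, D.Ext p.1 p.2 δ := by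
    rintro ⟨n, ε⟩ hp
    obtain ⟨hn, he⟩ := (hS _).mp hp
    obtain ⟨δ, hδ⟩ := hext n hn
    rcases he with he | he <;> simp only at he <;> subst he
    · exact ⟨δ, hδ⟩
    · exact ⟨_, hδ.mul_τ⟩
  refine ⟨hext', ?_⟩
  intro δ'
  obtain ⟨π, hπ⟩ := D.exists_type δ'
  apply existsUnique_of_exists_of_unique
  · obtain ⟨n, hn, rfl⟩ := htype δ' π hπ
    obtain ⟨δ, hδ⟩ := hext n hn
    obtain ⟨π', hπ'⟩ := D.exists_type δ⁻¹
    have h1 := hπ'.mul hδ.type_one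
    rw [inv_mul_cancel] at h1
    have h2 := h1.unique hasType_one
    have h3 := hπ'.mul hπ
    rw [h2] at h3
    obtain ⟨g, hg | hg⟩ := lemmaA h3
    · refine ⟨(n, 1), (hS _).mpr ⟨hn, Or.inl rfl⟩, δ, hδ, ?_⟩
      rw [hg]; exact inn_mem g
    · refine ⟨(n, -1), (hS _).mpr ⟨hn, Or.inr rfl⟩, δ * D.τ, hδ.mul_τ, ?_⟩
      have : (δ * D.τ)⁻¹ * δ' = D.τ⁻¹ * MulAut.conj g * (D.τ⁻¹)⁻¹ := by
        rw [mul_inv_rev, mul_assoc, hg]; group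
      rw [this]
      exact (Inn.normal _).conj_mem _ (inn_mem g) _
  · rintro ⟨n, ε⟩ ⟨n', ε'⟩ ⟨h1, δ, h2, h3⟩ ⟨h1', δ₁, h2', h3'⟩
    obtain ⟨hn, he⟩ := (hS _).mp h1
    obtain ⟨hn', he'⟩ := (hS _).mp h1'
    simp only at hn he hn' he'
    have h4 : δ⁻¹ * δ₁ ∈ Inn D.T := by
      have := mul_mem h3 (inv_mem h3')
      simpa [mul_assoc] using this
    have t1 : D.HasType δ (pi n) := Ext.type he h2
    have t2 : D.HasType δ₁ (pi n') := Ext.type he' h2'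
    have t3 := t1.mul (hasType_inn h4)
    rw [mul_inv_cancel_left] at t3
    have hnn : n = n' := pi_inj _ _ (t3.unique t2)
    subst hnn
    by_cases hee : ε = ε'
    · rw [hee]
    · exfalso
      have e3 : ε' = - ε := by omega
      subst e3
      have h5 : D.Ext n (-ε) (δ * D.τ) := Ext.mul_τ h2
      have h6 := h5.unique h2'
      rw [← h6, inv_mul_cancel_left] at h4
      exact τ_not_inner h4

lemma ext0 : D.Ext 0 1 1 := by
  rw [ext_iff]; simp

lemma ext3 (h : D.n 2 = D.n 0) : ∃ δ, D.Ext 3 1 δ := by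
  obtain ⟨δ, h1, h2⟩ := exists_tri_swap (k := D.n 1) h
  refine ⟨δ, (ext_iff _ _ _).mpr ⟨?_, ?_⟩⟩
  · simp only [zpow_one]; exact h1
  · simp only [zpow_one]; exact h2

lemma ext_flip {n : Fin 6} (h : ∃ δ, D.Ext n (-1) δ) : ∃ δ, D.Ext n 1 δ := by
  obtain ⟨δ, h⟩ := h
  exact ⟨_, h.mul_τ⟩

lemma ext_all (h : D.n 2 = D.n 0) (h' : D.n 2 = D.n 1) (n : Fin 6) : ∃ δ, D.Ext n 1 δ := by
  obtain ⟨s, s1, s2⟩ : ∃ δ : MulAut D.T, δ D.a = D.b ∧ δ D.b = D.a :=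
    exists_tri_swap (k := D.n 1) h
  obtain ⟨t, t1, t2⟩ : ∃ δ : MulAut D.T, δ D.a = D.a * D.b ∧ δ D.b = D.b⁻¹ :=
    exists_three (j := D.n 0) h'
  fin_cases n
  · exact ⟨1, ext0⟩
  · apply ext_flip
    refine ⟨MulAut.conj D.a * s * t * s, (ext_iff _ _ _).mpr ⟨?_, ?_⟩⟩ <;>
      simp [s1, s2, t1, t2, mul_assoc]
  · refine ⟨t, (ext_iff _ _ _).mpr ⟨?_, ?_⟩⟩ <;> simp [s1, s2, t1, t2, mul_assoc]
  · exact ext3 h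
  · apply ext_flip
    refine ⟨t * s, (ext_iff _ _ _).mpr ⟨?_, ?_⟩⟩ <;> simp [s1, s2, t1, t2, mul_assoc]
  · refine ⟨MulAut.conj D.a * s * t, (ext_iff _ _ _).mpr ⟨?_, ?_⟩⟩ <;>
      simp [s1, s2, t1, t2, mul_assoc]

end TD

lemma card_out {i j k : ℕ} {S : Set (Fin 6 × ℤ)} (h : IsPsiTransversal i j k S) :
    Nat.card (Out (TriangleGroup i j k)) = S.ncard := by
  obtain ⟨h1, h2⟩ := h
  choose δ hδ using h1
  have huniq : ∀ n ε (f g : MulAut (TriangleGroup i j k)), ExtendsPsi i j k n ε f →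
      ExtendsPsi i j k n ε g → f = g := by
    intro n ε f g hf hg
    exact aut_ext (hf.1.trans hg.1.symm) (hf.2.trans hg.2.symm)
  have hb : Function.Bijective
      (fun p : S => (QuotientGroup.mk (δ p.1 p.2) : Out (TriangleGroup i j k))) := by
    constructor
    · rintro ⟨p, hp⟩ ⟨q, hq⟩ hpq
      simp only [QuotientGroup.eq] at hpq
      have := (h2 (δ q hq)).unique ⟨hp, δ p hp, hδ p hp, hpq⟩
        ⟨hq, δ q hq, hδ q hq, by rw [inv_mul_cancel]; exact one_mem _⟩
      exact Subtype.ext this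
    · intro x
      obtain ⟨δ', rfl⟩ := QuotientGroup.mk_surjective x
      obtain ⟨p, hp, f, hf, hm⟩ := (h2 δ').exists
      refine ⟨⟨p, hp⟩, ?_⟩
      simp only [QuotientGroup.eq]
      rwa [huniq _ _ _ _ (hδ p hp) hf]
  rw [← Nat.card_congr (Equiv.ofBijective _ hb)]
  rfl

theorem lem_transversal (i j k : ℕ) (hi : 6 ≤ i) (hj : 6 ≤ j) (hk : 6 ≤ k) :
    (i ≠ j → j ≠ k → i ≠ k →
      IsPsiTransversal i j k {((0 : Fin 6), (1 : ℤ)), (0, -1)} ∧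
      Nat.card (Out (TriangleGroup i j k)) = 2) ∧
    (i = j → j ≠ k →
      IsPsiTransversal i j k {((0 : Fin 6), (1 : ℤ)), (0, -1), (3, 1), (3, -1)} ∧
      Nat.card (Out (TriangleGroup i j k)) = 4) ∧
    (i = j → j = k →
      IsPsiTransversal i j k {p : Fin 6 × ℤ | p.2 = 1 ∨ p.2 = -1} ∧
      Nat.card (Out (TriangleGroup i j k)) = 12) := by
  obtain ⟨D, hD⟩ := exists_TD i j k hi hj hk
  have d2 : i = D.n 2 := by rw [hD]; rfl
  have d0 : j = D.n 0 := by rw [hD]; rfl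
  have d1 : k = D.n 1 := by rw [hD]; rfl
  clear hD
  subst d2 d0 d1
  refine ⟨?_, ?_, ?_⟩
  · intro h1 h2 h3
    have ht : IsPsiTransversal (D.n 2) (D.n 0) (D.n 1) {((0 : Fin 6), (1 : ℤ)), (0, -1)} := by
      apply TD.transversal {0}
      · rintro n rfl
        exact ⟨1, TD.ext0⟩
      · intro δ π h
        refine ⟨0, rfl, ?_⟩
        obtain ⟨_, hn⟩ := h.inj
        have inj : ∀ p q, D.n p = D.n q → p = q := by
          intro p q
          fin_cases p <;> fin_cases q <;> simp [h1, h2, h3, h1.symm, h2.symm, h3.symm]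
        have : π = id := funext fun p => inj _ _ (hn p)
        rw [this]; decide
      · rintro ⟨n, ε⟩
        simp only [Set.mem_insert_iff, Set.mem_singleton_iff, Prod.mk.injEq]
        tauto
    refine ⟨ht, ?_⟩
    rw [card_out ht, Set.ncard_pair (by simp)]
  · intro h1 h2
    have ht : IsPsiTransversal (D.n 2) (D.n 0) (D.n 1)
        {((0 : Fin 6), (1 : ℤ)), (0, -1), (3, 1), (3, -1)} := by
      apply TD.transversal {0, 3}
      · rintro n (rfl | rfl)
        · exact ⟨1, TD.ext0⟩
        · exact TD.ext3 h1
      · intro δ π h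
        obtain ⟨hinj, hn⟩ := h.inj
        have h11 : π 1 = 1 := by
          have e := hn 1
          generalize π 1 = q at e
          fin_cases q
          · exact absurd e h2
          · rfl
          · exact absurd (h1.symm.trans e) h2
        rcases TD.pi_surj2 π hinj h11 with h | h
        · exact ⟨0, by simp, h⟩
        · exact ⟨3, by simp, h⟩
      · rintro ⟨n, ε⟩
        simp only [Set.mem_insert_iff, Set.mem_singleton_iff, Prod.mk.injEq]
        tauto
    refine ⟨ht, ?_⟩
    rw [card_out ht]
    have : ({((0 : Fin 6), (1 : ℤ)), (0, -1), (3, 1), (3, -1)} : Set (Fin 6 × ℤ)) =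
      (({(0, 1), (0, -1), (3, 1), (3, -1)} : Finset (Fin 6 × ℤ)) : Set (Fin 6 × ℤ)) := by simp
    rw [this, Set.ncard_coe_finset]; decide
  · intro h1 h2
    have ht : IsPsiTransversal (D.n 2) (D.n 0) (D.n 1) {p : Fin 6 × ℤ | p.2 = 1 ∨ p.2 = -1} := by
      apply TD.transversal Set.univ
      · intro n _
        exact TD.ext_all h1 (h1.trans h2) n
      · intro δ π h
        obtain ⟨n, hn⟩ := TD.pi_surj π h.inj.1
        exact ⟨n, trivial, hn⟩
      · rintro ⟨n, ε⟩
        simp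
    refine ⟨ht, ?_⟩
    rw [card_out ht]
    have : ({p : Fin 6 × ℤ | p.2 = 1 ∨ p.2 = -1} : Set (Fin 6 × ℤ)) =
      ((Finset.univ ×ˢ {1, -1} : Finset (Fin 6 × ℤ)) : Set (Fin 6 × ℤ)) := by
      ext ⟨n, ε⟩; simp
    rw [this, Set.ncard_coe_finset]; decide
end
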